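/- arXiv:1503.07603 — 3 statements merged into one kernel-verified Lean document; each statement's English description precedes it below -/
import Mathlib

section
/- Let k be a field with a fixed algebraic closure k̄, n ≥ 1, and f(X_0,X_1) ∈ k[X_0,X_1] a nonzero homogeneous polynomial of degree n+1. Let p(X) := f(X,1), s := (n+1) − deg p, C_f ∈ k^× the leading coefficient of p, and L := (k[X]/(p)) × (k[Y]/(Y^s)) with norm N_{L/k}. Let 𝒮_f be the set of pairs (M_0,M_1) of symmetric (n+1)×(n+1) matrices over k with det(X_0 M_0 + X_1 M_1) = f and rank(a M_0 + b M_1) ≥ n for all (a,b) ∈ k̄²∖{(0,0)}, on which SL_{n+1}(k) acts on the right by (M_0,M_1)·P := (PᵀM_0P, PᵀM_1P). Then there is a bijection between the set of orbits of this action on 𝒮_f and the quotient of the set {(u,α) ∈ k^× × L^× : C_f = (−1)^{n(n+1)/2}·u²·N_{L/k}(α)} by the equivalence relation (u,α) ∼ (N_{L/k}(β)^{−1}·u, β²·α) for β ∈ L^×. -/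
open Matrix Polynomial

/-- The dehomogenization `p(X) = f(X, 1)` of a bivariate polynomial `f`. -/
noncomputable def dehomog {k : Type*} [Field k] (f : MvPolynomial (Fin 2) k) :
    Polynomial k :=
  MvPolynomial.aeval ![Polynomial.X, 1] f

/-- The algebra `L = k[X]/(p) × k[Y]/(Y^s)` attached to a binary form `f` of degree `n+1`,
where `p = f(X,1)` and `s = (n+1) - deg p`. -/
noncomputable abbrev SegreAlgebra (k : Type*) [Field k] (n : ℕ)
    (f : MvPolynomial (Fin 2) k) : Type _ :=
  AdjoinRoot (dehomog f) ×
    AdjoinRoot ((Polynomial.X : Polynomial k) ^ (n + 1 - (dehomog f).natDegree))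

/-- The set `𝒮_f` of pairs of symmetric matrices with discriminant polynomial `f` whose
associated sheaf is free (regular pairs). -/
def RegularSymPairs (k : Type*) [Field k] (n : ℕ) (f : MvPolynomial (Fin 2) k) :
    Type _ :=
  {MM : Matrix (Fin (n + 1)) (Fin (n + 1)) k × Matrix (Fin (n + 1)) (Fin (n + 1)) k //
    MM.1.IsSymm ∧ MM.2.IsSymm ∧
    ((MvPolynomial.X 0 : MvPolynomial (Fin 2) k) •
        MM.1.map (MvPolynomial.C : k → MvPolynomial (Fin 2) k)
      + (MvPolynomial.X 1 : MvPolynomial (Fin 2) k) •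
        MM.2.map (MvPolynomial.C : k → MvPolynomial (Fin 2) k)).det = f ∧
    ∀ a b : AlgebraicClosure k, (a, b) ≠ (0, 0) →
      n ≤ (a • MM.1.map (algebraMap k (AlgebraicClosure k))
        + b • MM.2.map (algebraMap k (AlgebraicClosure k))).rank}

/-- Two pairs are related iff one is obtained from the other by the right action
`(M₀, M₁) · P = (PᵀM₀P, PᵀM₁P)` of `SL_{n+1}(k)`. -/
def SLRel (k : Type*) [Field k] (n : ℕ) (f : MvPolynomial (Fin 2) k)
    (M M' : RegularSymPairs k n f) : Prop :=
  ∃ P : Matrix (Fin (n + 1)) (Fin (n + 1)) k, P.det = 1 ∧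
    M'.1.1 = Pᵀ * M.1.1 * P ∧ M'.1.2 = Pᵀ * M.1.2 * P

/-- The set of pairs `(u, α) ∈ k^× × L^×` satisfying the norm condition
`C_f = (-1)^{n(n+1)/2} u² N_{L/k}(α)`. -/
noncomputable def NormPairs (k : Type*) [Field k] (n : ℕ)
    (f : MvPolynomial (Fin 2) k) : Type _ :=
  {ua : kˣ × (SegreAlgebra k n f)ˣ //
    (dehomog f).leadingCoeff =
      (-1 : k) ^ (n * (n + 1) / 2) * ((ua.1 : k)) ^ 2 *
        Algebra.norm k ((ua.2 : SegreAlgebra k n f))}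

/-- `(u, α) ∼ (N_{L/k}(β)⁻¹ · u, β² · α)` for `β ∈ L^×`. -/
noncomputable def NormRel (k : Type*) [Field k] (n : ℕ)
    (f : MvPolynomial (Fin 2) k) (x y : NormPairs k n f) : Prop :=
  ∃ β : (SegreAlgebra k n f)ˣ,
    y.1.1 = (Units.map (Algebra.norm k : SegreAlgebra k n f →* k) β)⁻¹ * x.1.1 ∧
    y.1.2 = β ^ 2 * x.1.2


section Concrete

variable {k : Type*} [Field k]

theorem aeval_homog_sum {f : MvPolynomial (Fin 2) k} {N : ℕ} (hf : f.IsHomogeneous N)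
    {S : Type*} [CommRing S] [Algebra k S] (r t : S) :
    MvPolynomial.aeval ![r, t] f =
      ∑ i ∈ Finset.range (N + 1), algebraMap k S ((dehomog f).coeff i) * r ^ i * t ^ (N - i) := by
  have hdeg : ∀ d ∈ f.support, d 0 + d 1 = N := by
    intro d hd
    by_contra h
    apply MvPolynomial.mem_support_iff.1 hd
    apply hf.coeff_eq_zero
    rwa [Finsupp.degree_eq_sum, Fin.sum_univ_two]
  have hc : ∀ i, (dehomog f).coeff i = ∑ d ∈ f.support, if d 0 = i then f.coeff d else 0 := by
    intro i
    rw [dehomog, MvPolynomial.aeval_def, MvPolynomial.eval₂_eq', Polynomial.finsetSum_coeff]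
    refine Finset.sum_congr rfl fun d _ => ?_
    simp only [Fin.prod_univ_two, Matrix.cons_val_zero, Matrix.cons_val_one, one_pow, mul_one,
      Polynomial.algebraMap_eq, Polynomial.coeff_C_mul, Polynomial.coeff_X_pow, mul_ite, mul_zero]
    simp only [eq_comm]
  rw [MvPolynomial.aeval_def, MvPolynomial.eval₂_eq']
  simp only [hc, map_sum, Finset.sum_mul]
  rw [Finset.sum_comm]
  refine Finset.sum_congr rfl fun d hd => ?_
  have h := hdeg d hd
  rw [Finset.sum_eq_single (d 0)]
  · have : N - d 0 = d 1 := by omega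
    simp [Fin.prod_univ_two, this, mul_assoc]
  · intro i _ hi
    simp [Ne.symm hi]
  · intro hi
    simp at hi
    omega

theorem homog_eq_of_dehomog {f g : MvPolynomial (Fin 2) k} {N : ℕ} (hf : f.IsHomogeneous N)
    (hg : g.IsHomogeneous N) (h : dehomog f = dehomog g) : f = g := by
  have h1 := aeval_homog_sum hf (MvPolynomial.X 0 : MvPolynomial (Fin 2) k) (MvPolynomial.X 1)
  have h2 := aeval_homog_sum hg (MvPolynomial.X 0 : MvPolynomial (Fin 2) k) (MvPolynomial.X 1)
  have h3 : (![MvPolynomial.X 0, MvPolynomial.X 1] : Fin 2 → MvPolynomial (Fin 2) k)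
      = MvPolynomial.X := by
    funext i; fin_cases i <;> rfl
  rw [h3, MvPolynomial.aeval_X_left, AlgHom.id_apply] at h1 h2
  rw [h1, h2, h]

theorem dehomog_ne_zero {f : MvPolynomial (Fin 2) k} {N : ℕ} (hf : f.IsHomogeneous N)
    (h0 : f ≠ 0) : dehomog f ≠ 0 := fun h =>
  h0 (homog_eq_of_dehomog hf (MvPolynomial.isHomogeneous_zero _ _ _) (by rw [h]; simp [dehomog]))

theorem dehomog_natDegree_le {f : MvPolynomial (Fin 2) k} {N : ℕ} (hf : f.IsHomogeneous N) :
    (dehomog f).natDegree ≤ N := by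
  have h := aeval_homog_sum hf (X : k[X]) 1
  rw [← dehomog] at h
  rw [h]
  refine Polynomial.natDegree_sum_le_of_forall_le _ _ fun i hi => ?_
  simp only [one_pow, mul_one, Polynomial.algebraMap_eq]
  refine (Polynomial.natDegree_C_mul_X_pow_le _ _).trans ?_
  simp at hi; omega

theorem rev_dehomog_ne_zero {f : MvPolynomial (Fin 2) k} {N : ℕ} (hf : f.IsHomogeneous N)
    (h0 : f ≠ 0) : MvPolynomial.aeval ![(1 : k[X]), X] f ≠ 0 := by
  intro h
  apply dehomog_ne_zero hf h0
  rw [aeval_homog_sum hf] at h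
  ext i
  by_cases hi : i ≤ N
  · have := congrArg (fun q => Polynomial.coeff q (N - i)) h
    simp only [one_pow, mul_one, Polynomial.algebraMap_eq, Polynomial.finsetSum_coeff,
      Polynomial.coeff_C_mul, Polynomial.coeff_X_pow, mul_ite, mul_zero, Polynomial.coeff_zero]
      at this
    rw [Finset.sum_eq_single i] at this
    · simpa using this
    · intro j hj hji
      simp at hj
      rw [if_neg (by omega)]
    · intro hh; simp at hh; omega
  · rw [Polynomial.coeff_eq_zero_of_natDegree_lt]
    · simp
    · have := dehomog_natDegree_le hf; omega

theorem aeval_eq_zero_L {f : MvPolynomial (Fin 2) k} {N : ℕ} (hf : f.IsHomogeneous N) :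
    MvPolynomial.aeval ![((AdjoinRoot.root (dehomog f), 1) : AdjoinRoot (dehomog f) ×
      AdjoinRoot ((X : k[X]) ^ (N - (dehomog f).natDegree))), (1, AdjoinRoot.root _)] f = 0 := by
  apply Prod.ext
  · have h1 := congrArg (AlgHom.fst k (AdjoinRoot (dehomog f))
      (AdjoinRoot ((X : k[X]) ^ (N - (dehomog f).natDegree)))) 
        (aeval_homog_sum hf ((AdjoinRoot.root (dehomog f), 1) : AdjoinRoot (dehomog f) ×
      AdjoinRoot ((X : k[X]) ^ (N - (dehomog f).natDegree))) (1, AdjoinRoot.root _))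
    have h2 := congrArg (Polynomial.aeval (AdjoinRoot.root (dehomog f)))
      (aeval_homog_sum hf (X : k[X]) 1)
    rw [← dehomog, AdjoinRoot.aeval_eq, AdjoinRoot.mk_self] at h2
    simp only [map_sum, map_mul, map_pow, AlgHom.commutes, AlgHom.fst_apply] at h1
    simp only [map_sum, map_mul, map_pow, Polynomial.algebraMap_eq, Polynomial.aeval_C, map_one,
      Polynomial.aeval_X] at h2
    exact h1.trans h2.symm
  · have h1 := congrArg (AlgHom.snd k (AdjoinRoot (dehomog f))
      (AdjoinRoot ((X : k[X]) ^ (N - (dehomog f).natDegree)))) 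
        (aeval_homog_sum hf ((AdjoinRoot.root (dehomog f), 1) : AdjoinRoot (dehomog f) ×
      AdjoinRoot ((X : k[X]) ^ (N - (dehomog f).natDegree))) (1, AdjoinRoot.root _))
    simp only [map_sum, map_mul, map_pow, AlgHom.commutes, AlgHom.snd_apply] at h1
    refine h1.trans (Finset.sum_eq_zero fun i hi => ?_)
    by_cases h : i ≤ (dehomog f).natDegree
    · have hy : (AdjoinRoot.root ((X : k[X]) ^ (N - (dehomog f).natDegree)))
          ^ (N - (dehomog f).natDegree) = 0 := by
        rw [← AdjoinRoot.mk_X, ← map_pow, AdjoinRoot.mk_self]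
      rw [pow_eq_zero_of_le (by omega) hy, mul_zero]
    · rw [Polynomial.coeff_eq_zero_of_natDegree_lt (by omega)]
      simp

theorem root_pow_eq_zero (s : ℕ) : (AdjoinRoot.root ((X : k[X]) ^ s)) ^ s = 0 := by
  rw [← AdjoinRoot.mk_X, ← map_pow, AdjoinRoot.mk_self]

/-- linear induction on `AdjoinRoot` -/
theorem adjoin_ind {q : k[X]} {M : Type*} [AddCommGroup M] [Module k M]
    (T : AdjoinRoot q →ₗ[k] M) (h : ∀ j : ℕ, T (AdjoinRoot.root q ^ j) = 0) : T = 0 := by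
  ext z
  induction z using AdjoinRoot.induction_on with
  | ih r =>
    rw [← AdjoinRoot.aeval_eq, Polynomial.aeval_eq_sum_range]
    simp [h]

theorem comm_mul {q : k[X]} (T : AdjoinRoot q →ₗ[k] AdjoinRoot q)
    (h : ∀ z, T (AdjoinRoot.root q * z) = AdjoinRoot.root q * T z) (z) : T z = T 1 * z := by
  have := adjoin_ind (T - LinearMap.mulLeft k (T 1)) (by
    intro j
    induction j with
    | zero => simp
    | succ j ih =>
      simp only [LinearMap.sub_apply, LinearMap.mulLeft_apply, sub_eq_zero] at ih ⊢
      rw [pow_succ', h, ih]; ring)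
  have := congrArg (fun F => F z) this
  simpa [sub_eq_zero] using this

variable (p : k[X]) (s : ℕ)

local notation "LL" => (AdjoinRoot p × AdjoinRoot ((X : k[X]) ^ s))

noncomputable def xiL : LL := (AdjoinRoot.root p, 1)
noncomputable def etaL : LL := (1, AdjoinRoot.root _)

theorem commL (A : LL →ₗ[k] LL) (h : ∀ z, etaL p s * A (xiL p s * z) = xiL p s * A (etaL p s * z))
    (z : LL) : A z = A 1 * z := by
  have h11 : ∀ z1, (A (AdjoinRoot.root p * z1, 0)).1 = AdjoinRoot.root p * (A (z1, 0)).1 := by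
    intro z1
    have := congrArg Prod.fst (h (z1, 0))
    simpa [xiL, etaL] using this
  have h21 : ∀ z1, (A (z1, 0)).2 = AdjoinRoot.root _ * (A (AdjoinRoot.root p * z1, 0)).2 := by
    intro z1
    have := congrArg Prod.snd (h (z1, 0))
    simpa [xiL, etaL] using this.symm
  have h12 : ∀ z2, (A (0, z2)).1 = AdjoinRoot.root _ * (A (0, AdjoinRoot.root _ * z2)).1 := by
    intro z2
    have := congrArg Prod.fst (h (0, z2))
    simpa [xiL, etaL] using this
  have h22 : ∀ z2, (A (0, AdjoinRoot.root _ * z2)).2 = AdjoinRoot.root _ * (A (0, z2)).2 := by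
    intro z2
    have := congrArg Prod.snd (h (0, z2))
    simpa [xiL, etaL] using this.symm
  have k21 : ∀ (j : ℕ) z1, (A (z1, 0)).2 = AdjoinRoot.root _ ^ j * (A (AdjoinRoot.root p ^ j * z1, 0)).2 := by
    intro j
    induction j with
    | zero => simp
    | succ j ih => 
      intro z1
      rw [ih, h21, pow_succ, pow_succ', mul_assoc, mul_assoc]
  have k12 : ∀ (j : ℕ) z2, (A (0, z2)).1 = AdjoinRoot.root _ ^ j * (A (0, AdjoinRoot.root _ ^ j * z2)).1 := by
    intro j
    induction j with
    | zero => simp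
    | succ j ih => 
      intro z1
      rw [ih, h12, pow_succ, pow_succ', mul_assoc, mul_assoc]
  have z21 : ∀ z1, (A (z1, 0)).2 = 0 := by
    intro z1
    rw [k21 s, root_pow_eq_zero, zero_mul]
  have z12 : ∀ z2, (A (0, z2)).1 = 0 := by
    intro z1
    rw [k12 s, root_pow_eq_zero, zero_mul]
    have : ((0, 0) : LL) = 0 := rfl
    rw [this, map_zero]; simp
  have m1 := comm_mul (LinearMap.fst k _ _ ∘ₗ A ∘ₗ LinearMap.inl k _ _) (by simpa using h11)
  have m2 := comm_mul (LinearMap.snd k _ _ ∘ₗ A ∘ₗ LinearMap.inr k _ _) (by simpa using h22)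
  simp only [LinearMap.comp_apply, LinearMap.fst_apply, LinearMap.snd_apply, LinearMap.inl_apply,
    LinearMap.inr_apply] at m1 m2
  have dec : ∀ z : LL, A z = A (z.1, 0) + A (0, z.2) := by
    intro z
    rw [← map_add]; simp
  rw [dec z, dec 1]
  apply Prod.ext
  · simp [z12, m1 z.1]
  · simp [z21, m2 z.2]

theorem unimodL : ∃ c c' : LL, c * xiL p s + c' * etaL p s = 1 :=
  ⟨(0, 1), (1, 0), by simp [xiL, etaL]⟩

/-- functionals killed by a member of the pencil -/
theorem functL {K : Type*} [Field K] [Algebra k K] (a b : K) (hab : (a, b) ≠ (0, 0)) :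
    ∃ e : LL, ∀ w : LL →ₗ[k] K, (∀ z, a * w (etaL p s * z) = b * w (xiL p s * z)) → w e = 0 → w = 0 := by
  have dec : ∀ (w : LL →ₗ[k] K), (∀ j : ℕ, w (AdjoinRoot.root p ^ j, 0) = 0) → 
      (∀ j : ℕ, w (0, AdjoinRoot.root _ ^ j) = 0) → w = 0 := by
    intro w h1 h2
    have e1 := adjoin_ind (w ∘ₗ LinearMap.inl k _ _) (by simpa using h1)
    have e2 := adjoin_ind (w ∘ₗ LinearMap.inr k _ _) (by simpa using h2)
    apply LinearMap.prod_ext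
    · simpa using e1
    · simpa using e2
  by_cases hb : b = 0
  · have ha : a ≠ 0 := by rintro rfl; exact hab (by rw [hb])
    refine ⟨(0, 1), fun w hw h0 => dec w (fun j => ?_) (fun j => ?_)⟩
    · have := hw (AdjoinRoot.root p ^ j, 0)
      simpa [hb, ha, etaL] using this
    · cases j with
      | zero => simpa using h0
      | succ j =>
        have := hw (0, AdjoinRoot.root _ ^ j)
        simpa [hb, ha, etaL, ← pow_succ'] using this
  · refine ⟨(1, 0), fun w hw h0 => dec w (fun j => ?_) (fun j => ?_)⟩
    · induction j with
      | zero => simpa using h0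
      | succ j ih =>
        have := hw (AdjoinRoot.root p ^ j, 0)
        simp [etaL, xiL, ih, hb] at this
        simpa [pow_succ'] using this
    · have key : ∀ i j : ℕ, s ≤ j + i → w (0, AdjoinRoot.root _ ^ j) = 0 := by
        intro i
        induction i with
        | zero =>
          intro j hj
          rw [pow_eq_zero_of_le (by omega) (root_pow_eq_zero s)]
          exact map_zero w
        | succ i ih =>
          intro j hj
          have := hw (0, AdjoinRoot.root _ ^ j)
          have h2 := ih (j + 1) (by omega)
          rw [pow_succ'] at h2
          simpa [etaL, xiL, h2, hb] using this
      exact key s j (by omega)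

/-- the chain argument -/
theorem chainL {N : ℕ} (M0 M1 : Matrix (Fin N) (Fin N) k)
    (hdet : (M0.map (Polynomial.C : k → k[X]) + (X : k[X]) • M1.map (Polynomial.C : k → k[X])).det ≠ 0)
    (Q : LL →ₗ[k] (Fin N → k))
    (hQ : ∀ z, M0 *ᵥ Q (xiL p s * z) + M1 *ᵥ Q (etaL p s * z) = 0) (z : LL)
    (hz : M0 *ᵥ Q (z.1, 0) - M1 *ᵥ Q (0, z.2) = 0) (w : LL) : Q (w * z) = 0 := by
  set c : ℕ → (Fin N → k) := fun j => if j ≤ s then Q (0, AdjoinRoot.root _ ^ (s - j) * z.2)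
    else - Q (AdjoinRoot.root p ^ (j - s - 1) * z.1, 0) with hc
  have c0 : c 0 = 0 := by
    simp only [hc, Nat.zero_le, if_true, Nat.sub_zero, root_pow_eq_zero, zero_mul]
    exact map_zero Q
  have crec : ∀ j, M0 *ᵥ c (j + 1) + M1 *ᵥ c j = 0 := by
    intro j
    rcases lt_trichotomy j s with h | h | h
    · have := hQ (0, AdjoinRoot.root _ ^ (s - j - 1) * z.2)
      have e : s - j = (s - j - 1) + 1 := by omega
      have e' : s - (j + 1) = s - j - 1 := by omega
      simp only [hc]
      rw [if_pos (by omega), if_pos (by omega), e, pow_succ', e', mul_assoc]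
      simpa [xiL, etaL] using this
    · subst h
      simp only [hc]
      rw [if_neg (by omega), if_pos le_rfl]
      rw [sub_eq_zero] at hz
      simp [Matrix.mulVec_neg, hz]
    · have := hQ (AdjoinRoot.root p ^ (j - s - 1) * z.1, 0)
      have e : j + 1 - s - 1 = (j - s - 1) + 1 := by omega
      simp only [hc]
      rw [if_neg (by omega), if_neg (by omega), e, pow_succ', mul_assoc]
      rw [Matrix.mulVec_neg, Matrix.mulVec_neg, ← neg_add, neg_eq_zero]
      simpa [xiL, etaL] using this
  have czero : ∀ j, c j = 0 := by
    have hN : ((M0.map (Polynomial.C : k → k[X]) + (X : k[X]) • M1.map (Polynomial.C : k → k[X])).map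
        (Polynomial.coeToPowerSeries.ringHom : k[X] →+* PowerSeries k)).det ≠ 0 := by
      rw [← RingHom.mapMatrix_apply, ← RingHom.map_det]
      intro h
      apply hdet
      apply Polynomial.coe_injective k
      simpa using h
    have := Matrix.eq_zero_of_mulVec_eq_zero hN (v := fun i => PowerSeries.mk fun j => c j i) (by
      ext i j
      simp only [Matrix.mulVec, dotProduct, map_sum, Matrix.map_apply, Matrix.add_apply,
        Matrix.smul_apply, map_add, smul_eq_mul, map_mul, Polynomial.coeToPowerSeries.ringHom_apply,
        Polynomial.coe_C, Polynomial.coe_X, add_mul, mul_assoc, PowerSeries.coeff_C_mul, 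
        PowerSeries.coeff_mk, Finset.sum_add_distrib]
      cases j with
      | zero =>
        simp [c0]
      | succ j =>
        simp only [PowerSeries.coeff_succ_X_mul, PowerSeries.coeff_C_mul, PowerSeries.coeff_mk]
        exact congrFun (crec j) i)
    intro j
    ext i
    have := congrArg (PowerSeries.coeff j) (congrFun this i)
    simpa using this
  have q1 : ∀ j : ℕ, Q (AdjoinRoot.root p ^ j * z.1, 0) = 0 := by
    intro j
    have := czero (s + 1 + j)
    simp only [hc] at this
    rw [if_neg (by omega), show s + 1 + j - s - 1 = j by omega] at this
    simpa using this
  have q2 : ∀ j : ℕ, Q (0, AdjoinRoot.root _ ^ j * z.2) = 0 := by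
    intro j
    by_cases hj : j ≤ s
    · have := czero (s - j)
      simp only [hc] at this
      rwa [if_pos (by omega), show s - (s - j) = j by omega] at this
    · rw [pow_eq_zero_of_le (by omega : s ≤ j) (root_pow_eq_zero s), zero_mul]
      exact map_zero Q
  have e1 := adjoin_ind (Q ∘ₗ LinearMap.inl k _ _ ∘ₗ LinearMap.mulRight k z.1) (by simpa using q1)
  have e2 := adjoin_ind (Q ∘ₗ LinearMap.inr k _ _ ∘ₗ LinearMap.mulRight k z.2) (by simpa using q2)
  have e1 := congrArg (fun F => F w.1) e1
  have e2 := congrArg (fun F => F w.2) e2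
  simp at e1 e2
  have : w * z = (w.1 * z.1, 0) + (0, w.2 * z.2) := by
    apply Prod.ext <;> simp
  rw [this, map_add, e1, e2, add_zero]

end Concrete


section MatrixLemmas

theorem adjugate_ne_zero_of_rank {K : Type*} [Field K] {n : ℕ}
    (A : Matrix (Fin (n + 1)) (Fin (n + 1)) K) (h : n ≤ A.rank) : A.adjugate ≠ 0 := by
  classical
  obtain ⟨L, L', D, hD⟩ := Matrix.Pivot.exists_list_transvec_mul_mul_list_transvec_eq_diagonal A
  set U := (List.map Matrix.TransvectionStruct.toMatrix L).prod
  set U' := (List.map Matrix.TransvectionStruct.toMatrix L').prod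
  have hU : U.det = 1 := Matrix.TransvectionStruct.det_toMatrix_prod L
  have hU' : U'.det = 1 := Matrix.TransvectionStruct.det_toMatrix_prod L'
  have hr : (Matrix.diagonal D).rank = A.rank := by
    rw [← hD, Matrix.rank_mul_eq_left_of_isUnit_det _ _ (by simp [hU']),
      Matrix.rank_mul_eq_right_of_isUnit_det _ _ (by simp [hU])]
  intro h0
  have h1 : (Matrix.diagonal D).adjugate = 0 := by
    rw [← hD, Matrix.adjugate_mul_distrib, Matrix.adjugate_mul_distrib, h0]; simp
  rw [Matrix.adjugate_diagonal] at h1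
  rw [← hr, Matrix.rank_diagonal] at h
  have hall : ∀ i, ∃ j, j ≠ i ∧ D j = 0 := by
    intro i
    have := congrFun (congrFun h1 i) i
    simp only [Matrix.diagonal_apply_eq, Matrix.zero_apply, Finset.prod_eq_zero_iff,
      Finset.mem_erase, Finset.mem_univ, and_true] at this
    exact this
  obtain ⟨j, -, hj⟩ := hall 0
  obtain ⟨j', hj', hj'0⟩ := hall j
  have hc : Fintype.card {i // D i ≠ 0} ≤ (({j, j'} : Finset (Fin (n+1)))ᶜ).card := by
    rw [Fintype.card_subtype]
    apply Finset.card_le_card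
    intro i hi
    simp at hi ⊢
    constructor <;> rintro rfl <;> contradiction
  rw [Finset.card_compl, Finset.card_pair hj'.symm, Fintype.card_fin] at hc
  have h2 := j.2
  have h3 := j'.2
  have h4 : (j' : ℕ) ≠ j := fun h => hj' (Fin.ext h)
  have h5 : n ≤ n + 1 - 2 := h.trans hc
  omega

/-- Over a ring with finitely many maximal ideals, if the entries of a matrix generate the unit
ideal then some combination of the columns is faithful. -/
theorem exists_faithful {L : Type*} [CommRing L] [Finite (MaximalSpectrum L)] {N : ℕ}
    (B : Matrix (Fin N) (Fin N) L)
    (h : ∀ m : Ideal L, m.IsMaximal → ∃ i j, B i j ∉ m) :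
    ∃ g : Fin N → L, ∀ z : L, (∀ i, z * (B *ᵥ g) i = 0) → z = 0 := by
  classical
  choose I J hIJ using fun m : MaximalSpectrum L => h m.asIdeal m.isMaximal
  have hcop : Pairwise (Function.onFun IsCoprime (fun m : MaximalSpectrum L => m.asIdeal)) := by
    intro m m' hne
    simp only [Function.onFun]
    rw [Ideal.isCoprime_iff_sup_eq]
    exact m.isMaximal.coprime_of_ne m'.isMaximal (fun h => hne (MaximalSpectrum.ext h))
  choose g hg using fun j : Fin N => Ideal.exists_forall_sub_mem_ideal hcop
    (fun m => if j = J m then (1 : L) else 0)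
  refine ⟨g, fun z hz => ?_⟩
  have htop : Ideal.span (Set.range (B *ᵥ g)) = ⊤ := by
    by_contra hne
    obtain ⟨m, hm, hle⟩ := Ideal.exists_le_maximal _ hne
    apply hIJ ⟨m, hm⟩
    have h1 : (B *ᵥ g) (I ⟨m, hm⟩) ∈ m := hle (Ideal.subset_span ⟨_, rfl⟩)
    have h2 : (B *ᵥ g) (I ⟨m, hm⟩) - B (I ⟨m, hm⟩) (J ⟨m, hm⟩) ∈ m := by
      have : (B *ᵥ g) (I ⟨m, hm⟩) - B (I ⟨m, hm⟩) (J ⟨m, hm⟩) =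
        ∑ j, B (I ⟨m, hm⟩) j * (g j - if j = J ⟨m, hm⟩ then 1 else 0) := by
        simp [Matrix.mulVec, dotProduct, mul_sub, Finset.sum_sub_distrib]
      rw [this]
      exact Ideal.sum_mem _ fun j _ => Ideal.mul_mem_left _ _ (hg j ⟨m, hm⟩)
    have := m.sub_mem h1 h2
    simpa using this
  have h1 : (1 : L) ∈ Ideal.span (Set.range (B *ᵥ g)) := by rw [htop]; trivial
  have : ∀ y ∈ Ideal.span (Set.range (B *ᵥ g)), z * y = 0 := by
    intro y hy
    induction hy using Submodule.span_induction with
    | mem y hy => obtain ⟨i, rfl⟩ := hy; exact hz i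
    | zero => simp
    | add a b _ _ ha hb => rw [mul_add, ha, hb, add_zero]
    | smul a b _ hb => rw [smul_eq_mul, mul_left_comm, hb, mul_zero]
  simpa using this 1 h1

theorem hankel_det {k : Type*} [CommRing k] (d : ℕ) : ∀ (h : ℕ → k), (∀ m, m + 1 < d → h m = 0) →
    (∀ m, m + 1 = d → h m = 1) →
    (Matrix.of fun i j : Fin d => h (i + j)).det = (-1) ^ (∑ i ∈ Finset.range d, i) := by
  induction d with
  | zero => intro h _ _; simp
  | succ d ih =>
    intro h h0 h1
    rw [Matrix.det_succ_row_zero, Finset.sum_eq_single (Fin.last d)]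
    · have := ih (fun m => h (m + 1)) (fun m hm => h0 _ (by omega)) (fun m hm => h1 _ (by omega))
      have e : (Matrix.of fun i j : Fin (d + 1) => h (i + j)).submatrix Fin.succ
          (Fin.last d).succAbove = Matrix.of fun i j : Fin d => h (i + j + 1) := by
        ext i j
        simp only [Matrix.submatrix_apply, Matrix.of_apply, Fin.succAbove_last, Fin.val_succ,
          Fin.val_castSucc]
        congr 1; ring
      rw [e, this, Finset.sum_range_succ, pow_add]
      simp [h1]; ring
    · intro j _ hj
      have : (j : ℕ) < d := by
        have := Fin.val_lt_last hj; exact this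
      simp [h0 j (by omega)]
    · simp

theorem aeval_det {k : Type*} [Field k] {S : Type*} [CommRing S] [Algebra k S] {ι : Type*} [Fintype ι]
    [DecidableEq ι] (A B : Matrix ι ι k) (r t : S) :
    MvPolynomial.aeval ![r, t] ((MvPolynomial.X 0 : MvPolynomial (Fin 2) k) •
        A.map (MvPolynomial.C : k → MvPolynomial (Fin 2) k)
      + (MvPolynomial.X 1 : MvPolynomial (Fin 2) k) •
        B.map (MvPolynomial.C : k → MvPolynomial (Fin 2) k)).det =
      (r • A.map (algebraMap k S) + t • B.map (algebraMap k S)).det := by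
  rw [AlgHom.map_det]
  congr 1
  ext i j
  simp [MvPolynomial.algHom_C]

theorem det_homog {k : Type*} [Field k] {ι : Type*} [Fintype ι]
    [DecidableEq ι] (A B : Matrix ι ι k) :
    ((MvPolynomial.X 0 : MvPolynomial (Fin 2) k) •
        A.map (MvPolynomial.C : k → MvPolynomial (Fin 2) k)
      + (MvPolynomial.X 1 : MvPolynomial (Fin 2) k) •
        B.map (MvPolynomial.C : k → MvPolynomial (Fin 2) k)).det.IsHomogeneous (Fintype.card ι) := by
  rw [Matrix.det_apply]
  refine MvPolynomial.IsHomogeneous.sum _ _ _ fun σ _ => ?_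
  have h1 : (∏ i, ((MvPolynomial.X 0 : MvPolynomial (Fin 2) k) •
        A.map (MvPolynomial.C : k → MvPolynomial (Fin 2) k)
      + (MvPolynomial.X 1 : MvPolynomial (Fin 2) k) •
        B.map (MvPolynomial.C : k → MvPolynomial (Fin 2) k)) (σ i) i).IsHomogeneous
      (Fintype.card ι) := by
    have := MvPolynomial.IsHomogeneous.prod (R := k) (σ := Fin 2) Finset.univ (fun i => 
      ((MvPolynomial.X 0 : MvPolynomial (Fin 2) k) •
        A.map (MvPolynomial.C : k → MvPolynomial (Fin 2) k)
      + (MvPolynomial.X 1 : MvPolynomial (Fin 2) k) •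
        B.map (MvPolynomial.C : k → MvPolynomial (Fin 2) k)) (σ i) i) (fun _ : ι => 1) (by
        intro i _
        simp only [Matrix.add_apply, Matrix.smul_apply, Matrix.map_apply, smul_eq_mul]
        refine MvPolynomial.IsHomogeneous.add ?_ ?_
        · exact (MvPolynomial.isHomogeneous_X k (0 : Fin 2)).mul (MvPolynomial.isHomogeneous_C _ _)
        · exact (MvPolynomial.isHomogeneous_X k (1 : Fin 2)).mul (MvPolynomial.isHomogeneous_C _ _))
    simpa using this
  rcases Int.units_eq_one_or (Equiv.Perm.sign σ) with h | h
  · rw [h, one_smul]; exact h1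
  · rw [h, Units.neg_smul, one_smul]; exact h1.neg

end MatrixLemmas


section Frob

variable {k : Type*} [Field k]

theorem exists_tau {q : k[X]} (hq : q ≠ 0) : ∃ τ : AdjoinRoot q →ₗ[k] k,
    (∀ m, m + 1 < q.natDegree → τ (AdjoinRoot.root q ^ m) = 0) ∧
    (∀ m, m + 1 = q.natDegree → τ (AdjoinRoot.root q ^ m) = 1) := by
  let pb := AdjoinRoot.powerBasis hq
  have hdim : pb.dim = q.natDegree := rfl
  let τ : AdjoinRoot q →ₗ[k] k := pb.basis.constr k (fun i => if (i : ℕ) + 1 = q.natDegree then 1 else 0)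
  have key : ∀ m, m < q.natDegree → τ (AdjoinRoot.root q ^ m) = if m + 1 = q.natDegree then 1 else 0 := by
    intro m hm
    have : AdjoinRoot.root q ^ m = pb.basis ⟨m, hm⟩ := by
      rw [pb.basis_eq_pow]; rfl
    rw [this, Module.Basis.constr_basis]
  refine ⟨τ, fun m hm => ?_, fun m hm => ?_⟩
  · rw [key m (by omega), if_neg (by omega)]
  · rw [key m (by omega), if_pos hm]

theorem leftMul_prod {S T : Type*} [CommRing S] [CommRing T] [Algebra k S] [Algebra k T]
    {ι κ : Type*} [Fintype ι] [Fintype κ] [DecidableEq ι] [DecidableEq κ]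
    (b : Module.Basis ι k S) (c : Module.Basis κ k T) (z : S × T) :
    Algebra.leftMulMatrix (b.prod c) z =
      Matrix.fromBlocks (Algebra.leftMulMatrix b z.1) 0 0 (Algebra.leftMulMatrix c z.2) := by
  ext i j
  rw [Algebra.leftMulMatrix_eq_repr_mul]
  rcases i with i | i <;> rcases j with j | j <;>
    simp [Algebra.leftMulMatrix_eq_repr_mul, Module.Basis.prod_apply]

theorem det_formula (n : ℕ) (f : MvPolynomial (Fin 2) k) (hf0 : f ≠ 0)
    (hfh : f.IsHomogeneous (n + 1)) :
    ∃ (b : Module.Basis (Fin (n + 1)) k (SegreAlgebra k n f)) (ℓ : SegreAlgebra k n f →ₗ[k] k),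
      MvPolynomial.C ((dehomog f).leadingCoeff * (Matrix.of fun i j => ℓ (b i * b j)).det) *
      ((MvPolynomial.X 0 : MvPolynomial (Fin 2) k) •
        (Algebra.leftMulMatrix b (etaL _ _)).map (MvPolynomial.C : k → MvPolynomial (Fin 2) k)
      + (MvPolynomial.X 1 : MvPolynomial (Fin 2) k) •
        (Algebra.leftMulMatrix b (-xiL _ _)).map (MvPolynomial.C : k → MvPolynomial (Fin 2) k)).det
      = MvPolynomial.C ((-1) ^ (n * (n + 1) / 2)) * f := by
  classical
  have hp := dehomog_ne_zero hfh hf0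
  have hd := dehomog_natDegree_le hfh
  unfold SegreAlgebra
  generalize hpp : dehomog f = p at *
  obtain ⟨s, hs⟩ : ∃ s, n + 1 = p.natDegree + s := ⟨n + 1 - p.natDegree, by omega⟩
  have hs' : n + 1 - p.natDegree = s := by omega
  rw [hs']
  have hX : ((X : k[X]) ^ s) ≠ 0 := pow_ne_zero _ X_ne_zero
  have hXd : ((X : k[X]) ^ s).natDegree = s := natDegree_X_pow s
  obtain ⟨τ1, h10, h11⟩ := exists_tau hp
  obtain ⟨τ2, h20, h21⟩ := exists_tau hX
  let pb1 := AdjoinRoot.powerBasis hp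
  let pb2 := AdjoinRoot.powerBasis hX
  have d1 : pb1.dim = p.natDegree := rfl
  have d2 : pb2.dim = s := hXd
  let e : (Fin pb1.dim ⊕ Fin pb2.dim) ≃ Fin (n + 1) :=
    finSumFinEquiv.trans (finCongr (by omega))
  let b0 := pb1.basis.prod pb2.basis
  let c : k := (-1) ^ (p.natDegree + 1)
  let ℓ : AdjoinRoot p × AdjoinRoot ((X : k[X]) ^ s) →ₗ[k] k := LinearMap.coprod τ1 (c • τ2)
  refine ⟨b0.reindex e, ℓ, ?_⟩
  have hG : (Matrix.of fun i j => ℓ ((b0.reindex e) i * (b0.reindex e) j)).det =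
      (-1) ^ (∑ i ∈ Finset.range p.natDegree, i) * 
        (c ^ s * (-1) ^ (∑ i ∈ Finset.range s, i)) := by
    have e1 : (Matrix.of fun i j => ℓ ((b0.reindex e) i * (b0.reindex e) j)) =
      (Matrix.fromBlocks 
        (Matrix.of fun i j : Fin pb1.dim => τ1 (AdjoinRoot.root p ^ ((i : ℕ) + j))) 0 0
        (c • Matrix.of fun i j : Fin pb2.dim => τ2 (AdjoinRoot.root _ ^ ((i : ℕ) + j)))).submatrix
          e.symm e.symm := by
      ext i j
      simp only [Matrix.of_apply, Matrix.submatrix_apply, Module.Basis.reindex_apply]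
      rcases e.symm i with i | i <;> rcases e.symm j with j | j <;>
        simp [b0, ℓ, Module.Basis.prod_apply, pow_add, pb1, pb2]
    have a1 := hankel_det pb1.dim (fun m => τ1 (AdjoinRoot.root p ^ m)) h10 h11
    have a2 := hankel_det pb2.dim (fun m => τ2 (AdjoinRoot.root _ ^ m)) h20 h21
    rw [e1, Matrix.det_submatrix_equiv_self, Matrix.det_fromBlocks_zero₂₁, Matrix.det_smul, a1, a2]
    simp only [Fintype.card_fin, d1, d2]
  apply homog_eq_of_dehomog (N := n + 1)
  · have := (MvPolynomial.isHomogeneous_C (Fin 2) (p.leadingCoeff *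
        (Matrix.of fun i j => ℓ ((b0.reindex e) i * (b0.reindex e) j)).det)).mul
        (det_homog (Algebra.leftMulMatrix (b0.reindex e) (etaL _ _))
          (Algebra.leftMulMatrix (b0.reindex e) (-xiL _ _)))
    simpa using this
  · have := (MvPolynomial.isHomogeneous_C (Fin 2) ((-1 : k) ^ (n * (n + 1) / 2))).mul hfh
    simpa using this
  · have hmul : ∀ g h : MvPolynomial (Fin 2) k, dehomog (g * h) = dehomog g * dehomog h := by
      intro g h; simp [dehomog]
    have hC : ∀ a : k, dehomog (MvPolynomial.C a) = C a := by
      intro a; simp [dehomog, MvPolynomial.algHom_C]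
    rw [hmul, hmul, hC, hC, hpp, hG]
    have hdet : ∀ A B : Matrix (Fin (n+1)) (Fin (n+1)) k,
      dehomog ((MvPolynomial.X 0 : MvPolynomial (Fin 2) k) •
        A.map (MvPolynomial.C : k → MvPolynomial (Fin 2) k)
      + (MvPolynomial.X 1 : MvPolynomial (Fin 2) k) •
        B.map (MvPolynomial.C : k → MvPolynomial (Fin 2) k)).det = 
        ((X : k[X]) • A.map (algebraMap k k[X]) + (1 : k[X]) • B.map (algebraMap k k[X])).det :=
      fun A B => aeval_det A B _ _
    rw [hdet]
    have e2 : (X : k[X]) • (Algebra.leftMulMatrix (b0.reindex e) (etaL p s)).map (algebraMap k k[X]) + 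
        (1 : k[X]) • (Algebra.leftMulMatrix (b0.reindex e) (-xiL p s)).map (algebraMap k k[X]) =
        (Matrix.fromBlocks (Matrix.charmatrix (Algebra.leftMulMatrix pb1.basis pb1.gen)) 0 0
          (- (1 - (X : k[X]) • (Algebra.leftMulMatrix pb2.basis pb2.gen).map C))).submatrix e.symm e.symm := by
      have r : ∀ z, Algebra.leftMulMatrix (b0.reindex e) z = 
          (Algebra.leftMulMatrix b0 z).submatrix e.symm e.symm := by
        intro z
        ext i j
        simp [Algebra.leftMulMatrix_eq_repr_mul]
      rw [r, r, leftMul_prod, leftMul_prod]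
      ext i j : 2
      simp only [Matrix.add_apply, Matrix.smul_apply, Matrix.map_apply, Matrix.submatrix_apply]
      rcases e.symm i with i | i <;> rcases e.symm j with j | j
      · simp [etaL, xiL, Matrix.charmatrix_apply, Matrix.one_apply, Matrix.diagonal_apply, pb1, sub_eq_add_neg]
      · simp
      · simp
      · simp [etaL, xiL, Matrix.one_apply, pb2]
        split_ifs <;> simp [sub_eq_add_neg]
    have e3 : (1 - (X : k[X]) • (Algebra.leftMulMatrix pb2.basis pb2.gen).map C).det = 1 := by
      have := Matrix.reverse_charpoly (Algebra.leftMulMatrix pb2.basis pb2.gen)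
      rw [Matrix.charpolyRev] at this
      rw [← this, charpoly_leftMulMatrix, AdjoinRoot.powerBasis_gen, AdjoinRoot.minpoly_root hX]
      have hr := Polynomial.reverse_mul_X_pow (1 : k[X]) s
      rw [one_mul] at hr
      simp only [leadingCoeff_X_pow, inv_one, map_one, mul_one, hr]
      rw [← C_1, reverse_C]
    rw [e2, Matrix.det_submatrix_equiv_self, Matrix.det_fromBlocks_zero₂₁, Matrix.det_neg, e3,
      ← Matrix.charpoly, charpoly_leftMulMatrix, AdjoinRoot.powerBasis_gen, AdjoinRoot.minpoly_root hp]
    have hlc : p.leadingCoeff ≠ 0 := leadingCoeff_ne_zero.2 hp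
    have hlc' : C p.leadingCoeff * C p.leadingCoeff⁻¹ = 1 := by
      rw [← C_mul, mul_inv_cancel₀ hlc, C_1]
    have hsgn : n * (n + 1) / 2 + (2 * s) = 
        ∑ i ∈ Finset.range p.natDegree, i + ((p.natDegree + 1) * s + ∑ i ∈ Finset.range s, i) + s := by
      have h1 : n * (n + 1) / 2 = ∑ i ∈ Finset.range (n + 1), i := by
        rw [Finset.sum_range_id]; simp [mul_comm]
      have h2 : ∑ i ∈ Finset.range (p.natDegree + s), i = ∑ i ∈ Finset.range p.natDegree, i +
          ∑ i ∈ Finset.range s, (p.natDegree + i) := Finset.sum_range_add _ _ _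
      rw [h1, hs, h2, Finset.sum_add_distrib]
      simp; ring
    have hsgn' : (-1 : k[X]) ^ (n * (n + 1) / 2) = (-1) ^ (∑ i ∈ Finset.range p.natDegree, i) *
        (((-1) ^ (p.natDegree + 1)) ^ s * (-1) ^ (∑ i ∈ Finset.range s, i)) * (-1) ^ s := by
      rw [← pow_mul, ← pow_add, ← pow_add, ← pow_add, ← hsgn, pow_add]; simp
    simp only [Fintype.card_fin, d2, map_mul, map_pow, map_neg, map_one, c]
    rw [hsgn']
    linear_combination ((-1) ^ (∑ i ∈ Finset.range p.natDegree, i) *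
        (((-1) ^ (p.natDegree + 1)) ^ s * (-1) ^ (∑ i ∈ Finset.range s, i)) * (-1) ^ s) * p * hlc'

end Frob


section Abstract

variable {k L : Type*} [Field k] [CommRing L] [Algebra k L] {N : ℕ}
  (b : Module.Basis (Fin N) k L) (ℓ : L →ₗ[k] k)

/-- Gram matrix. -/
noncomputable def Gm : Matrix (Fin N) (Fin N) k := Matrix.of fun i j => ℓ (b i * b j)

theorem Gm_symm : (Gm b ℓ)ᵀ = Gm b ℓ := by
  ext i j; simp [Gm, mul_comm]

theorem Gm_mul_apply (z : L) (i j) :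
    (Gm b ℓ * Algebra.leftMulMatrix b z) i j = ℓ (b i * (z * b j)) := by
  conv_rhs => rw [← b.sum_repr (z * b j), Finset.mul_sum, map_sum]
  rw [Matrix.mul_apply]
  refine Finset.sum_congr rfl fun m _ => ?_
  rw [Algebra.leftMulMatrix_eq_repr_mul, mul_smul_comm, map_smul]
  simp [Gm, mul_comm]

theorem Gm_mul_symm (z : L) : (Gm b ℓ * Algebra.leftMulMatrix b z)ᵀ =
    Gm b ℓ * Algebra.leftMulMatrix b z := by
  ext i j
  rw [Matrix.transpose_apply, Gm_mul_apply, Gm_mul_apply]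
  congr 1; ring

theorem Gm_comm (z : L) : (Algebra.leftMulMatrix b z)ᵀ * Gm b ℓ =
    Gm b ℓ * Algebra.leftMulMatrix b z := by
  rw [← Gm_mul_symm, Matrix.transpose_mul, Gm_symm]

theorem Gm_nondeg (h : (Gm b ℓ).det ≠ 0) (y : L) (hy : ∀ w, ℓ (w * y) = 0) : y = 0 := by
  have : Gm b ℓ *ᵥ (b.repr y) = 0 := by
    ext i
    rw [Pi.zero_apply, ← hy (b i)]
    conv_rhs => rw [← b.sum_repr y, Finset.mul_sum, map_sum]
    simp [Matrix.mulVec, dotProduct, Gm, mul_comm]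
  have := Matrix.eq_zero_of_mulVec_eq_zero h this
  apply b.repr.injective
  ext i
  simpa using congrFun this i

variable (ξ η : L)

local notation "Λ" => Algebra.leftMulMatrix b

theorem central
    (hcomm : ∀ A : L →ₗ[k] L, (∀ z, η * A (ξ * z) = ξ * A (η * z)) → ∀ z, A z = A 1 * z)
    (A : Matrix (Fin N) (Fin N) k) (h : Λ η * A * Λ ξ = Λ ξ * A * Λ η) :
    ∃ a, A = Λ a := by
  refine ⟨(Matrix.toLin b b A) 1, ?_⟩
  have h2 := hcomm (Matrix.toLin b b A) (by
    intro z
    have := congrArg (fun M => Matrix.toLin b b M z) h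
    simpa [Matrix.toLin_mul b b b, Algebra.leftMulMatrix_apply] using this)
  apply (Matrix.toLin b b).injective
  ext z
  rw [h2 z, Algebra.leftMulMatrix_apply]
  simp

theorem symm_pencil
    (hcomm : ∀ A : L →ₗ[k] L, (∀ z, η * A (ξ * z) = ξ * A (η * z)) → ∀ z, A z = A 1 * z)
    (hG : (Gm b ℓ).det ≠ 0) (S : Matrix (Fin N) (Fin N) k)
    (h0 : (S * Λ η)ᵀ = S * Λ η) (h1 : (S * Λ ξ)ᵀ = S * Λ ξ) : ∃ α, S = Gm b ℓ * Λ α := by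
  have hu : IsUnit (Gm b ℓ).det := isUnit_iff_ne_zero.2 hG
  have key : ∀ z, (S * Λ z)ᵀ = S * Λ z → (Gm b ℓ)⁻¹ * S * Λ z = Λ z * ((Gm b ℓ)⁻¹ * Sᵀ) := by
    intro z hz
    have h3 : Gm b ℓ * (Λ z * ((Gm b ℓ)⁻¹ * Sᵀ)) = S * Λ z := by
      rw [← Matrix.mul_assoc, ← Gm_comm, Matrix.mul_assoc, Matrix.mul_nonsing_inv_cancel_left _ _ hu,
        ← Matrix.transpose_mul, hz]
    rw [Matrix.mul_assoc, ← h3, Matrix.nonsing_inv_mul_cancel_left _ _ hu]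
  have k0 := key η h0
  have k1 := key ξ h1
  obtain ⟨α, hα⟩ := central b ξ η hcomm ((Gm b ℓ)⁻¹ * Sᵀ) (by
    rw [← k0, ← k1, Matrix.mul_assoc _ (Λ η), Matrix.mul_assoc _ (Λ ξ), ← map_mul, ← map_mul, mul_comm η])
  refine ⟨α, ?_⟩
  rw [← Gm_mul_symm, ← hα, Matrix.mul_nonsing_inv_cancel_left _ _ hu, Matrix.transpose_transpose]

theorem stab_pencil
    (hcomm : ∀ A : L →ₗ[k] L, (∀ z, η * A (ξ * z) = ξ * A (η * z)) → ∀ z, A z = A 1 * z)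
    (hG : (Gm b ℓ).det ≠ 0) (hun : ∃ c c' : L, c * ξ + c' * η = 1)
    (R : Matrix (Fin N) (Fin N) k) (hR : R.det ≠ 0) (α α' : Lˣ)
    (h0 : Rᵀ * (Gm b ℓ * Λ (α * η)) * R = Gm b ℓ * Λ (α' * η))
    (h1 : Rᵀ * (Gm b ℓ * Λ (α * ξ)) * R = Gm b ℓ * Λ (α' * ξ)) :
    ∃ β : Lˣ, R = Λ β ∧ α' = β ^ 2 * α := by
  have hα : IsUnit (Λ (α : L)).det := by
    rw [← Matrix.isUnit_iff_isUnit_det]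
    exact α.isUnit.map (Algebra.leftMulMatrix b)
  have hu : IsUnit (Gm b ℓ).det := isUnit_iff_ne_zero.2 hG
  have hS : IsUnit (Rᵀ * (Gm b ℓ * Λ (α : L))).det := by
    rw [Matrix.det_mul, Matrix.det_mul, Matrix.det_transpose]
    exact (isUnit_iff_ne_zero.2 hR).mul (hu.mul hα)
  set S := Rᵀ * (Gm b ℓ * Λ (α : L)) with hSdef
  have e0 : S * Λ η * R = Gm b ℓ * Λ (α' * η) := by
    rw [← h0, map_mul, hSdef]; simp only [Matrix.mul_assoc]
  have e1 : S * Λ ξ * R = Gm b ℓ * Λ (α' * ξ) := by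
    rw [← h1, map_mul, hSdef]; simp only [Matrix.mul_assoc]
  obtain ⟨β, hβ⟩ := central b ξ η hcomm R (by
    have : S * (Λ η * R * Λ ξ) = S * (Λ ξ * R * Λ η) := by
      rw [← Matrix.mul_assoc, ← Matrix.mul_assoc, e0, ← Matrix.mul_assoc, ← Matrix.mul_assoc, e1,
        Matrix.mul_assoc, Matrix.mul_assoc, ← map_mul, ← map_mul]
      congr 2; ring
    have := congrArg (fun M => S⁻¹ * M) this
    simpa only [Matrix.nonsing_inv_mul_cancel_left _ _ hS] using this)
  have key : ∀ z, Rᵀ * (Gm b ℓ * Λ (α * z)) * R = Gm b ℓ * Λ (α' * z) → β ^ 2 * α * z = α' * z := by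
    intro z hz
    rw [hβ, ← Matrix.mul_assoc, Gm_comm, Matrix.mul_assoc, Matrix.mul_assoc, ← map_mul,
      ← map_mul] at hz
    have := congrArg (fun M => (Gm b ℓ)⁻¹ * M) hz
    simp only [Matrix.nonsing_inv_mul_cancel_left _ _ hu] at this
    rw [← Algebra.leftMulMatrix_injective b this]; ring
  have k0 := key η h0
  have k1 := key ξ h1
  obtain ⟨c, c', hc⟩ := hun
  have hfin : β ^ 2 * (α : L) = α' := by
    linear_combination c * k1 + c' * k0 + ((α' : L) - β ^ 2 * α) * hc
  have hβu : IsUnit β := by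
    apply isUnit_of_mul_isUnit_left (y := β * α)
    rw [← mul_assoc, ← pow_two, hfin]
    exact α'.isUnit
  refine ⟨hβu.unit, hβ, ?_⟩
  ext
  simp [hfin]

theorem rank_pencil {n : ℕ} {K : Type*} [Field K] [Algebra k K] (b : Module.Basis (Fin (n + 1)) k L)
    (x y : K)
    (h : ∃ e : L, ∀ w : L →ₗ[k] K, (∀ z, x * w (η * z) = y * w (ξ * z)) → w e = 0 → w = 0) :
    n ≤ (x • (Algebra.leftMulMatrix b η).map (algebraMap k K) -
      y • (Algebra.leftMulMatrix b ξ).map (algebraMap k K)).rank := by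
  obtain ⟨e, he⟩ := h
  set A := (x • (Algebra.leftMulMatrix b η).map (algebraMap k K) -
      y • (Algebra.leftMulMatrix b ξ).map (algebraMap k K)) with hA
  let fn : (Fin (n + 1) → K) → (L →ₗ[k] K) := fun v => b.constr k v
  have hfn : ∀ v z, fn v z = ∑ i, v i * algebraMap k K (b.repr z i) := by
    intro v z
    simp [fn, Module.Basis.constr_apply_fintype, Algebra.smul_def, mul_comm]
  let F : (Fin (n + 1) → K) →ₗ[K] K :=
    { toFun := fun v => fn v e
      map_add' := by intro v v'; simp [hfn, add_mul, Finset.sum_add_distrib]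
      map_smul' := by intro c v; simp [hfn, Finset.mul_sum, mul_assoc] }
  have hker : Module.finrank K (LinearMap.ker (Aᵀ).mulVecLin) ≤ 1 := by
    have hinj : Function.Injective (F ∘ₗ (LinearMap.ker (Aᵀ).mulVecLin).subtype) := by
      rw [← LinearMap.ker_eq_bot, LinearMap.ker_eq_bot']
      rintro ⟨v, hv⟩ h0
      have h0' : fn v e = 0 := h0
      rw [LinearMap.mem_ker, Matrix.mulVecLin_apply, Matrix.mulVec_transpose] at hv
      have hw : fn v = 0 := by
        apply he _ _ h0'
        have : x • (fn v ∘ₗ LinearMap.mulLeft k η) = y • (fn v ∘ₗ LinearMap.mulLeft k ξ) := by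
          apply b.ext
          intro j
          have := congrFun hv j
          simp only [Matrix.vecMul, dotProduct, hA, Matrix.sub_apply, Matrix.smul_apply,
            Matrix.map_apply, smul_eq_mul, Algebra.leftMulMatrix_eq_repr_mul, mul_sub,
            Finset.sum_sub_distrib, Pi.zero_apply, sub_eq_zero] at this
          simp only [LinearMap.smul_apply, LinearMap.comp_apply, LinearMap.mulLeft_apply, hfn,
            smul_eq_mul, Finset.mul_sum]
          simpa only [mul_left_comm] using this
        intro z
        exact congrArg (fun T => T z) this
      apply Subtype.ext
      ext i
      have := congrArg (fun T => T (b i)) hw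
      simpa [fn] using this
    simpa using LinearMap.finrank_le_finrank_of_injective hinj
  have := LinearMap.finrank_range_add_finrank_ker (Aᵀ).mulVecLin
  rw [← Matrix.rank_transpose, Matrix.rank]
  simp at this
  omega

end Abstract


section Main

variable {k : Type*} [Field k]

theorem finite_L (n : ℕ) (f : MvPolynomial (Fin 2) k)
    (b : Module.Basis (Fin (n + 1)) k (SegreAlgebra k n f)) :
    Finite (MaximalSpectrum (SegreAlgebra k n f)) := by
  have : Module.Finite k (SegreAlgebra k n f) := Module.Finite.of_basis b
  have : IsArtinianRing (SegreAlgebra k n f) := IsArtinianRing.of_finite k _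
  infer_instance

theorem exists_point {L : Type*} [CommRing L] [Algebra k L] [Module.Finite k L] (m : Ideal L)
    (hm : m.IsMaximal) : ∃ φ : L →ₐ[k] AlgebraicClosure k, ∀ z ∈ m, φ z = 0 := by
  let _ : Field (L ⧸ m) := Ideal.Quotient.field m
  have : Module.Finite k (L ⧸ m) := inferInstance
  have : Algebra.IsAlgebraic k (L ⧸ m) := Algebra.IsAlgebraic.of_finite k _
  refine ⟨(IsAlgClosed.lift : (L ⧸ m) →ₐ[k] AlgebraicClosure k).comp (Ideal.Quotient.mkₐ k m), ?_⟩
  intro z hz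
  have : Ideal.Quotient.mkₐ k m z = 0 := Ideal.Quotient.eq_zero_iff_mem.2 hz
  rw [AlgHom.comp_apply, this, map_zero]

theorem exists_strict_equiv (n : ℕ) (f : MvPolynomial (Fin 2) k) (hf0 : f ≠ 0)
    (hfh : f.IsHomogeneous (n + 1)) (b : Module.Basis (Fin (n + 1)) k (SegreAlgebra k n f))
    (ℓ : SegreAlgebra k n f →ₗ[k] k) (hG : (Gm b ℓ).det ≠ 0) (M : RegularSymPairs k n f) :
    ∃ Q H : Matrix (Fin (n + 1)) (Fin (n + 1)) k, Q.det ≠ 0 ∧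
      M.1.1 * Q = H * Algebra.leftMulMatrix b (etaL _ _) ∧
      M.1.2 * Q = H * Algebra.leftMulMatrix b (-xiL _ _) := by
  obtain ⟨⟨M0, M1⟩, hs0, hs1, hdet, hrank⟩ := M
  dsimp only at hs0 hs1 hdet hrank ⊢
  have : Module.Finite k (SegreAlgebra k n f) := Module.Finite.of_basis b
  have := finite_L n f b
  set ξ : SegreAlgebra k n f := xiL _ _ with hξ
  set η : SegreAlgebra k n f := etaL _ _ with hη
  obtain ⟨c, c', hun⟩ := unimodL (dehomog f) (n + 1 - (dehomog f).natDegree)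
  rw [← hξ, ← hη] at hun
  set AL := ξ • M0.map (algebraMap k (SegreAlgebra k n f)) +
    η • M1.map (algebraMap k (SegreAlgebra k n f)) with hAL
  have hAdet : AL.det = 0 := by
    rw [hAL, ← aeval_det, hdet]
    exact aeval_eq_zero_L hfh
  have hB : ∀ m : Ideal (SegreAlgebra k n f), m.IsMaximal → ∃ i j, AL.adjugate i j ∉ m := by
    intro m hm
    by_contra hcon
    push Not at hcon
    obtain ⟨φ, hφ⟩ := exists_point (k := k) m hm
    have h1 : (φ : SegreAlgebra k n f →+* AlgebraicClosure k).mapMatrix AL.adjugate = 0 := by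
      ext i j
      exact hφ _ (hcon i j)
    rw [RingHom.map_adjugate] at h1
    apply adjugate_ne_zero_of_rank _ (hrank (φ ξ) (φ η) _)
    · rw [← h1]
      congr 1
      ext i j
      simp [hAL, -Prod.algebraMap_apply]
    · intro h0
      rw [Prod.mk.injEq] at h0
      have := congrArg φ hun
      rw [map_add, map_mul, map_mul, h0.1, h0.2, map_one] at this
      simp at this
  obtain ⟨g, hg⟩ := exists_faithful AL.adjugate hB
  set a := AL.adjugate *ᵥ g with ha
  have hAa : AL *ᵥ a = 0 := by
    rw [ha, Matrix.mulVec_mulVec, Matrix.mul_adjugate, hAdet]; simp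
  let Q : SegreAlgebra k n f →ₗ[k] (Fin (n + 1) → k) :=
    LinearMap.pi fun i => ℓ ∘ₗ LinearMap.mulRight k (a i)
  have hQapp : ∀ z i, Q z i = ℓ (z * a i) := fun z i => rfl
  have hQ : ∀ z, M0 *ᵥ Q (ξ * z) + M1 *ᵥ Q (η * z) = 0 := by
    intro z
    ext i
    have h1 := congrArg (fun y => ℓ (z * y)) (congrFun hAa i)
    simp only [Matrix.mulVec, dotProduct, hAL, Matrix.add_apply, Matrix.smul_apply,
      Matrix.map_apply, smul_eq_mul, Pi.zero_apply, mul_zero, map_zero, Finset.mul_sum,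
      map_sum] at h1
    simp only [Pi.add_apply, Matrix.mulVec, dotProduct, hQapp, Pi.zero_apply,
      ← Finset.sum_add_distrib]
    rw [← h1]
    refine Finset.sum_congr rfl fun j _ => ?_
    have sm : ∀ (c : k) y, c * ℓ y = ℓ (c • y) := fun c y => by rw [map_smul, smul_eq_mul]
    rw [sm, sm, ← map_add]
    congr 1
    rw [Algebra.smul_def, Algebra.smul_def]; ring
  have hQ0 : ∀ z, (∀ w, Q (w * z) = 0) → z = 0 := by
    intro z hz
    apply hg
    intro i
    apply Gm_nondeg b ℓ hG
    intro w
    rw [← mul_assoc]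
    exact congrFun (hz w) i
  have hrev : (M0.map (Polynomial.C : k → k[X]) + (X : k[X]) • M1.map (Polynomial.C : k → k[X])).det ≠ 0 := by
    have h1 := rev_dehomog_ne_zero hfh hf0
    rw [← hdet, aeval_det, one_smul] at h1
    exact h1
  let H : SegreAlgebra k n f →ₗ[k] (Fin (n + 1) → k) :=
    M0.mulVecLin ∘ₗ Q ∘ₗ LinearMap.inl k _ _ ∘ₗ LinearMap.fst k _ _
     - M1.mulVecLin ∘ₗ Q ∘ₗ LinearMap.inr k _ _ ∘ₗ LinearMap.snd k _ _
  have hHapp : ∀ z, H z = M0 *ᵥ Q (z.1, 0) - M1 *ᵥ Q (0, z.2) := fun z => rfl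
  have hHinj : ∀ z, H z = 0 → z = 0 := by
    intro z hz
    apply hQ0
    intro w
    exact chainL _ _ M0 M1 hrev Q hQ z hz w
  have hdec : ∀ z : SegreAlgebra k n f, Q z = Q (z.1, 0) + Q (0, z.2) := by
    intro z
    rw [← map_add]; simp
  have h0 : ∀ z, M0 *ᵥ Q z = H (η * z) := by
    intro z
    have h1 := hQ (0, z.2)
    rw [hHapp, hdec z, Matrix.mulVec_add]
    simp only [hξ, hη, xiL, etaL, Prod.mk_mul_mk, mul_zero, one_mul] at h1
    simp only [hη, etaL, Prod.fst_mul, Prod.snd_mul, one_mul]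
    rw [eq_neg_of_add_eq_zero_left h1]
    abel
  have h1 : ∀ z, M1 *ᵥ Q z = H (-ξ * z) := by
    intro z
    have h1 := hQ (z.1, 0)
    rw [neg_mul, map_neg, hHapp, hdec z, Matrix.mulVec_add]
    simp only [hξ, hη, xiL, etaL, Prod.mk_mul_mk, mul_zero, one_mul] at h1
    simp only [hξ, xiL, Prod.fst_mul, Prod.snd_mul, one_mul]
    rw [eq_neg_of_add_eq_zero_right h1]
    abel
  have hQinj : ∀ z, Q z = 0 → z = 0 := by
    intro z hz
    have e0 := hHinj (η * z) (by rw [← h0, hz, Matrix.mulVec_zero])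
    have e1 := hHinj (-ξ * z) (by rw [← h1, hz, Matrix.mulVec_zero])
    linear_combination c' * e0 - c * e1 - z * hun
  refine ⟨LinearMap.toMatrix b (Pi.basisFun k _) Q, LinearMap.toMatrix b (Pi.basisFun k _) H,
    ?_, ?_, ?_⟩
  · rw [← isUnit_iff_ne_zero, ← Matrix.isUnit_iff_isUnit_det, ← Matrix.mulVec_injective_iff_isUnit]
    intro v v' hvv
    rw [← sub_eq_zero] at hvv ⊢
    rw [← Matrix.mulVec_sub] at hvv
    set u := v - v'
    have hu : (b.repr (b.equivFun.symm u) : Fin (n + 1) → k) = u :=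
      b.equivFun.apply_symm_apply u
    rw [← hu, LinearMap.toMatrix_mulVec_repr] at hvv
    have := hQinj (b.equivFun.symm u) (by
      ext i; simpa using congrFun hvv i)
    exact (LinearEquiv.map_eq_zero_iff _).1 this
  · have : M0.mulVecLin ∘ₗ Q = H ∘ₗ LinearMap.mulLeft k η := by
      exact LinearMap.ext fun z => h0 z
    have := congrArg (LinearMap.toMatrix b (Pi.basisFun k _)) this
    rw [LinearMap.toMatrix_comp b (Pi.basisFun k _), LinearMap.toMatrix_comp b b] at this
    simpa [LinearMap.toMatrix_eq_toMatrix', Algebra.leftMulMatrix_apply, ← Matrix.toLin'_apply'] using this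
  · have : M1.mulVecLin ∘ₗ Q = H ∘ₗ LinearMap.mulLeft k (-ξ) := by
      exact LinearMap.ext fun z => h1 z
    have := congrArg (LinearMap.toMatrix b (Pi.basisFun k _)) this
    rw [LinearMap.toMatrix_comp b (Pi.basisFun k _), LinearMap.toMatrix_comp b b] at this
    simpa [LinearMap.toMatrix_eq_toMatrix', Algebra.leftMulMatrix_apply, ← Matrix.toLin'_apply'] using this

end Main


section Final

variable {k : Type*} [Field k]

theorem pen_conj {R : Type*} [CommRing R] (φ : k →+* R) {N : ℕ} (x y : R)
    (P A B Q : Matrix (Fin N) (Fin N) k) :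
    x • (P * A * Q).map φ + y • (P * B * Q).map φ =
      P.map φ * (x • A.map φ + y • B.map φ) * Q.map φ := by
  rw [Matrix.map_mul, Matrix.map_mul, Matrix.map_mul, Matrix.map_mul, Matrix.mul_add,
    Matrix.add_mul, Matrix.mul_smul, Matrix.mul_smul, Matrix.smul_mul, Matrix.smul_mul]

theorem det_pen_conj {R : Type*} [CommRing R] (φ : k →+* R) {N : ℕ} (x y : R)
    (P A B Q : Matrix (Fin N) (Fin N) k) :
    (x • (P * A * Q).map φ + y • (P * B * Q).map φ).det =
      φ (P.det * Q.det) * (x • A.map φ + y • B.map φ).det := by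
  rw [pen_conj, Matrix.det_mul, Matrix.det_mul, map_mul, RingHom.map_det, RingHom.map_det,
    RingHom.mapMatrix_apply, RingHom.mapMatrix_apply]
  ring

theorem rank_pen_conj {R : Type*} [Field R] (φ : k →+* R) {N : ℕ} (x y : R)
    (P A B Q : Matrix (Fin N) (Fin N) k) (hP : P.det ≠ 0) (hQ : Q.det ≠ 0) :
    (x • (P * A * Q).map φ + y • (P * B * Q).map φ).rank =
      (x • A.map φ + y • B.map φ).rank := by
  have key : ∀ T : Matrix (Fin N) (Fin N) k, T.det ≠ 0 → IsUnit (T.map φ).det := by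
    intro T hT
    have := (isUnit_iff_ne_zero.2 hT).map φ
    rwa [RingHom.map_det, RingHom.mapMatrix_apply] at this
  rw [pen_conj, Matrix.rank_mul_eq_left_of_isUnit_det _ _ (key Q hQ),
    Matrix.rank_mul_eq_right_of_isUnit_det _ _ (key P hP)]

/-- A diagonal matrix of prescribed determinant. -/
noncomputable def Dm (n : ℕ) (u : k) : Matrix (Fin (n + 1)) (Fin (n + 1)) k :=
  Matrix.diagonal (Fin.cons u fun _ => 1)

theorem Dm_det (n : ℕ) (u : k) : (Dm n u).det = u := by
  simp [Dm, Matrix.det_diagonal, Fin.prod_univ_succ]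

theorem isUnit_of_norm {L : Type*} [CommRing L] [Algebra k L] [Module.Finite k L] (α : L)
    (h : Algebra.norm k α ≠ 0) : IsUnit α := by
  rw [Algebra.norm_apply] at h
  have h1 : Function.Bijective (Algebra.lmul k L α) := by
    rw [← Module.End.isUnit_iff, LinearMap.isUnit_iff_isUnit_det]
    exact isUnit_iff_ne_zero.2 h
  obtain ⟨y, hy⟩ := h1.2 1
  exact IsUnit.of_mul_eq_one y hy

variable {n : ℕ} {f : MvPolynomial (Fin 2) k}

/-- First standard element. -/
noncomputable def et (n : ℕ) (f : MvPolynomial (Fin 2) k) : SegreAlgebra k n f := etaL _ _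

/-- Second standard element. -/
noncomputable def xi' (n : ℕ) (f : MvPolynomial (Fin 2) k) : SegreAlgebra k n f := -xiL _ _

theorem comm' (A : SegreAlgebra k n f →ₗ[k] SegreAlgebra k n f)
    (h : ∀ z, et n f * A (xi' n f * z) = xi' n f * A (et n f * z)) (z) : A z = A 1 * z := by
  refine commL _ _ A (fun z => ?_) z
  have := h z
  simp only [et, xi', neg_mul, map_neg, mul_neg, neg_inj] at this
  exact this

theorem unimod' : ∃ c c' : SegreAlgebra k n f, c * xi' n f + c' * et n f = 1 := by
  obtain ⟨c, c', h⟩ := unimodL (dehomog f) (n + 1 - (dehomog f).natDegree)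
  refine ⟨-c, c', ?_⟩
  rw [← h, xi', et]; ring

variable (b : Module.Basis (Fin (n + 1)) k (SegreAlgebra k n f)) (ℓ : SegreAlgebra k n f →ₗ[k] k)

theorem rank_std (x y : AlgebraicClosure k) (h : (x, y) ≠ (0, 0)) :
    n ≤ (x • (Algebra.leftMulMatrix b (et n f)).map (algebraMap k (AlgebraicClosure k)) +
      y • (Algebra.leftMulMatrix b (xi' n f)).map (algebraMap k (AlgebraicClosure k))).rank := by
  have := rank_pencil (xiL _ _) (etaL _ _) b x y (functL _ _ x y h)
  convert this using 2
  rw [sub_eq_add_neg, ← smul_neg]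
  congr 2
  ext i j
  simp [xi']

/-- The standard pencil determinant statement. -/
def DetStd : Prop :=
  MvPolynomial.C ((dehomog f).leadingCoeff * (Gm b ℓ).det) *
    ((MvPolynomial.X 0 : MvPolynomial (Fin 2) k) •
      (Algebra.leftMulMatrix b (et n f)).map (MvPolynomial.C : k → MvPolynomial (Fin 2) k)
      + (MvPolynomial.X 1 : MvPolynomial (Fin 2) k) • (Algebra.leftMulMatrix b (xi' n f)).map
        (MvPolynomial.C : k → MvPolynomial (Fin 2) k)).det
    = MvPolynomial.C ((-1) ^ (n * (n + 1) / 2)) * f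

/-- The model matrix. -/
noncomputable def Mm (α z : SegreAlgebra k n f) : Matrix (Fin (n + 1)) (Fin (n + 1)) k :=
  Gm b ℓ * Algebra.leftMulMatrix b (α * z)

theorem Mm_conj (P R : Matrix (Fin (n + 1)) (Fin (n + 1)) k) (α z : SegreAlgebra k n f) :
    P * Mm b ℓ α z * R =
      (P * (Gm b ℓ * Algebra.leftMulMatrix b α)) * Algebra.leftMulMatrix b z * R := by
  rw [Mm, map_mul]; simp only [Matrix.mul_assoc]

theorem Mm_symm (R : Matrix (Fin (n + 1)) (Fin (n + 1)) k) (α z : SegreAlgebra k n f) :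
    (Rᵀ * Mm b ℓ α z * R).IsSymm := by
  unfold Matrix.IsSymm
  rw [Matrix.transpose_mul, Matrix.transpose_mul, Matrix.transpose_transpose, Mm, Gm_mul_symm]
  simp only [Matrix.mul_assoc]

theorem Mm_det (hD : DetStd b ℓ) (R : Matrix (Fin (n + 1)) (Fin (n + 1)) k)
    (α : SegreAlgebra k n f) :
    MvPolynomial.C (dehomog f).leadingCoeff *
    ((MvPolynomial.X 0 : MvPolynomial (Fin 2) k) •
      (Rᵀ * Mm b ℓ α (et n f) * R).map (MvPolynomial.C : k → MvPolynomial (Fin 2) k)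
      + (MvPolynomial.X 1 : MvPolynomial (Fin 2) k) • (Rᵀ * Mm b ℓ α (xi' n f) * R).map
        (MvPolynomial.C : k → MvPolynomial (Fin 2) k)).det
    = MvPolynomial.C ((-1) ^ (n * (n + 1) / 2) * R.det ^ 2 * Algebra.norm k α) * f := by
  rw [Mm_conj, Mm_conj, det_pen_conj, Matrix.det_mul, Matrix.det_mul, Matrix.det_transpose,
    ← Algebra.norm_eq_matrix_det]
  unfold DetStd at hD
  simp only [map_mul, map_pow] at hD ⊢
  linear_combination (MvPolynomial.C R.det ^ 2 * MvPolynomial.C (Algebra.norm k α)) * hD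

theorem G_det (hf0 : f ≠ 0) (hD : DetStd b ℓ) : (Gm b ℓ).det ≠ 0 := by
  intro h
  unfold DetStd at hD
  rw [h, mul_zero, map_zero, zero_mul] at hD
  have := mul_eq_zero.1 hD.symm
  simp [hf0] at this

theorem Mm_conj_unit (α β z : SegreAlgebra k n f) :
    (Algebra.leftMulMatrix b β)ᵀ * Mm b ℓ α z * Algebra.leftMulMatrix b β =
      Mm b ℓ (β ^ 2 * α) z := by
  rw [Mm, Mm, ← Matrix.mul_assoc, Gm_comm, Matrix.mul_assoc, Matrix.mul_assoc, ← map_mul,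
    ← map_mul]
  congr 2; ring

theorem norm_unit_ne (α : (SegreAlgebra k n f)ˣ) :
    Algebra.norm k (α : SegreAlgebra k n f) ≠ 0 :=
  (α.isUnit.map (Algebra.norm k)).ne_zero

/-- The map from norm pairs to pairs of matrices. -/
noncomputable def Phi (hf0 : f ≠ 0) (hlc : (dehomog f).leadingCoeff ≠ 0) (hD : DetStd b ℓ)
    (x : NormPairs k n f) : RegularSymPairs k n f :=
  ⟨((Dm n (x.1.1 : k))ᵀ * Mm b ℓ x.1.2 (et n f) * Dm n (x.1.1 : k),
    (Dm n (x.1.1 : k))ᵀ * Mm b ℓ x.1.2 (xi' n f) * Dm n (x.1.1 : k)), by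
    refine ⟨Mm_symm _ _ _ _ _, Mm_symm _ _ _ _ _, ?_, ?_⟩
    · have := Mm_det b ℓ hD (Dm n (x.1.1 : k)) x.1.2
      rw [Dm_det, ← x.2] at this
      exact mul_left_cancel₀ (by simpa using hlc) this
    · intro p q hpq
      dsimp only
      rw [Mm_conj, Mm_conj, rank_pen_conj]
      · exact rank_std b p q hpq
      · rw [Matrix.det_mul, Matrix.det_mul, Matrix.det_transpose, Dm_det,
          ← Algebra.norm_eq_matrix_det]
        exact mul_ne_zero x.1.1.ne_zero (mul_ne_zero (G_det b ℓ hf0 hD) (norm_unit_ne _))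
      · rw [Dm_det]; exact x.1.1.ne_zero⟩

theorem SLRel_equiv : Equivalence (SLRel k n f) := by
  refine ⟨fun M => ⟨1, by simp⟩, ?_, ?_⟩
  · rintro M M' ⟨P, hP, h0, h1⟩
    have hu : IsUnit P.det := by rw [hP]; exact isUnit_one
    have key : ∀ A : Matrix (Fin (n + 1)) (Fin (n + 1)) k, A = (P⁻¹)ᵀ * (Pᵀ * A * P) * P⁻¹ := by
      intro A
      have e : (P⁻¹)ᵀ * Pᵀ = 1 := by
        rw [← Matrix.transpose_mul, Matrix.mul_nonsing_inv _ hu, Matrix.transpose_one]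
      calc A = ((P⁻¹)ᵀ * Pᵀ) * A * (P * P⁻¹) := by
            rw [e, Matrix.mul_nonsing_inv _ hu, one_mul, mul_one]
        _ = _ := by simp only [Matrix.mul_assoc]
    refine ⟨P⁻¹, by simp [Matrix.det_nonsing_inv, hP], ?_, ?_⟩
    · rw [h0]; exact key _
    · rw [h1]; exact key _
  · rintro M M' M'' ⟨P, hP, h0, h1⟩ ⟨P', hP', h0', h1'⟩
    refine ⟨P * P', by rw [Matrix.det_mul, hP, hP', one_mul], ?_, ?_⟩
    · rw [h0', h0, Matrix.transpose_mul]; simp only [Matrix.mul_assoc]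
    · rw [h1', h1, Matrix.transpose_mul]; simp only [Matrix.mul_assoc]

theorem conj_aux {N : ℕ} (P Q D A : Matrix (Fin N) (Fin N) k) :
    (P * Q * D)ᵀ * A * (P * Q * D) = Dᵀ * (Qᵀ * (Pᵀ * A * P) * Q) * D := by
  rw [Matrix.transpose_mul, Matrix.transpose_mul]; simp only [Matrix.mul_assoc]

theorem conj_cancel {N : ℕ} (D A : Matrix (Fin N) (Fin N) k) (hD : IsUnit D.det) :
    (D⁻¹)ᵀ * (Dᵀ * A * D) * D⁻¹ = A := by
  have e : (D⁻¹)ᵀ * Dᵀ = 1 := by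
    rw [← Matrix.transpose_mul, Matrix.mul_nonsing_inv _ hD, Matrix.transpose_one]
  calc _ = ((D⁻¹)ᵀ * Dᵀ) * A * (D * D⁻¹) := by simp only [Matrix.mul_assoc]
    _ = A := by rw [e, Matrix.mul_nonsing_inv _ hD, one_mul, mul_one]

theorem Dm_unit (u : kˣ) : IsUnit (Dm n (u : k)).det := by rw [Dm_det]; exact u.isUnit

theorem Phi_rel (hf0 : f ≠ 0) (hlc : (dehomog f).leadingCoeff ≠ 0) (hD : DetStd b ℓ)
    (x y : NormPairs k n f) (h : NormRel k n f x y) :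
    SLRel k n f (Phi b ℓ hf0 hlc hD x) (Phi b ℓ hf0 hlc hD y) := by
  obtain ⟨β, h1, h2⟩ := h
  have h1' : (y.1.1 : k) = (Algebra.norm k (β : SegreAlgebra k n f))⁻¹ * x.1.1 := by
    rw [h1]; simp
  have h2' : (y.1.2 : SegreAlgebra k n f) = β ^ 2 * x.1.2 := by rw [h2]; simp
  refine ⟨(Dm n (x.1.1 : k))⁻¹ * Algebra.leftMulMatrix b β * Dm n (y.1.1 : k), ?_, ?_, ?_⟩
  · rw [Matrix.det_mul, Matrix.det_mul, Dm_det, Matrix.det_nonsing_inv, Dm_det,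
      Ring.inverse_eq_inv', ← Algebra.norm_eq_matrix_det, h1']
    have := norm_unit_ne β
    have := x.1.1.ne_zero
    field_simp
  · rw [conj_aux]
    dsimp only [Phi]
    rw [conj_cancel _ _ (Dm_unit _), Mm_conj_unit, h2']
  · rw [conj_aux]
    dsimp only [Phi]
    rw [conj_cancel _ _ (Dm_unit _), Mm_conj_unit, h2']

theorem Phi_inj (hf0 : f ≠ 0) (hlc : (dehomog f).leadingCoeff ≠ 0) (hD : DetStd b ℓ)
    (x y : NormPairs k n f) (h : SLRel k n f (Phi b ℓ hf0 hlc hD x) (Phi b ℓ hf0 hlc hD y)) :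
    NormRel k n f x y := by
  obtain ⟨P, hP, h0, h1⟩ := h
  dsimp only [Phi] at h0 h1
  have key : ∀ z, (Dm n (y.1.1 : k))ᵀ * Mm b ℓ y.1.2 z * Dm n (y.1.1 : k) =
      Pᵀ * ((Dm n (x.1.1 : k))ᵀ * Mm b ℓ x.1.2 z * Dm n (x.1.1 : k)) * P →
      (Dm n (x.1.1 : k) * P * (Dm n (y.1.1 : k))⁻¹)ᵀ * Mm b ℓ x.1.2 z *
        (Dm n (x.1.1 : k) * P * (Dm n (y.1.1 : k))⁻¹) = Mm b ℓ y.1.2 z := by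
    intro z hz
    rw [conj_aux, ← hz, conj_cancel _ _ (Dm_unit _)]
  have hdet : (Dm n (x.1.1 : k) * P * (Dm n (y.1.1 : k))⁻¹).det = x.1.1 * (y.1.1 : k)⁻¹ := by
    rw [Matrix.det_mul, Matrix.det_mul, Dm_det, Matrix.det_nonsing_inv, Dm_det,
      Ring.inverse_eq_inv', hP, mul_one]
  obtain ⟨β, hR, hβ⟩ := stab_pencil b ℓ (xi' n f) (et n f) comm' (G_det b ℓ hf0 hD) unimod'
    (Dm n (x.1.1 : k) * P * (Dm n (y.1.1 : k))⁻¹)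
    (by rw [hdet]; simp) x.1.2 y.1.2 (key _ h0) (key _ h1)
  refine ⟨β, ?_, hβ⟩
  rw [hR, ← Algebra.norm_eq_matrix_det] at hdet
  ext
  simp only [Units.val_mul, Units.val_inv_eq_inv_val, Units.coe_map, MonoidHom.coe_coe]
  rw [hdet]
  have := y.1.1.ne_zero
  have := x.1.1.ne_zero
  field_simp

theorem Phi_surj (hf0 : f ≠ 0) (hfh : f.IsHomogeneous (n + 1))
    (hlc : (dehomog f).leadingCoeff ≠ 0) (hD : DetStd b ℓ)
    (M : RegularSymPairs k n f) : ∃ x, SLRel k n f M (Phi b ℓ hf0 hlc hD x) := by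
  have hG := G_det b ℓ hf0 hD
  have : Module.Finite k (SegreAlgebra k n f) := Module.Finite.of_basis b
  obtain ⟨Q, H, hQ, h0, h1⟩ := exists_strict_equiv n f hf0 hfh b ℓ hG M
  have e0 : Qᵀ * M.1.1 * Q = Qᵀ * H * Algebra.leftMulMatrix b (et n f) := by
    rw [Matrix.mul_assoc, h0, ← Matrix.mul_assoc]; rfl
  have e1 : Qᵀ * M.1.2 * Q = Qᵀ * H * Algebra.leftMulMatrix b (xi' n f) := by
    rw [Matrix.mul_assoc, h1, ← Matrix.mul_assoc]; rfl
  have sy : ∀ A : Matrix (Fin (n + 1)) (Fin (n + 1)) k, A.IsSymm → (Qᵀ * A * Q)ᵀ = Qᵀ * A * Q := by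
    intro A hA
    rw [Matrix.transpose_mul, Matrix.transpose_mul, Matrix.transpose_transpose, hA.eq,
      Matrix.mul_assoc]
  obtain ⟨α, hα⟩ := symm_pencil b ℓ (xi' n f) (et n f) comm' hG (Qᵀ * H)
    (by rw [← e0]; exact sy _ M.2.1) (by rw [← e1]; exact sy _ M.2.2.1)
  have m0 : Qᵀ * M.1.1 * Q = Mm b ℓ α (et n f) := by
    rw [e0, hα, Mm, map_mul, Matrix.mul_assoc]
  have m1 : Qᵀ * M.1.2 * Q = Mm b ℓ α (xi' n f) := by
    rw [e1, hα, Mm, map_mul, Matrix.mul_assoc]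
  have hdet := Mm_det b ℓ hD 1 α
  rw [Matrix.transpose_one, one_mul, one_mul, mul_one, mul_one, ← m0, ← m1, det_pen_conj,
    M.2.2.2.1, ← mul_assoc, ← map_mul] at hdet
  have hlcα := MvPolynomial.C_injective _ _ (mul_right_cancel₀ hf0 hdet)
  rw [Matrix.det_transpose, Matrix.det_one, one_pow, mul_one] at hlcα
  have hN : Algebra.norm k α ≠ 0 := by
    intro h
    rw [h, mul_zero] at hlcα
    exact mul_ne_zero hlc (mul_ne_zero hQ hQ) hlcα
  have hαu := isUnit_of_norm α hN
  refine ⟨⟨((Units.mk0 _ hQ)⁻¹, hαu.unit), ?_⟩, Q * Dm n (Q.det)⁻¹, ?_, ?_, ?_⟩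
  · simp only [Units.val_inv_eq_inv_val, Units.val_mk0, IsUnit.unit_spec]
    field_simp
    linear_combination hlcα
  · rw [Matrix.det_mul, Dm_det, mul_inv_cancel₀ hQ]
  · simp only [Phi, Units.val_inv_eq_inv_val, Units.val_mk0, IsUnit.unit_spec]
    rw [← m0, Matrix.transpose_mul]; simp only [Matrix.mul_assoc]
  · simp only [Phi, Units.val_inv_eq_inv_val, Units.val_mk0, IsUnit.unit_spec]
    rw [← m1, Matrix.transpose_mul]; simp only [Matrix.mul_assoc]

end Final

theorem sl_orbits_biject_with_norm_classes
    (k : Type*) [Field k] (n : ℕ) (hn : 1 ≤ n)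
    (f : MvPolynomial (Fin 2) k) (hf0 : f ≠ 0) (hfh : f.IsHomogeneous (n + 1)) :
    Nonempty (Quot (SLRel k n f) ≃ Quot (NormRel k n f)) := by
  obtain ⟨b, ℓ, hbl⟩ := det_formula n f hf0 hfh
  have hD : DetStd b ℓ := hbl
  have hlc : (dehomog f).leadingCoeff ≠ 0 :=
    Polynomial.leadingCoeff_ne_zero.2 (dehomog_ne_zero hfh hf0)
  refine ⟨(Equiv.ofBijective (Quot.map (Phi b ℓ hf0 hlc hD) (Phi_rel b ℓ hf0 hlc hD))
    ⟨?_, ?_⟩).symm⟩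
  · rintro ⟨x⟩ ⟨y⟩ hxy
    apply Quot.sound
    apply Phi_inj b ℓ hf0 hlc hD
    have := Quot.eqvGen_exact hxy
    rwa [SLRel_equiv.eqvGen_iff] at this
  · rintro ⟨M⟩
    obtain ⟨x, hx⟩ := Phi_surj b ℓ hf0 hfh hlc hD M
    exact ⟨Quot.mk _ x, (Quot.sound hx).symm⟩
end

section
/- Let k be a field with a fixed algebraic closure k̄, n ≥ 1, and f(X_0,X_1) ∈ k[X_0,X_1] a nonzero homogeneous polynomial of degree n+1; let p(X) := f(X,1), s := (n+1) − deg p, and L := (k[X]/(p)) × (k[Y]/(Y^s)) with norm N_{L/k}. Let (M_0,M_1) be any pair of symmetric (n+1)×(n+1) matrices over k with det(X_0 M_0 + X_1 M_1) = f and rank(a M_0 + b M_1) ≥ n for all (a,b) ∈ k̄²∖{(0,0)}. Then the stabilizer group {P ∈ SL_{n+1}(k) : PᵀM_0P = M_0 and PᵀM_1P = M_1} is isomorphic as a group to the group {β ∈ L^× : β² = 1 and N_{L/k}(β) = 1} (under multiplication). -/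
open Matrix Polynomial

/-- `P ∈ SL_{n+1}(k)` stabilizes the pair `(M₀, M₁)` under the action
`(M₀, M₁) · P = (PᵀM₀P, PᵀM₁P)`. -/
def IsStabilizing {k : Type*} [Field k] {n : ℕ}
    (M₀ M₁ : Matrix (Fin (n + 1)) (Fin (n + 1)) k)
    (P : Matrix.SpecialLinearGroup (Fin (n + 1)) k) : Prop :=
  (P : Matrix (Fin (n + 1)) (Fin (n + 1)) k)ᵀ * M₀ *
      (P : Matrix (Fin (n + 1)) (Fin (n + 1)) k) = M₀ ∧
  (P : Matrix (Fin (n + 1)) (Fin (n + 1)) k)ᵀ * M₁ *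
      (P : Matrix (Fin (n + 1)) (Fin (n + 1)) k) = M₁


set_option linter.unusedSectionVars false
section helperA

variable {k : Type*} [Field k] {ι : Type*} [Fintype ι] [DecidableEq ι]

/-- constant matrices -/
noncomputable def cm : Matrix ι ι k →+* Matrix ι ι k[X] := (C : k →+* k[X]).mapMatrix

lemma cm_apply (M : Matrix ι ι k) (i j : ι) : cm M i j = C (M i j) := rfl

lemma cm_inj {M N : Matrix ι ι k} (h : cm M = cm N) : M = N := by
  ext i j
  have := congrFun (congrFun h i) j
  simpa [cm_apply] using this

lemma cm_transpose (M : Matrix ι ι k) : (cm M)ᵀ = cm Mᵀ := rfl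

/-- reduced modulo `p` -/
def Red (p : k[X]) (W : Matrix ι ι k[X]) : Prop := ∀ i j, (W i j).degree < p.degree

lemma Red.sub {p : k[X]} {U W : Matrix ι ι k[X]} (hU : Red p U) (hW : Red p W) :
    Red p (U - W) := fun i j => lt_of_le_of_lt (degree_sub_le _ _) (max_lt (hU i j) (hW i j))

lemma Red.mul_cm {p : k[X]} (hp : p ≠ 0) {U : Matrix ι ι k[X]} (hU : Red p U)
    (M : Matrix ι ι k) : Red p (U * cm M) := by
  intro i j
  rw [Matrix.mul_apply]
  refine lt_of_le_of_lt (degree_sum_le _ _) ?_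
  rw [Finset.sup_lt_iff (bot_lt_iff_ne_bot.2 (by simpa using hp))]
  intro l _
  rw [cm_apply]
  refine lt_of_le_of_lt (degree_mul_le _ _) (lt_of_le_of_lt ?_ (hU i l))
  calc _ ≤ (U i l).degree + 0 := by gcongr; exact degree_C_le
    _ = _ := by simp

lemma Red.cm_mul {p : k[X]} (hp : p ≠ 0) {U : Matrix ι ι k[X]} (hU : Red p U)
    (M : Matrix ι ι k) : Red p (cm M * U) := by
  intro i j
  rw [Matrix.mul_apply]
  refine lt_of_le_of_lt (degree_sum_le _ _) ?_
  rw [Finset.sup_lt_iff (bot_lt_iff_ne_bot.2 (by simpa using hp))]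
  intro l _
  rw [cm_apply]
  refine lt_of_le_of_lt (degree_mul_le _ _) (lt_of_le_of_lt ?_ (hU l j))
  calc _ ≤ 0 + (U l j).degree := by gcongr; exact degree_C_le
    _ = _ := by simp

lemma Red.eq_zero {p : k[X]} {U W : Matrix ι ι k[X]} (h : p • U = W)
    (hW : Red p W) : U = 0 := by
  ext1 i j
  by_contra hne
  have h1 := hW i j
  rw [← h, Matrix.smul_apply, smul_eq_mul, degree_mul] at h1
  have h2 : 0 ≤ (U i j).degree := zero_le_degree_iff.2 hne
  have h3 : p.degree + 0 ≤ p.degree + (U i j).degree := by gcongr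
  rw [add_zero] at h3
  exact absurd h1 (not_lt.2 h3)

lemma smul_mat_cancel {p : k[X]} (hp : p ≠ 0) {U W : Matrix ι ι k[X]} (h : p • U = p • W) :
    U = W := by
  ext1 i j
  have := congrFun (congrFun h i) j
  simpa [hp] using this

theorem splitA (M₀ M₁ : Matrix ι ι k) (hs₀ : M₀.IsSymm) (hs₁ : M₁.IsSymm)
    (p : k[X]) (hp : p ≠ 0) (S : Matrix ι ι k[X]) (hS : S = (X : k[X]) • cm M₀ + cm M₁)
    (hdet : S.det = p) :
    ∃ (H : Matrix ι ι k) (B : Matrix ι ι k[X]), H * H = H ∧ Hᵀ * M₀ = M₀ * H ∧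
      Hᵀ * M₁ = M₁ * H ∧ B * S = 1 - cm H ∧ 
      (∀ P Q : Matrix ι ι k, Q * M₀ = M₀ * P → Q * M₁ = M₁ * P → P * H = H * P) ∧
      IsUnit (M₀ * H + M₁ * (1 - H)).det := by
  set A := S.adjugate with hA
  have hST : Sᵀ = S := by
    rw [hS, transpose_add, transpose_smul, cm_transpose, cm_transpose, hs₀, hs₁]
  have hAT : Aᵀ = A := by rw [hA, adjugate_transpose, hST]
  set B : Matrix ι ι k[X] := A.map (· / p) with hB
  set R : Matrix ι ι k[X] := A.map (· % p) with hR
  have hBT : Bᵀ = B := by rw [hB, ← transpose_map, hAT]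
  have hRT : Rᵀ = R := by rw [hR, ← transpose_map, hAT]
  have hABR : A = p • B + R := by
    ext1 i j
    simp [hB, hR, EuclideanDomain.div_add_mod]
  have hRred : Red p R := fun i j => EuclideanDomain.mod_lt _ hp
  have hAS : A * S = p • 1 := by rw [hA, adjugate_mul, hdet]
  have hRS0 : R * S = p • (1 - B * S) := by
    rw [smul_sub, ← hAS, hABR, add_mul, smul_mul_assoc]; abel
  have hconst : 1 - B * S = cm ((1 - B * S).map (fun u => u.coeff 0)) := by
    ext1 i j
    rw [cm_apply, Matrix.map_apply]
    apply eq_C_of_degree_le_zero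
    have h1 : (p * (1 - B * S) i j).degree ≤ p.degree := by
      rw [← smul_eq_mul, ← Matrix.smul_apply, ← hRS0, hS, mul_add, mul_smul_comm,
        Matrix.add_apply, Matrix.smul_apply, smul_eq_mul]
      refine (degree_add_le _ _).trans (max_le ?_ ((hRred.mul_cm hp M₁) i j).le)
      have h2 := (hRred.mul_cm hp M₀) i j
      rw [degree_mul, degree_X]
      rw [degree_eq_natDegree hp] at h2 ⊢
      by_cases h0 : (R * cm M₀) i j = 0
      · rw [h0]; simp
      · rw [degree_eq_natDegree h0] at h2 ⊢
        have h3 : ((R * cm M₀) i j).natDegree < p.natDegree := by exact_mod_cast h2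
        have h4 : 1 + ((R * cm M₀) i j).natDegree ≤ p.natDegree := by omega
        exact_mod_cast h4
    by_cases h0 : (1 - B * S) i j = 0
    · rw [h0]; simp
    · rw [degree_mul, degree_eq_natDegree hp, degree_eq_natDegree h0] at h1
      have h3 : p.natDegree + ((1 - B * S) i j).natDegree ≤ p.natDegree := by exact_mod_cast h1
      rw [degree_eq_natDegree h0]
      have h4 : ((1 - B * S) i j).natDegree = 0 := by omega
      rw [h4]; simp
  set H := (1 - B * S).map (fun u => u.coeff 0) with hH
  have hBS : B * S = 1 - cm H := by rw [← hconst]; abel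
  have hSB : S * B = 1 - cm Hᵀ := by
    have := congrArg transpose hBS
    rw [transpose_mul, hST, hBT, transpose_sub, transpose_one, cm_transpose] at this
    exact this
  have hRS : R * S = p • cm H := by rw [hRS0, ← hconst]
  have hGS : cm Hᵀ * S = S * cm H := by
    have e1 : cm Hᵀ = 1 - S * B := by rw [hSB]; abel
    have e2 : cm H = 1 - B * S := by rw [hBS]; abel
    rw [e1, e2, sub_mul, mul_sub, one_mul, mul_one, mul_assoc]
  have hHB : cm H * B = 0 := by
    refine Red.eq_zero (p := p) (W := R * cm (1 - Hᵀ)) ?_ (hRred.mul_cm hp _)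
    rw [← smul_mul_assoc, ← hRS, mul_assoc, hSB, map_sub, map_one]
  have hHH : H * H = H := by
    apply cm_inj
    rw [map_mul]
    have e2 : cm H = 1 - B * S := by rw [hBS]; abel
    calc cm H * cm H = cm H * (1 - B * S) := by rw [← e2]
      _ = _ := by rw [mul_sub, mul_one, ← mul_assoc, hHB, zero_mul, sub_zero]
  have key : ∀ U V : Matrix ι ι k, (X : k[X]) • cm U + cm V = 0 → U = 0 ∧ V = 0 := by
    intro U V h
    constructor
    · ext i j
      have := congrArg (fun u => coeff u 1) (congrFun (congrFun h i) j)
      simpa [cm_apply, coeff_C] using this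
    · ext i j
      have := congrArg (fun u => coeff u 0) (congrFun (congrFun h i) j)
      simpa [cm_apply, coeff_C] using this
  have hGM : Hᵀ * M₀ - M₀ * H = 0 ∧ Hᵀ * M₁ - M₁ * H = 0 := by
    apply key
    rw [hS] at hGS
    have := sub_eq_zero.2 hGS
    rw [← this]
    simp only [map_sub, map_mul, mul_add, add_mul, mul_smul_comm, smul_mul_assoc, smul_sub]
    abel
  have hG0 := sub_eq_zero.1 hGM.1
  have hG1 := sub_eq_zero.1 hGM.2
  refine ⟨H, B, hHH, hG0, hG1, hBS, ?_, ?_⟩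
  · intro P Q h0 h1
    have hQS : cm Q * S = S * cm P := by
      rw [hS]
      simp only [mul_add, add_mul, mul_smul_comm, smul_mul_assoc, ← map_mul, h0, h1]
    have hSA : S * A = p • 1 := by rw [hA, mul_adjugate, hdet]
    have hPA : cm P * A = A * cm Q := by
      apply smul_mat_cancel hp
      calc p • (cm P * A) = (p • 1) * (cm P * A) := by rw [smul_mul_assoc, one_mul]
        _ = A * (S * cm P) * A := by rw [← hAS]; noncomm_ring
        _ = A * cm Q * (S * A) := by rw [← hQS]; noncomm_ring
        _ = _ := by rw [hSA, mul_smul_comm, mul_one]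
    have hPB : cm P * B = B * cm Q := by
      rw [← sub_eq_zero]
      refine Red.eq_zero (p := p) (W := R * cm Q - cm P * R) ?_
        ((hRred.mul_cm hp _).sub (hRred.cm_mul hp _))
      rw [hABR, mul_add, add_mul, mul_smul_comm, smul_mul_assoc] at hPA
      rw [smul_sub, sub_eq_sub_iff_add_eq_add, hPA]
      abel
    have h3 : cm P * (B * S) = (B * S) * cm P := by
      rw [← mul_assoc, hPB, mul_assoc, hQS, mul_assoc]
    rw [hBS, mul_sub, sub_mul, mul_one, one_mul, sub_right_inj, ← map_mul, ← map_mul] at h3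
    exact cm_inj h3
  · rw [isUnit_iff_ne_zero]
    intro hz
    obtain ⟨v, hv, hZv⟩ := exists_mulVec_eq_zero_iff.2 hz
    set W : Matrix ι ι k := Matrix.of fun i _ => v i with hW
    have hZW : (M₀ * H + M₁ * (1 - H)) * W = 0 := by
      ext i j
      exact congrFun hZv i
    have hW0 : M₀ * (H * W) = 0 := by
      have := congrArg (fun T => Hᵀ * T) hZW
      simp only [mul_zero] at this
      rw [← this]
      have e : Hᵀ * ((M₀ * H + M₁ * (1 - H)) * W)
        = (Hᵀ * M₀) * H * W + (Hᵀ * M₁) * (1 - H) * W := by noncomm_ring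
      rw [e, hG0, hG1]
      have e2 : M₀ * H * H * W + M₁ * H * (1 - H) * W
        = M₀ * (H * H) * W + M₁ * (H - H * H) * W := by noncomm_ring
      rw [e2, hHH, sub_self]
      noncomm_ring
    have hW1 : M₁ * ((1 - H) * W) = 0 := by
      have e : (M₀ * H + M₁ * (1 - H)) * W = M₀ * (H * W) + M₁ * ((1 - H) * W) := by
        noncomm_ring
      rw [e, hW0, zero_add] at hZW
      exact hZW
    have hHW : H * W = 0 := by
      apply cm_inj
      rw [map_zero]
      refine Red.eq_zero (p := p) (W := R * cm (M₁ * (H * W))) ?_ (hRred.mul_cm hp _)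
      have e1 : S * cm (H * W) = cm (M₁ * (H * W)) := by
        rw [hS, add_mul, smul_mul_assoc, ← map_mul, hW0, ← map_mul, map_zero, smul_zero, zero_add]
      rw [← e1, ← mul_assoc, hRS, smul_mul_assoc, ← map_mul, ← mul_assoc, hHH]
    have hHW' : W = 0 := by
      have e0 : (1 - H) * W = W := by rw [sub_mul, hHW, one_mul, sub_zero]
      rw [e0] at hW1
      have e1 : S * cm W = (X : k[X]) • cm (M₀ * W) := by
        rw [hS, add_mul, smul_mul_assoc, ← map_mul, ← map_mul, hW1, map_zero, add_zero]
      have e2 : cm W = (X : k[X]) • (B * cm (M₀ * W)) := by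
        rw [← mul_smul_comm, ← e1, ← mul_assoc, hBS, sub_mul, ← map_mul, hHW, map_zero, one_mul,
          sub_zero]
      ext i j
      have := congrArg (fun u => coeff u 0) (congrFun (congrFun e2 i) j)
      simpa [cm_apply] using this
    apply hv
    ext i
    exact congrFun (congrFun hHW' i) i

end helperA

section helperB

variable {k : Type*} [Field k] {ι : Type*} [Fintype ι] [DecidableEq ι]

lemma exists_factor (D : Matrix ι ι k) (g : k[X]) :
    ∃ U : Matrix ι ι k[X], g • (1 : Matrix ι ι k[X]) - cm (aeval D g)
      = U * ((X : k[X]) • 1 - cm D) := by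
  induction g using Polynomial.induction_on' with
  | add a b ha hb =>
    obtain ⟨U, hU⟩ := ha
    obtain ⟨V, hV⟩ := hb
    refine ⟨U + V, ?_⟩
    rw [add_mul, ← hU, ← hV, map_add, map_add, add_smul]
    abel
  | monomial m a =>
    have hc : Commute ((X : k[X]) • (1 : Matrix ι ι k[X])) (cm D) := by
      simp [Commute, SemiconjBy]
    have := hc.geom_sum₂_mul m
    refine ⟨C a • (∑ i ∈ Finset.range m, ((X : k[X]) • (1 : Matrix ι ι k[X])) ^ i *
      cm D ^ (m - 1 - i)), ?_⟩
    rw [smul_mul_assoc, this, aeval_monomial, smul_sub, map_mul, map_pow, _root_.smul_pow, one_pow,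
      smul_smul, C_mul_X_pow_eq_monomial]
    congr 1
    have h1 : cm (algebraMap k (Matrix ι ι k) a) = C a • (1 : Matrix ι ι k[X]) := by
      ext1 i j
      rw [cm_apply]
      by_cases h : i = j <;> simp [algebraMap_matrix_apply, h]
    rw [h1, smul_mul_assoc, one_mul]

lemma eval_zero_of_factor (D H : Matrix ι ι k) (g : k[X]) (U : Matrix ι ι k[X])
    (h : g • cm H = U * ((X : k[X]) • 1 - cm D)) : H * aeval D g = 0 := by
  have h1 := congrArg matPolyEquiv h
  have h2 : matPolyEquiv (cm H) = C H := matPolyEquiv_map_C H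
  have h3 : matPolyEquiv (cm D) = C D := matPolyEquiv_map_C D
  have h4 : g • cm H = cm H * (g • 1) := by simp
  rw [h4, map_mul, map_mul, map_sub, matPolyEquiv_smul_one, matPolyEquiv_smul_one, h2, h3,
    map_X] at h1
  have h5 := congrArg (eval D) h1
  rw [eval_mul_X_sub_C, eval_C_mul, eval_map_algebraMap] at h5
  exact h5

lemma B1 (D H G Z Zi : Matrix ι ι k) (hZ : Zi * Z = 1) (hDH : D * H = H * D)
    (T : Matrix ι ι k[X]) (hT : T * cm H = cm Z * (((X : k[X]) • 1 - cm D) * cm H))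
    (hG : cm G * T = T * cm H) (q : k[X]) (hq : T.det = q) :
    H * aeval D q = 0 ∧
      ∀ g : k[X], H * aeval D g = 0 → ∃ V, g • (cm H * T.adjugate) = q • V := by
  have hcomm : ((X : k[X]) • 1 - cm D) * cm H = cm H * ((X : k[X]) • 1 - cm D) := by
    rw [sub_mul, mul_sub, ← map_mul, ← map_mul, hDH]; simp
  constructor
  · apply eval_zero_of_factor D H q (T.adjugate * cm Z * cm H)
    have : T.adjugate * (T * cm H) = q • cm H := by
      rw [← mul_assoc, adjugate_mul, hq, smul_mul_assoc, one_mul]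
    rw [← this, hT, hcomm]
    noncomm_ring
  · intro g hg
    obtain ⟨U, hU⟩ := exists_factor D g
    have hgD : aeval D g * H = 0 := by
      rw [← hg]
      have hc : Commute H D := hDH.symm
      have : aeval D g ∈ Algebra.adjoin k {D} := aeval_mem_adjoin_singleton k D
      exact ((Algebra.commute_of_mem_adjoin_of_forall_mem_commute this
        (fun b hb => by rw [Set.mem_singleton_iff.1 hb]; exact hc)).eq).symm
    have h1 : g • cm H = U * (((X : k[X]) • 1 - cm D) * cm H) := by
      rw [← mul_assoc, ← hU, sub_mul, ← map_mul, hgD, map_zero, sub_zero, smul_mul_assoc, one_mul]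
    have h2 : ((X : k[X]) • 1 - cm D) * cm H = cm Zi * (T * cm H) := by
      rw [hT, ← mul_assoc (cm Zi), ← map_mul, hZ, map_one, one_mul]
    refine ⟨U * cm Zi * cm G, ?_⟩
    rw [← smul_mul_assoc, h1, h2, ← hG]
    have : U * (cm Zi * (cm G * T)) * T.adjugate = U * cm Zi * cm G * (T * T.adjugate) := by
      noncomm_ring
    rw [this, mul_adjugate, hq, mul_smul_comm, mul_one]

lemma primitive_dvd (A : Matrix ι ι k[X])
    (hA : ∀ x : AlgebraicClosure k, A.map (aeval x) ≠ 0) (p g : k[X])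
    (h : ∀ i j, p ∣ g * A i j) : p ∣ g := by
  set I : Ideal k[X] := Ideal.span (Set.range fun ij : ι × ι => A ij.1 ij.2) with hI
  obtain ⟨c, hc⟩ := (IsPrincipalIdealRing.principal I).principal
  have hcA : ∀ i j, c ∣ A i j := by
    intro i j
    rw [← Ideal.mem_span_singleton]
    change A i j ∈ Submodule.span k[X] {c}
    rw [← hc]
    exact Ideal.subset_span ⟨(i, j), rfl⟩
  have hu : c.degree = 0 := by
    by_contra hd
    obtain ⟨x, hx⟩ := IsAlgClosed.exists_aeval_eq_zero (AlgebraicClosure k) c hd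
    apply hA x
    ext i j
    obtain ⟨t, ht⟩ := hcA i j
    simp [ht, hx]
  have hIt : I = ⊤ := by
    rw [hc]
    exact Ideal.span_singleton_eq_top.2 (isUnit_iff_degree_eq_zero.2 hu)
  have h1 : ∀ x ∈ I, p ∣ g * x := by
    intro x hx
    induction hx using Submodule.span_induction with
    | mem x hx => obtain ⟨ij, rfl⟩ := hx; exact h _ _
    | zero => simp
    | add x y _ _ hx hy => rw [mul_add]; exact dvd_add hx hy
    | smul a x _ hx => rw [smul_eq_mul, mul_left_comm]; exact hx.mul_left a
  simpa using h1 1 (hIt ▸ Submodule.mem_top)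

lemma adj_ne_zero {K : Type*} [Field K] {n : ℕ} (M : Matrix (Fin (n + 1)) (Fin (n + 1)) K)
    (h : n ≤ M.rank) : M.adjugate ≠ 0 := by
  classical
  obtain ⟨L, L', D, hD⟩ := Matrix.Pivot.exists_list_transvec_mul_mul_list_transvec_eq_diagonal M
  set U := (L.map TransvectionStruct.toMatrix).prod
  set V := (L'.map TransvectionStruct.toMatrix).prod
  have hU : IsUnit U.det := by rw [TransvectionStruct.det_toMatrix_prod]; exact isUnit_one
  have hV : IsUnit V.det := by rw [TransvectionStruct.det_toMatrix_prod]; exact isUnit_one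
  intro h0
  have hr : (diagonal D).rank = M.rank := by
    rw [← hD, rank_mul_eq_left_of_isUnit_det _ _ hV, rank_mul_eq_right_of_isUnit_det _ _ hU]
  have hadj : (diagonal D).adjugate = 0 := by
    rw [← hD, adjugate_mul_distrib, adjugate_mul_distrib, h0]; simp
  rw [Matrix.rank_diagonal] at hr
  rw [adjugate_diagonal] at hadj
  have hz : ∀ i, ∃ j, j ≠ i ∧ D j = 0 := by
    intro i
    have h1 := congrFun (congrFun hadj i) i
    simp only [diagonal_apply_eq, Matrix.zero_apply] at h1
    obtain ⟨j, hj, hj0⟩ := Finset.prod_eq_zero_iff.1 h1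
    exact ⟨j, by simpa using hj, hj0⟩
  obtain ⟨a, _, ha⟩ := hz 0
  obtain ⟨b, hab, hb⟩ := hz a
  have h2 : Fintype.card {i // D i ≠ 0} ≤ n - 1 := by
    rw [Fintype.card_subtype]
    have h3 : (Finset.univ.filter fun i => D i ≠ 0) ⊆ (Finset.univ.erase a).erase b := by
      intro i hi
      simp only [Finset.mem_filter, Finset.mem_univ, true_and] at hi
      simp only [Finset.mem_erase, Finset.mem_univ, and_true]
      exact ⟨fun h => hi (h ▸ hb), fun h => hi (h ▸ ha)⟩
    refine (Finset.card_le_card h3).trans ?_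
    rw [Finset.card_erase_of_mem (by simp [hab]), Finset.card_erase_of_mem (by simp)]
    simp
  rw [hr] at h2
  have : n = 0 := by omega
  subst this
  exact hab (by ext; omega)

end helperB

section helperB2

variable {k : Type*} [Field k] {ι : Type*} [Fintype ι] [DecidableEq ι]

lemma nilp_of_factor (N K : Matrix ι ι k) (E : Matrix ι ι k[X])
    (h : cm K = E * (1 - (X : k[X]) • cm N)) : ∃ m, K * N ^ m = 0 := by
  have h1 := congrArg matPolyEquiv h
  have h2 : matPolyEquiv (cm K) = C K := matPolyEquiv_map_C K
  have h3 : matPolyEquiv (cm N) = C N := matPolyEquiv_map_C N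
  have h4 : (X : k[X]) • cm N = cm N * ((X : k[X]) • 1) := by simp
  rw [h4, map_mul, map_sub, map_mul, matPolyEquiv_smul_one, h2, h3, map_X, map_one, mul_sub,
    mul_one, ← mul_assoc] at h1
  set e := matPolyEquiv E
  have hc : ∀ i, e.coeff i = K * N ^ i := by
    intro i
    induction i with
    | zero =>
      have := congrArg (fun u => coeff u 0) h1
      simp only [coeff_C_zero, coeff_sub, mul_coeff_zero, coeff_X_zero, mul_zero, sub_zero] at this
      rw [pow_zero, mul_one, ← this]
    | succ i ih =>
      have := congrArg (fun u => coeff u (i + 1)) h1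
      simp only [coeff_C_succ, coeff_sub, coeff_mul_X, coeff_mul_C] at this
      rw [pow_succ, ← mul_assoc, ← ih]
      exact (sub_eq_zero.1 this.symm)
  exact ⟨e.natDegree + 1, by rw [← hc]; exact coeff_natDegree_succ_eq_zero⟩

set_option maxHeartbeats 1000000 in
theorem B2 (M₀ M₁ : Matrix ι ι k) (hs₀ : M₀.IsSymm) (hs₁ : M₁.IsSymm)
    (p : k[X]) (S : Matrix ι ι k[X]) (hS : S = (X : k[X]) • cm M₀ + cm M₁)
    (hdet : S.det = p)
    (H : Matrix ι ι k) (B : Matrix ι ι k[X]) (hHH : H * H = H) (hH0 : Hᵀ * M₀ = M₀ * H)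
    (hH1 : Hᵀ * M₁ = M₁ * H) (hBS : B * S = 1 - cm H)
    (hZu : IsUnit (M₀ * H + M₁ * (1 - H)).det)
    (T : Matrix ι ι k[X]) (hT : T = cm M₀ + (X : k[X]) • cm M₁) (s : ℕ) (u : k[X])
    (hTdet : T.det = X ^ s * u) (hu : u.coeff 0 ≠ 0)
    (hA : ∀ x : AlgebraicClosure k, S.adjugate.map (aeval x) ≠ 0) (hA' : M₀.adjugate ≠ 0) :
    ∃ Z D₀ D₁ : Matrix ι ι k, Z = M₀ * H + M₁ * (1 - H) ∧ IsUnit Z.det ∧ Z * D₀ = M₀ ∧ 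
      Z * D₁ = M₁ ∧ Zᵀ = Z ∧ Hᵀ * Z = Z * H ∧ D₀ * H = H * D₀ ∧ D₁ * H = H * D₁ ∧
      D₀ * D₁ = D₁ * D₀ ∧ H * aeval (-D₁) p = 0 ∧ (∀ g, H * aeval (-D₁) g = 0 → p ∣ g) ∧
      (1 - H) * aeval (-D₀) (X ^ s : k[X]) = 0 ∧
      (∀ g : k[X], (1 - H) * aeval (-D₀) g = 0 → X ^ s ∣ g) := by
  obtain ⟨Z, hZ⟩ : ∃ Z, Z = M₀ * H + M₁ * (1 - H) := ⟨_, rfl⟩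
  rw [← hZ] at hZu
  have hZi : Z⁻¹ * Z = 1 := nonsing_inv_mul _ hZu
  have hiZ : Z * Z⁻¹ = 1 := mul_nonsing_inv _ hZu
  obtain ⟨D₀, hD0⟩ : ∃ D, D = Z⁻¹ * M₀ := ⟨_, rfl⟩
  obtain ⟨D₁, hD1⟩ : ∃ D, D = Z⁻¹ * M₁ := ⟨_, rfl⟩
  have hZD0 : Z * D₀ = M₀ := by rw [hD0, ← mul_assoc, hiZ, one_mul]
  have hZD1 : Z * D₁ = M₁ := by rw [hD1, ← mul_assoc, hiZ, one_mul]
  have hGZ : Hᵀ * Z = Z * H := by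
    rw [hZ]
    calc _ = (Hᵀ * M₀) * H + (Hᵀ * M₁) * (1 - H) := by noncomm_ring
      _ = _ := by rw [hH0, hH1]; noncomm_ring
  have hZT : Zᵀ = Z := by
    rw [hZ, transpose_add, transpose_mul, transpose_mul, transpose_sub, transpose_one, hs₀, hs₁,
      sub_mul, hH0, hH1]; noncomm_ring
  have hHZ : H * Z⁻¹ = Z⁻¹ * Hᵀ := by
    calc H * Z⁻¹ = (Z⁻¹ * Z) * H * Z⁻¹ := by rw [hZi, one_mul]
      _ = Z⁻¹ * (Z * H) * Z⁻¹ := by noncomm_ring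
      _ = Z⁻¹ * Hᵀ * (Z * Z⁻¹) := by rw [← hGZ]; noncomm_ring
      _ = _ := by rw [hiZ, mul_one]
  have hD0H : D₀ * H = H * D₀ := by
    rw [hD0, mul_assoc, ← hH0, ← mul_assoc, ← mul_assoc, hHZ]
  have hD1H : D₁ * H = H * D₁ := by
    rw [hD1, mul_assoc, ← hH1, ← mul_assoc, ← mul_assoc, hHZ]
  have hZH : Z * H = M₀ * H := by
    calc Z * H = M₀ * (H * H) + M₁ * (H - H * H) := by rw [hZ]; noncomm_ring
      _ = _ := by rw [hHH]; simp
  have hZH' : Z * (1 - H) = M₁ * (1 - H) := by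
    calc Z * (1 - H) = M₀ * (H - H * H) + M₁ * (1 - H - H + H * H) := by rw [hZ]; noncomm_ring
      _ = _ := by rw [hHH]; simp
  have hD0H1 : D₀ * H = H := by rw [hD0, mul_assoc, ← hZH, ← mul_assoc, hZi, one_mul]
  have hD1H1 : D₁ * (1 - H) = 1 - H := by rw [hD1, mul_assoc, ← hZH', ← mul_assoc, hZi, one_mul]
  have hDD : D₀ * D₁ = D₁ * D₀ := by
    have e1 : D₀ * D₁ * H = D₁ * D₀ * H := by
      rw [mul_assoc, hD1H, ← mul_assoc, hD0H1, mul_assoc, hD0H1, hD1H]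
    have e2 : D₀ * D₁ * (1 - H) = D₁ * D₀ * (1 - H) := by
      have : D₀ * (1 - H) = (1 - H) * D₀ := by rw [mul_sub, sub_mul, hD0H, mul_one, one_mul]
      rw [mul_assoc, hD1H1, mul_assoc, this, ← mul_assoc, hD1H1]
    calc D₀ * D₁ = D₀ * D₁ * H + D₀ * D₁ * (1 - H) := by noncomm_ring
      _ = D₁ * D₀ * H + D₁ * D₀ * (1 - H) := by rw [e1, e2]
      _ = _ := by noncomm_ring
  have hSH : cm Hᵀ * S = S * cm H := by
    rw [hS]
    simp only [mul_add, add_mul, mul_smul_comm, smul_mul_assoc, ← map_mul, hH0, hH1]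
  have hTH : cm Hᵀ * T = T * cm H := by
    rw [hT]
    simp only [mul_add, add_mul, mul_smul_comm, smul_mul_assoc, ← map_mul, hH0, hH1]
  have hF1 : S * cm H = cm Z * (((X : k[X]) • 1 - cm (-D₁)) * cm H) := by
    have e : ((X : k[X]) • 1 - cm (-D₁)) * cm H = (X : k[X]) • cm H + cm (D₁ * H) := by
      rw [sub_mul, smul_mul_assoc, one_mul, map_neg, neg_mul, sub_neg_eq_add, map_mul]
    rw [e, hS, mul_add, mul_smul_comm, ← map_mul, ← map_mul, ← mul_assoc, hZD1, hZH, add_mul,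
      smul_mul_assoc, ← map_mul, ← map_mul]
  have hF2 : T * cm (1 - H) = cm Z * (((X : k[X]) • 1 - cm (-D₀)) * cm (1 - H)) := by
    have e : ((X : k[X]) • 1 - cm (-D₀)) * cm (1 - H)
        = (X : k[X]) • cm (1 - H) + cm (D₀ * (1 - H)) := by
      rw [sub_mul, smul_mul_assoc, one_mul, map_neg, neg_mul, sub_neg_eq_add, map_mul]
    rw [e, hT, mul_add, mul_smul_comm, ← map_mul, ← map_mul, ← mul_assoc, hZD0, hZH', add_mul,
      smul_mul_assoc, ← map_mul, ← map_mul, add_comm]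
  obtain ⟨hfa, hfi⟩ := B1 (-D₁) H Hᵀ Z Z⁻¹ hZi (by simp [hD1H]) S hF1 hSH p hdet
  obtain ⟨hia, hii⟩ := B1 (-D₀) (1 - H) (1 - Hᵀ) Z Z⁻¹ hZi
    (by rw [neg_mul, mul_neg, mul_sub, sub_mul, hD0H, mul_one, one_mul]) T hF2
    (by rw [map_sub, map_sub, sub_mul, mul_sub, hTH]; simp) _ hTdet
  refine ⟨Z, D₀, D₁, hZ, hZu, hZD0, hZD1, hZT, hGZ, hD0H, hD1H, hDD, hfa, ?_, ?_, ?_⟩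
  · intro g hg
    obtain ⟨V, hV⟩ := hfi g hg
    apply primitive_dvd S.adjugate hA
    have h1 : (1 - cm H) * S.adjugate = p • B := by
      rw [← hBS, mul_assoc, mul_adjugate, hdet, mul_smul_comm, mul_one]
    have h2 : g • S.adjugate = p • (V + g • B) := by
      rw [smul_add, smul_comm p g, ← h1, ← hV, ← smul_add]
      congr 1
      rw [sub_mul, one_mul]; abel
    intro i j
    exact ⟨_, congrFun (congrFun h2 i) j⟩
  · obtain ⟨m, hm⟩ := nilp_of_factor (-D₀) (1 - H) (B * cm Z * cm (1 - H)) (by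
      have e : cm (1 - H) = B * (S * cm (1 - H)) := by
        rw [← mul_assoc, hBS]
        have : (1 : Matrix ι ι k[X]) - cm H = cm (1 - H) := by simp
        rw [this, ← map_mul]
        congr 1
        rw [mul_sub, mul_one, sub_mul, one_mul, hHH]; simp
      have e3 : S * cm (1 - H) = cm Z * (cm (1 - H) * (1 - (X : k[X]) • cm (-D₀))) := by
        have c0 : (1 - H) * D₀ = D₀ * (1 - H) := by rw [sub_mul, mul_sub, hD0H]; simp
        have c1 : cm (1 - H) * (1 - (X : k[X]) • cm (-D₀))
            = cm (1 - H) + (X : k[X]) • cm (D₀ * (1 - H)) := by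
          rw [mul_sub, mul_one, mul_smul_comm, ← map_mul, mul_neg, c0, map_neg, smul_neg,
            sub_neg_eq_add]
        rw [c1, mul_add, mul_smul_comm, ← map_mul, ← map_mul, ← mul_assoc, hZD0, hZH', hS, add_mul,
          smul_mul_assoc, ← map_mul, ← map_mul]
        abel
      rw [e3] at e
      exact e.trans (by simp only [mul_assoc]))
    have hcop : IsCoprime (X ^ m : k[X]) u := by
      apply IsCoprime.pow_left
      rw [irreducible_X.coprime_iff_not_dvd]
      rwa [X_dvd_iff]
    obtain ⟨a, b, hab⟩ := hcop
    have h1 : (X ^ s : k[X]) = X ^ m * (a * X ^ s) + (X ^ s * u) * b := by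
      linear_combination (-(X ^ s : k[X])) * hab
    rw [h1, map_add, mul_add, map_mul, map_mul _ (X ^ s * u), ← mul_assoc, ← mul_assoc, hia,
      aeval_X_pow, hm]
    simp
  · intro g hg
    obtain ⟨V, hV⟩ := hii g hg
    set F : Matrix ι ι k[X] := 1 + (X : k[X]) • cm D₁ with hF
    have hF3 : T * cm H = cm Z * (F * cm H) := by
      rw [hF, hT]
      simp only [add_mul, mul_add, smul_mul_assoc, ← map_mul, one_mul, mul_smul_comm, hZH]
      rw [← mul_assoc, hZD1]
    have hF4 : F * (cm H * T.adjugate) = (X ^ s * u) • (cm Z⁻¹ * cm Hᵀ) := by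
      calc F * (cm H * T.adjugate) = cm (Z⁻¹ * Z) * (F * (cm H * T.adjugate)) := by
            rw [hZi, map_one, one_mul]
        _ = cm Z⁻¹ * (cm Z * (F * cm H)) * T.adjugate := by rw [map_mul]; noncomm_ring
        _ = cm Z⁻¹ * cm Hᵀ * (T * T.adjugate) := by rw [← hF3, ← hTH]; noncomm_ring
        _ = _ := by rw [mul_adjugate, hTdet, mul_smul_comm, mul_one]
    have hF5 : F.det • (cm H * T.adjugate) = (X ^ s * u) • (F.adjugate * (cm Z⁻¹ * cm Hᵀ)) := by
      rw [← mul_smul_comm (X ^ s * u) F.adjugate, ← hF4, ← mul_assoc F.adjugate, adjugate_mul, smul_mul_assoc, one_mul]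
    have hFc : IsCoprime (X ^ s : k[X]) F.det := by
      apply IsCoprime.pow_left
      rw [irreducible_X.coprime_iff_not_dvd, X_dvd_iff, coeff_zero_eq_eval_zero]
      have : (1 : Matrix ι ι k).det ≠ 0 := by simp
      have h2 : (evalRingHom (0 : k)).mapMatrix F = 1 := by
        ext i j
        simp [hF, one_apply, apply_ite (eval (0 : k))]
      have h3 := RingHom.map_det (evalRingHom (0 : k)) F
      rw [h2, det_one] at h3
      change evalRingHom 0 F.det ≠ 0
      rw [h3]
      exact one_ne_zero
    have hd : ∀ i j, (X ^ s : k[X]) ∣ g * T.adjugate i j := by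
      intro i j
      have e1 : (X ^ s : k[X]) ∣ (cm H * T.adjugate : Matrix ι ι k[X]) i j := by
        apply hFc.dvd_of_dvd_mul_left
        exact ⟨_, (congrFun (congrFun hF5 i) j).trans (mul_assoc _ _ _)⟩
      have e2 : (X ^ s : k[X]) ∣ g * (cm (1 - H) * T.adjugate : Matrix ι ι k[X]) i j :=
        ⟨_, (congrFun (congrFun hV i) j).trans (mul_assoc _ _ _)⟩
      have e3 : T.adjugate = cm (1 - H) * T.adjugate + cm H * T.adjugate := by
        rw [← add_mul, ← map_add]; simp
      rw [e3, Matrix.add_apply, mul_add]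
      exact dvd_add e2 (e1.mul_left g)
    obtain ⟨i, j, hij⟩ : ∃ i j, M₀.adjugate i j ≠ 0 := by
      by_contra! hcon
      exact hA' (by ext i j; exact hcon i j)
    have hc2 : IsCoprime (X ^ s : k[X]) (T.adjugate i j) := by
      apply IsCoprime.pow_left
      rw [irreducible_X.coprime_iff_not_dvd, X_dvd_iff, coeff_zero_eq_eval_zero]
      have h2 : (evalRingHom (0 : k)).mapMatrix T = M₀ := by
        ext i j
        simp [hT, cm_apply]
      have h3 := RingHom.map_adjugate (evalRingHom (0 : k)) T
      rw [h2] at h3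
      rw [← h3] at hij
      exact hij
    exact hc2.dvd_of_dvd_mul_right (hd i j)

end helperB2

section helperC

variable {k : Type*} [Field k] {ι : Type*} [Fintype ι] [DecidableEq ι]

lemma exists_cyclic (D H : Matrix ι ι k) (hHH : H * H = H) (hDH : D * H = H * D) (p : k[X])
    (hp : ∀ g, H * aeval D g = 0 → p ∣ g) :
    ∃ x : ι → k, H *ᵥ x = x ∧ ∀ g : k[X], aeval D g *ᵥ x = 0 → p ∣ g := by
  let V := LinearMap.range (Matrix.mulVecLin H)
  have hV : ∀ v ∈ V, Matrix.mulVecLin D v ∈ V := by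
    rintro _ ⟨w, rfl⟩
    refine ⟨D *ᵥ w, ?_⟩
    simp [hDH]
  let φ : V →ₗ[k] V := (Matrix.mulVecLin D).restrict hV
  have hφ : ∀ (g : k[X]) (v : V), ((aeval φ g v : V) : ι → k) = aeval D g *ᵥ (v : ι → k) := by
    intro g
    induction g using Polynomial.induction_on with
    | C a => intro v; simp [Algebra.algebraMap_eq_smul_one, Matrix.smul_mulVec]
    | add a b ha hb => intro v; simp [ha, hb, Matrix.add_mulVec]
    | monomial m a ih =>
      intro v
      have e1 : aeval φ (C a * X ^ m * X) = aeval φ (C a * X ^ m) * φ := by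
        rw [map_mul _ (C a * X ^ m) X, aeval_X]
      have e2 : aeval D (C a * X ^ m * X) = aeval D (C a * X ^ m) * D := by
        rw [map_mul _ (C a * X ^ m) X, aeval_X]
      rw [pow_succ, ← mul_assoc, e1, e2, Module.End.mul_apply, ih, ← Matrix.mulVec_mulVec]
      rfl
  obtain ⟨x, hx⟩ := Module.exists_ker_toSpanSingleton_eq_annihilator k[X] (Module.AEval' φ)
  obtain ⟨x, rfl⟩ := (Module.AEval'.of φ).surjective x
  refine ⟨x, ?_, ?_⟩
  · obtain ⟨w, hw⟩ := x.2
    rw [← hw]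
    simp [hHH]
  · intro g hg
    apply hp
    have h1 : g ∈ LinearMap.ker (LinearMap.toSpanSingleton k[X] _ (Module.AEval'.of φ x)) := by
      rw [LinearMap.mem_ker, LinearMap.toSpanSingleton_apply]
      have : aeval φ g x = 0 := by
        apply Subtype.ext
        rw [hφ, hg]; rfl
      have h2 := Module.AEval.of_aeval_smul (R := k) (a := φ) g x
      rw [Module.End.smul_def, this, map_zero] at h2
      exact h2.symm
    rw [hx, Module.mem_annihilator] at h1
    have h3 : ∀ v : V, aeval D g *ᵥ (v : ι → k) = 0 := by
      intro v
      have h2 := Module.AEval.of_aeval_smul (R := k) (a := φ) g v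
      rw [Module.End.smul_def] at h2
      have h4 := h1 (Module.AEval'.of φ v)
      have h5 : aeval φ g v = 0 := (Module.AEval.of k V φ).map_eq_zero_iff.1 (h2.trans h4)
      rw [← hφ, h5]; rfl
    have h4 : aeval D g * H = 0 := by
      apply Matrix.ext_of_mulVec_single
      intro i
      rw [← Matrix.mulVec_mulVec]
      rw [zero_mulVec]
      exact h3 ⟨H *ᵥ Pi.single i 1, ⟨_, rfl⟩⟩
    rw [← h4]
    have hc : Commute H D := hDH.symm
    exact (Algebra.commute_of_mem_adjoin_of_forall_mem_commute
        (aeval_mem_adjoin_singleton k D)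
        (fun b hb => by rw [Set.mem_singleton_iff.1 hb]; exact hc)).eq

lemma commute_aeval {A : Type*} [Ring A] [Algebra k A] {P D : A} (h : Commute P D) (g : k[X]) :
    Commute P (aeval D g) :=
  Algebra.commute_of_mem_adjoin_of_forall_mem_commute
        (aeval_mem_adjoin_singleton k D)
        (fun b hb => by rw [Set.mem_singleton_iff.1 hb]; exact h)

lemma ring_aux {A : Type*} [Ring A] (H K a a' b b' : A) (hHH : H * H = H) (hKK : K * K = K)
    (hHK : H * K = 0) (hKH : K * H = 0) (c1 : H * a = a * H) (c2 : K * b = b * K) :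
    H * (a * a') + K * (b * b') = (H * a + K * b) * (H * a' + K * b') := by
  have e : (H * a + K * b) * (H * a' + K * b')
    = H * a * (H * a') + H * a * (K * b') + K * b * (H * a') + K * b * (K * b') := by
    noncomm_ring
  rw [e, c1, c2]
  have e2 : a * H * (H * a') + a * H * (K * b') + b * K * (H * a') + b * K * (K * b')
    = a * (H * H) * a' + a * (H * K) * b' + b * (K * H) * a' + b * (K * K) * b' := by
    noncomm_ring
  rw [e2, hHH, hKK, hHK, hKH, ← c1, ← c2]
  noncomm_ring

theorem lemC (H D N : Matrix ι ι k) (hHH : H * H = H) (hDH : D * H = H * D)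
    (hNH : N * H = H * N) (p q : k[X]) (hp0 : p ≠ 0) (hq0 : q ≠ 0)
    (hdeg : p.natDegree + q.natDegree = Fintype.card ι)
    (hpa : H * aeval D p = 0) (hp : ∀ g, H * aeval D g = 0 → p ∣ g)
    (hqa : (1 - H) * aeval N q = 0) (hq : ∀ g, (1 - H) * aeval N g = 0 → q ∣ g) :
    ∃ ρ : (AdjoinRoot p × AdjoinRoot q) →ₐ[k] Matrix ι ι k,
      (∀ g h, ρ (AdjoinRoot.mk p g, AdjoinRoot.mk q h) = H * aeval D g + (1 - H) * aeval N h) ∧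
      Function.Injective ρ ∧ (∀ β, (ρ β).det = Algebra.norm k β) ∧
      ∀ P, P * H = H * P → P * D = D * P → P * N = N * P → ∃ β, ρ β = P := by
  have hKK : (1 - H) * (1 - H) = 1 - H := by rw [mul_sub, mul_one, sub_mul, one_mul, hHH]; simp
  have hHK : H * (1 - H) = 0 := by rw [mul_sub, mul_one, hHH, sub_self]
  have hKH : (1 - H) * H = 0 := by rw [sub_mul, one_mul, hHH, sub_self]
  have hNK : N * (1 - H) = (1 - H) * N := by rw [mul_sub, sub_mul, hNH, mul_one, one_mul]
  let f : AdjoinRoot p × AdjoinRoot q → Matrix ι ι k := fun β =>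
    H * aeval D (Function.surjInv AdjoinRoot.mk_surjective β.1) +
      (1 - H) * aeval N (Function.surjInv AdjoinRoot.mk_surjective β.2)
  have wd : ∀ (H D : Matrix ι ι k) (p g g' : k[X]), H * aeval D p = 0 →
      AdjoinRoot.mk p g = AdjoinRoot.mk p g' → H * aeval D g = H * aeval D g' := by
    intro H D p g g' h0 h
    rw [AdjoinRoot.mk_eq_mk] at h
    obtain ⟨t, ht⟩ := h
    rw [← sub_eq_zero, ← mul_sub, ← map_sub, ht, map_mul, ← mul_assoc, h0, zero_mul]
  have hf : ∀ g h, f (AdjoinRoot.mk p g, AdjoinRoot.mk q h)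
      = H * aeval D g + (1 - H) * aeval N h := by
    intro g h
    change H * _ + (1 - H) * _ = _
    rw [wd H D p _ g hpa (Function.surjInv_eq _ _), wd (1 - H) N q _ h hqa (Function.surjInv_eq _ _)]
  have hsurj : ∀ β : AdjoinRoot p × AdjoinRoot q, ∃ g h,
      β = (AdjoinRoot.mk p g, AdjoinRoot.mk q h) := by
    rintro ⟨a, b⟩
    obtain ⟨g, rfl⟩ := AdjoinRoot.mk_surjective a
    obtain ⟨h, rfl⟩ := AdjoinRoot.mk_surjective b
    exact ⟨g, h, rfl⟩
  let fl : (AdjoinRoot p × AdjoinRoot q) →ₗ[k] Matrix ι ι k :=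
    { toFun := f
      map_add' := by
        intro a b
        obtain ⟨g, h, rfl⟩ := hsurj a
        obtain ⟨g', h', rfl⟩ := hsurj b
        rw [Prod.mk_add_mk, ← map_add, ← map_add, hf, hf, hf]
        simp only [map_add, mul_add]
        abel
      map_smul' := by
        intro c a
        obtain ⟨g, h, rfl⟩ := hsurj a
        rw [Prod.smul_mk, AdjoinRoot.smul_mk, AdjoinRoot.smul_mk, hf, hf]
        simp }
  have hone : fl 1 = 1 := by
    have : (1 : AdjoinRoot p × AdjoinRoot q) = (AdjoinRoot.mk p 1, AdjoinRoot.mk q 1) := by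
      rw [map_one, map_one]; rfl
    change f 1 = 1
    rw [this, hf]; simp
  have hmul : ∀ a b, fl (a * b) = fl a * fl b := by
    intro a b
    obtain ⟨g, h, rfl⟩ := hsurj a
    obtain ⟨g', h', rfl⟩ := hsurj b
    change f _ = f _ * f _
    rw [Prod.mk_mul_mk, ← map_mul, ← map_mul, hf, hf, hf, map_mul, map_mul]
    have c1 : H * aeval D g = aeval D g * H := (commute_aeval (show Commute H D from hDH.symm) g).eq
    have c2 : (1 - H) * aeval N h = aeval N h * (1 - H) :=
      (commute_aeval (show Commute (1 - H) N from hNK.symm) h).eq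
    exact ring_aux H (1 - H) _ _ _ _ hHH hKK hHK hKH c1 c2
  let ρ : (AdjoinRoot p × AdjoinRoot q) →ₐ[k] Matrix ι ι k := AlgHom.ofLinearMap fl hone hmul
  have hρ : ∀ g h, ρ (AdjoinRoot.mk p g, AdjoinRoot.mk q h)
      = H * aeval D g + (1 - H) * aeval N h := hf
  obtain ⟨x, hx, hxp⟩ := exists_cyclic D H hHH hDH p hp
  obtain ⟨y, hy, hyq⟩ := exists_cyclic N (1 - H) hKK hNK q hq
  have hHy : H *ᵥ y = 0 := by rw [← hy, mulVec_mulVec, hHK, zero_mulVec]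
  have hKx : (1 - H) *ᵥ x = 0 := by rw [← hx, mulVec_mulVec, hKH, zero_mulVec]
  let ψ : (AdjoinRoot p × AdjoinRoot q) →ₗ[k] (ι → k) :=
    { toFun := fun β => ρ β *ᵥ (x + y)
      map_add' := by intro a b; rw [map_add, add_mulVec]
      map_smul' := by intro c a; rw [map_smul, smul_mulVec]; rfl }
  have hψi : Function.Injective ψ := by
    rw [injective_iff_map_eq_zero]
    intro β hβ
    obtain ⟨g, h, rfl⟩ := hsurj β
    change ρ _ *ᵥ (x + y) = 0 at hβ
    rw [hρ] at hβ
    have c1 : H * aeval D g = aeval D g * H := (commute_aeval (show Commute H D from hDH.symm) g).eq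
    have c2 : (1 - H) * aeval N h = aeval N h * (1 - H) :=
      (commute_aeval (show Commute (1 - H) N from hNK.symm) h).eq
    have d1 : aeval D g *ᵥ x = 0 := by
      have := congrArg (fun v => H *ᵥ v) hβ
      simp only [mulVec_mulVec, mulVec_zero] at this
      rw [mul_add, ← mul_assoc, ← mul_assoc, hHH, hHK, zero_mul, add_zero, c1, ← mulVec_mulVec,
        mulVec_add, hx, hHy, add_zero] at this
      exact this
    have d2 : aeval N h *ᵥ y = 0 := by
      have := congrArg (fun v => (1 - H) *ᵥ v) hβ
      simp only [mulVec_mulVec, mulVec_zero] at this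
      rw [mul_add, ← mul_assoc, ← mul_assoc, hKK, hKH, zero_mul, zero_add, c2, ← mulVec_mulVec,
        mulVec_add, hy, hKx, zero_add] at this
      exact this
    rw [AdjoinRoot.mk_eq_zero.2 (hxp g d1), AdjoinRoot.mk_eq_zero.2 (hyq h d2)]
    rfl
  have : Module.Finite k (AdjoinRoot p) := (AdjoinRoot.powerBasis hp0).finite
  have : Module.Finite k (AdjoinRoot q) := (AdjoinRoot.powerBasis hq0).finite
  have hdim : Module.finrank k (AdjoinRoot p × AdjoinRoot q) = Module.finrank k (ι → k) := by
    rw [Module.finrank_prod, (AdjoinRoot.powerBasis hp0).finrank,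
      (AdjoinRoot.powerBasis hq0).finrank, AdjoinRoot.powerBasis_dim, AdjoinRoot.powerBasis_dim,
      hdeg, Module.finrank_fintype_fun_eq_card]
  let e := LinearEquiv.ofInjectiveOfFinrankEq ψ hψi hdim
  have he : ∀ β, e β = ρ β *ᵥ (x + y) := fun β => rfl
  refine ⟨ρ, hρ, ?_, ?_, ?_⟩
  · intro a b hab
    apply e.injective
    rw [he, he, hab]
  · intro β
    rw [Algebra.norm_apply, ← LinearMap.det_conj _ e, ← LinearMap.det_toLin']
    have key : Matrix.toLin' (ρ β) = (e : (AdjoinRoot p × AdjoinRoot q) →ₗ[k] (ι → k)) ∘ₗ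
        (Algebra.lmul k (AdjoinRoot p × AdjoinRoot q) β) ∘ₗ
        (e.symm : (ι → k) →ₗ[k] (AdjoinRoot p × AdjoinRoot q)) := by
      apply LinearMap.ext
      intro v
      obtain ⟨γ, rfl⟩ := e.surjective v
      have : e (β * γ) = ρ β *ᵥ e γ := by
        rw [he, he, map_mul, mulVec_mulVec]
      simp [this]
    rw [key]
  · intro P h1 h2 h3
    obtain ⟨β, hβ⟩ := e.surjective (P *ᵥ (x + y))
    refine ⟨β, ?_⟩
    have hcom : ∀ γ, Commute P (ρ γ) := by
      intro γ
      obtain ⟨g, h, rfl⟩ := hsurj γ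
      rw [hρ]
      have hPH : Commute P H := h1
      exact (hPH.mul_right (commute_aeval (show Commute P D from h2) g)).add_right
        (((Commute.one_right P).sub_right hPH).mul_right
          (commute_aeval (show Commute P N from h3) h))
    apply Matrix.ext_of_mulVec_single
    intro i
    obtain ⟨γ, hγ⟩ := e.surjective (Pi.single i 1)
    rw [← hγ, he, mulVec_mulVec, mulVec_mulVec, (hcom γ).eq, ← map_mul, mul_comm, map_mul,
      ← mulVec_mulVec, ← mulVec_mulVec, ← hβ, he]

end helperC

section helperE

variable {k : Type*} [Field k]

lemma hom_facts (d : ℕ) (f : MvPolynomial (Fin 2) k) (hf0 : f ≠ 0) (hfh : f.IsHomogeneous d) :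
    dehomog f ≠ 0 ∧ (dehomog f).natDegree ≤ d ∧
      ∃ u : k[X], MvPolynomial.aeval ![1, (X : k[X])] f = X ^ (d - (dehomog f).natDegree) * u ∧
        u.coeff 0 ≠ 0 := by
  have hp : dehomog f = ∑ m ∈ f.support, C (f.coeff m) * X ^ (m 0) := by
    rw [dehomog, MvPolynomial.aeval_def, MvPolynomial.eval₂_eq']
    refine Finset.sum_congr rfl fun m _ => ?_
    simp [Fin.prod_univ_two]
  have hq : MvPolynomial.aeval ![1, (X : k[X])] f = ∑ m ∈ f.support, C (f.coeff m) * X ^ (m 1) := by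
    rw [MvPolynomial.aeval_def, MvPolynomial.eval₂_eq']
    refine Finset.sum_congr rfl fun m _ => ?_
    simp [Fin.prod_univ_two]
  have hm : ∀ m ∈ f.support, m 0 + m 1 = d := by
    intro m h
    have := hfh (MvPolynomial.mem_support_iff.1 h)
    rw [Finsupp.weight_apply, Finsupp.sum_fintype _ _ (by simp)] at this
    simpa [Fin.sum_univ_two] using this
  have hc : ∀ j, (dehomog f).coeff j = ∑ m ∈ f.support, if j = m 0 then f.coeff m else 0 := by
    intro j
    rw [hp, finsetSum_coeff]
    exact Finset.sum_congr rfl fun m _ => coeff_C_mul_X_pow _ _ _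
  have hcq : ∀ j ≤ d, (MvPolynomial.aeval ![1, (X : k[X])] f).coeff j = (dehomog f).coeff (d - j) := by
    intro j hj
    rw [hc, hq, finsetSum_coeff]
    refine Finset.sum_congr rfl fun m h => ?_
    rw [coeff_C_mul_X_pow]
    have := hm m h
    have e : j = m 1 ↔ d - j = m 0 := by omega
    simp only [e]
  have hp0 : dehomog f ≠ 0 := by
    intro h0
    obtain ⟨m, hmem⟩ := MvPolynomial.support_nonempty.2 hf0
    have h1 := hc (m 0)
    rw [h0, coeff_zero, Finset.sum_eq_single m] at h1
    · rw [if_pos rfl] at h1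
      exact MvPolynomial.mem_support_iff.1 hmem h1.symm
    · intro m' h' hne
      rw [if_neg]
      intro h2
      apply hne
      have a := hm m hmem
      have b := hm m' h'
      ext i
      fin_cases i
      · exact h2.symm
      · change m' 1 = m 1
        omega
    · intro h; exact absurd hmem h
  have hd : (dehomog f).natDegree ≤ d := by
    rw [natDegree_le_iff_coeff_eq_zero]
    intro j hj
    rw [hc]
    refine Finset.sum_eq_zero fun m h => ?_
    have := hm m h
    rw [if_neg (by omega)]
  refine ⟨hp0, hd, ?_⟩
  have hdvd : X ^ (d - (dehomog f).natDegree) ∣ MvPolynomial.aeval ![1, (X : k[X])] f := by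
    rw [X_pow_dvd_iff]
    intro j hj
    rw [hcq j (by omega)]
    exact coeff_eq_zero_of_natDegree_lt (by omega)
  obtain ⟨u, hu⟩ := hdvd
  refine ⟨u, hu, ?_⟩
  have h1 := hcq (d - (dehomog f).natDegree) (by omega)
  rw [hu] at h1
  have h2 := coeff_X_pow_mul u (d - (dehomog f).natDegree) 0
  rw [zero_add] at h2
  rw [h2, Nat.sub_sub_self hd] at h1
  rw [h1]
  exact leadingCoeff_ne_zero.2 hp0

lemma det_spec {ι : Type*} [Fintype ι] [DecidableEq ι] (f : MvPolynomial (Fin 2) k)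
    (M₀ M₁ : Matrix ι ι k) (a b : k[X])
    (hdet : ((MvPolynomial.X 0 : MvPolynomial (Fin 2) k) •
        M₀.map (MvPolynomial.C : k → MvPolynomial (Fin 2) k)
      + (MvPolynomial.X 1 : MvPolynomial (Fin 2) k) •
        M₁.map (MvPolynomial.C : k → MvPolynomial (Fin 2) k)).det = f) :
    (a • cm M₀ + b • cm M₁).det = MvPolynomial.aeval ![a, b] f := by
  rw [← hdet, AlgHom.map_det]
  congr 1
  ext1 i j
  simp [cm_apply, Polynomial.algebraMap_eq]

lemma hA_aux (n : ℕ) (M₀ M₁ : Matrix (Fin (n + 1)) (Fin (n + 1)) k)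
    (hrank : ∀ a b : AlgebraicClosure k, (a, b) ≠ (0, 0) →
      n ≤ (a • M₀.map (algebraMap k (AlgebraicClosure k))
        + b • M₁.map (algebraMap k (AlgebraicClosure k))).rank) (x : AlgebraicClosure k) :
    ((X : k[X]) • cm M₀ + cm M₁).adjugate.map (aeval x) ≠ 0 := by
  have h := adj_ne_zero _ (hrank x 1 (by simp))
  have e := RingHom.map_adjugate (aeval x : k[X] →ₐ[k] AlgebraicClosure k).toRingHom
    ((X : k[X]) • cm M₀ + cm M₁)
  intro h0
  apply h
  rw [← h0]
  refine Eq.trans ?_ e.symm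
  congr 1
  ext1 i j
  simp [cm_apply]
  exact mul_comm _ _

lemma hA'_aux (n : ℕ) (M₀ M₁ : Matrix (Fin (n + 1)) (Fin (n + 1)) k)
    (hrank : ∀ a b : AlgebraicClosure k, (a, b) ≠ (0, 0) →
      n ≤ (a • M₀.map (algebraMap k (AlgebraicClosure k))
        + b • M₁.map (algebraMap k (AlgebraicClosure k))).rank) :
    M₀.adjugate ≠ 0 := by
  have h := adj_ne_zero _ (hrank 1 0 (by simp))
  have e := RingHom.map_adjugate (algebraMap k (AlgebraicClosure k)) M₀
  intro h0
  apply h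
  rw [h0, map_zero] at e
  rw [one_smul, zero_smul, add_zero]
  exact e.symm

lemma aeval_transpose {ι : Type*} [Fintype ι] [DecidableEq ι] (D Z : Matrix ι ι k)
    (h : Dᵀ * Z = Z * D) (g : k[X]) : (aeval D g)ᵀ * Z = Z * aeval D g := by
  induction g using Polynomial.induction_on with
  | C a => simp [Algebra.algebraMap_eq_smul_one]
  | add a b ha hb => simp [add_mul, mul_add, ha, hb]
  | monomial m a ih =>
    have e2 : aeval D (C a * X ^ m * X) = aeval D (C a * X ^ m) * D := by
      rw [map_mul _ (C a * X ^ m) X, aeval_X]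
    rw [pow_succ, ← mul_assoc, e2, transpose_mul, mul_assoc, ih]
    have hc : D * aeval D (C a * X ^ m) = aeval D (C a * X ^ m) * D :=
      (commute_aeval (Commute.refl D) _).eq
    rw [← hc, ← mul_assoc, h, mul_assoc]

/-- main linear algebra statement -/
theorem mainLA (n : ℕ) (f : MvPolynomial (Fin 2) k) (hf0 : f ≠ 0) (hfh : f.IsHomogeneous (n + 1))
    (M₀ M₁ : Matrix (Fin (n + 1)) (Fin (n + 1)) k)
    (hs₀ : M₀.IsSymm) (hs₁ : M₁.IsSymm)
    (hdet : ((MvPolynomial.X 0 : MvPolynomial (Fin 2) k) •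
        M₀.map (MvPolynomial.C : k → MvPolynomial (Fin 2) k)
      + (MvPolynomial.X 1 : MvPolynomial (Fin 2) k) •
        M₁.map (MvPolynomial.C : k → MvPolynomial (Fin 2) k)).det = f)
    (hrank : ∀ a b : AlgebraicClosure k, (a, b) ≠ (0, 0) →
      n ≤ (a • M₀.map (algebraMap k (AlgebraicClosure k))
        + b • M₁.map (algebraMap k (AlgebraicClosure k))).rank) :
    ∃ ρ : SegreAlgebra k n f →ₐ[k] Matrix (Fin (n + 1)) (Fin (n + 1)) k,
      Function.Injective ρ ∧ (∀ β, (ρ β).det = Algebra.norm k β) ∧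
      (∀ β, (ρ β)ᵀ * M₀ = M₀ * ρ β) ∧ (∀ β, (ρ β)ᵀ * M₁ = M₁ * ρ β) ∧
      (∀ P R : Matrix (Fin (n + 1)) (Fin (n + 1)) k, P * R = 1 →
        Pᵀ * M₀ * P = M₀ → Pᵀ * M₁ * P = M₁ → ∃ β, ρ β = P) ∧
      (∀ W, M₀ * W = M₀ → M₁ * W = M₁ → W = 1) := by
  obtain ⟨hp0, hdeg, u, hTu, hu⟩ := hom_facts (n + 1) f hf0 hfh
  have hS := det_spec f M₀ M₁ X 1 hdet
  have hT := det_spec f M₀ M₁ 1 X hdet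
  rw [one_smul] at hS hT
  change _ = dehomog f at hS
  rw [hTu] at hT
  obtain ⟨H, B, hHH, hH0, hH1, hBS, hcom, hZu⟩ := splitA M₀ M₁ hs₀ hs₁ (dehomog f) hp0 _ rfl hS
  obtain ⟨Z, D₀, D₁, hZ, hZd, hZ0, hZ1, hZt, hHZ, h0H, h1H, h01, hpa, hp, hqa, hq⟩ :=
    B2 M₀ M₁ hs₀ hs₁ (dehomog f) _ rfl hS H B hHH hH0 hH1 hBS hZu _ rfl _ u hT hu
      (hA_aux n M₀ M₁ hrank) (hA'_aux n M₀ M₁ hrank)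
  have hZl : ∀ A B : Matrix (Fin (n + 1)) (Fin (n + 1)) k, Z * A = Z * B → A = B := by
    intro A B h
    have := congrArg (fun Y => Z⁻¹ * Y) h
    simpa only [Matrix.nonsing_inv_mul_cancel_left _ _ hZd] using this
  obtain ⟨ρ, hρ, hρi, hρd, hρc⟩ := lemC H (-D₁) (-D₀) hHH (by simp [h1H]) (by simp [h0H])
    (dehomog f) (X ^ (n + 1 - (dehomog f).natDegree)) hp0 (pow_ne_zero _ X_ne_zero)
    (by rw [natDegree_X_pow, Fintype.card_fin]; omega) hpa hp hqa hq
  have hsurj : ∀ β : SegreAlgebra k n f, ∃ g h, β = (AdjoinRoot.mk _ g, AdjoinRoot.mk _ h) := by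
    rintro ⟨a, b⟩
    obtain ⟨g, rfl⟩ := AdjoinRoot.mk_surjective a
    obtain ⟨h, rfl⟩ := AdjoinRoot.mk_surjective b
    exact ⟨g, h, rfl⟩
  have t0 : D₀ᵀ * Z = Z * D₀ := by
    rw [hZ0, ← hZt, ← transpose_mul, hZ0]; exact hs₀
  have t1 : D₁ᵀ * Z = Z * D₁ := by
    rw [hZ1, ← hZt, ← transpose_mul, hZ1]; exact hs₁
  have cc : ∀ A, Commute A H → Commute A D₀ → Commute A D₁ → ∀ β, Commute A (ρ β) := by
    intro A aH a0 a1 β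
    obtain ⟨g, h, rfl⟩ := hsurj β
    rw [hρ]
    exact (aH.mul_right (commute_aeval a1.neg_right g)).add_right
        (((Commute.one_right A).sub_right aH).mul_right (commute_aeval a0.neg_right h))
  have c0 := cc D₀ h0H (Commute.refl _) h01
  have c1 := cc D₁ h1H h01.symm (Commute.refl _)
  have hρZ : ∀ β, (ρ β)ᵀ * Z = Z * ρ β := by
    intro β
    obtain ⟨g, h, rfl⟩ := hsurj β
    rw [hρ]
    have e1 := aeval_transpose (-D₁) Z (by simp [t1]) g
    have e2 := aeval_transpose (-D₀) Z (by simp [t0]) h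
    have f1 : H * aeval (-D₁) g = aeval (-D₁) g * H :=
      (commute_aeval (show Commute H (-D₁) from Commute.neg_right (show Commute D₁ H from h1H).symm) g).eq
    have f2 : H * aeval (-D₀) h = aeval (-D₀) h * H :=
      (commute_aeval (show Commute H (-D₀) from Commute.neg_right (show Commute D₀ H from h0H).symm) h).eq
    have f2' : (1 - H) * aeval (-D₀) h = aeval (-D₀) h * (1 - H) := by
      rw [sub_mul, mul_sub, f2, one_mul, mul_one]
    have g' : (1 - H)ᵀ * Z = Z * (1 - H) := by
      rw [transpose_sub, transpose_one, sub_mul, mul_sub, hHZ, one_mul, mul_one]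
    rw [f1, f2', transpose_add, transpose_mul, transpose_mul, add_mul, mul_add, mul_assoc, e1,
      mul_assoc, e2, ← mul_assoc, hHZ, ← mul_assoc, g', mul_assoc, mul_assoc, f1, f2']
  refine ⟨ρ, hρi, hρd, ?_, ?_, ?_, ?_⟩
  · intro β
    rw [← hZ0, ← mul_assoc, hρZ, mul_assoc, mul_assoc, (c0 β).eq]
  · intro β
    rw [← hZ1, ← mul_assoc, hρZ, mul_assoc, mul_assoc, (c1 β).eq]
  · intro P R hPR h0 h1
    have hRP : R * P = 1 := mul_eq_one_comm.1 hPR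
    have k0 : Pᵀ * M₀ = M₀ * R := by
      calc Pᵀ * M₀ = Pᵀ * M₀ * (P * R) := by rw [hPR, mul_one]
        _ = M₀ * R := by rw [← mul_assoc, h0]
    have k1 : Pᵀ * M₁ = M₁ * R := by
      calc Pᵀ * M₁ = Pᵀ * M₁ * (P * R) := by rw [hPR, mul_one]
        _ = M₁ * R := by rw [← mul_assoc, h1]
    have rH := hcom R Pᵀ k0 k1
    have kZ : Pᵀ * Z = Z * R := by
      have rH' : R * (1 - H) = (1 - H) * R := by
        rw [sub_mul, mul_sub, rH, one_mul, mul_one]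
      rw [hZ, mul_add, add_mul, ← mul_assoc, ← mul_assoc, k0, k1, mul_assoc, mul_assoc, rH, rH',
        ← mul_assoc, ← mul_assoc]
    have r0 : R * D₀ = D₀ * R := by
      apply hZl
      rw [← mul_assoc, ← kZ, mul_assoc, hZ0, k0, ← mul_assoc, hZ0]
    have r1 : R * D₁ = D₁ * R := by
      apply hZl
      rw [← mul_assoc, ← kZ, mul_assoc, hZ1, k1, ← mul_assoc, hZ1]
    have flip : ∀ A, R * A = A * R → P * A = A * P := by
      intro A h
      calc P * A = P * A * (R * P) := by rw [hRP, mul_one]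
        _ = P * (A * R) * P := by noncomm_ring
        _ = (P * R) * A * P := by rw [← h]; noncomm_ring
        _ = A * P := by rw [hPR, one_mul]
    exact hρc P (flip H rH) (flip _ (by simp [r1])) (flip _ (by simp [r0]))
  · intro W w0 w1
    have wH := hcom W 1 (by rw [one_mul, w0]) (by rw [one_mul, w1])
    apply hZl
    rw [hZ, mul_one, add_mul, mul_assoc, mul_assoc, ← wH, sub_mul, one_mul, ← wH]
    have : W - W * H = W * (1 - H) := by rw [mul_sub, mul_one]
    rw [this, ← mul_assoc, ← mul_assoc, w0, w1]

end helperE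

theorem stabilizer_isomorphic_to_two_torsion_norm_one_units
    (k : Type*) [Field k] (n : ℕ) (hn : 1 ≤ n)
    (f : MvPolynomial (Fin 2) k) (hf0 : f ≠ 0) (hfh : f.IsHomogeneous (n + 1))
    (M₀ M₁ : Matrix (Fin (n + 1)) (Fin (n + 1)) k)
    (hs₀ : M₀.IsSymm) (hs₁ : M₁.IsSymm)
    (hdet : ((MvPolynomial.X 0 : MvPolynomial (Fin 2) k) •
        M₀.map (MvPolynomial.C : k → MvPolynomial (Fin 2) k)
      + (MvPolynomial.X 1 : MvPolynomial (Fin 2) k) •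
        M₁.map (MvPolynomial.C : k → MvPolynomial (Fin 2) k)).det = f)
    (hrank : ∀ a b : AlgebraicClosure k, (a, b) ≠ (0, 0) →
      n ≤ (a • M₀.map (algebraMap k (AlgebraicClosure k))
        + b • M₁.map (algebraMap k (AlgebraicClosure k))).rank) :
    ∃ φ : {P : Matrix.SpecialLinearGroup (Fin (n + 1)) k // IsStabilizing M₀ M₁ P} ≃
        {β : (SegreAlgebra k n f)ˣ //
          β ^ 2 = 1 ∧ Algebra.norm k (β : SegreAlgebra k n f) = 1},
      ∀ (P Q : {P : Matrix.SpecialLinearGroup (Fin (n + 1)) k // IsStabilizing M₀ M₁ P})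
        (hPQ : IsStabilizing M₀ M₁ ((P : Matrix.SpecialLinearGroup (Fin (n + 1)) k) *
          (Q : Matrix.SpecialLinearGroup (Fin (n + 1)) k))),
        (φ ⟨(P : Matrix.SpecialLinearGroup (Fin (n + 1)) k) *
            (Q : Matrix.SpecialLinearGroup (Fin (n + 1)) k), hPQ⟩ :
          (SegreAlgebra k n f)ˣ) =
        (φ P : (SegreAlgebra k n f)ˣ) * (φ Q : (SegreAlgebra k n f)ˣ) := by
  obtain ⟨ρ, hi, hd, h0, h1, hs, hW⟩ := mainLA n f hf0 hfh M₀ M₁ hs₀ hs₁ hdet hrank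
  let ψ : {β : (SegreAlgebra k n f)ˣ //
          β ^ 2 = 1 ∧ Algebra.norm k (β : SegreAlgebra k n f) = 1} →
      {P : Matrix.SpecialLinearGroup (Fin (n + 1)) k // IsStabilizing M₀ M₁ P} := fun β =>
    ⟨⟨ρ (β.1 : SegreAlgebra k n f), by rw [hd, β.2.2]⟩, by
      have hb : (β.1 : SegreAlgebra k n f) * (β.1 : SegreAlgebra k n f) = 1 := by
        rw [← Units.val_mul, ← pow_two, β.2.1, Units.val_one]
      have hb2 : ρ (β.1 : SegreAlgebra k n f) * ρ (β.1 : SegreAlgebra k n f) = 1 := by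
        rw [← map_mul, hb, map_one]
      constructor
      · change (ρ _)ᵀ * M₀ * ρ _ = M₀
        rw [h0, mul_assoc, hb2, mul_one]
      · change (ρ _)ᵀ * M₁ * ρ _ = M₁
        rw [h1, mul_assoc, hb2, mul_one]⟩
  have hψ : ∀ β, ((ψ β).1 : Matrix (Fin (n + 1)) (Fin (n + 1)) k) =
    ρ (β.1 : SegreAlgebra k n f) := fun β => rfl
  have hψi : Function.Injective ψ := by
    intro a b hab
    apply Subtype.ext
    apply Units.ext
    apply hi
    rw [← hψ, ← hψ, hab]
  have hψs : Function.Surjective ψ := by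
    rintro ⟨P, hP0, hP1⟩
    obtain ⟨β, hβ⟩ := hs P.1 (P⁻¹).1
      (by rw [← Matrix.SpecialLinearGroup.coe_mul, mul_inv_cancel,
        Matrix.SpecialLinearGroup.coe_one]) hP0 hP1
    have hPP : (P : Matrix (Fin (n + 1)) (Fin (n + 1)) k) * P.1 = 1 := by
      apply hW
      · rw [← mul_assoc, ← hβ, ← h0, hβ]; exact hP0
      · rw [← mul_assoc, ← hβ, ← h1, hβ]; exact hP1
    have hbb : β * β = 1 := by
      apply hi
      rw [map_mul, hβ, hPP, map_one]
    refine ⟨⟨⟨β, β, hbb, hbb⟩, ?_, ?_⟩, ?_⟩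
    · apply Units.ext
      rw [pow_two]
      exact hbb
    · change Algebra.norm k β = 1
      rw [← hd, hβ]; exact P.2
    · apply Subtype.ext
      apply Subtype.ext
      exact hβ
  refine ⟨(Equiv.ofBijective ψ ⟨hψi, hψs⟩).symm, ?_⟩
  intro P Q hPQ
  obtain ⟨a, rfl⟩ := hψs P
  obtain ⟨b, rfl⟩ := hψs Q
  obtain ⟨c, hc⟩ := hψs ⟨_, hPQ⟩
  rw [← hc]
  have e : ∀ x, (Equiv.ofBijective ψ ⟨hψi, hψs⟩).symm (ψ x) = x := fun x =>
    (Equiv.ofBijective ψ ⟨hψi, hψs⟩).symm_apply_apply x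
  rw [e, e, e]
  apply Units.ext
  apply hi
  rw [Units.val_mul, map_mul, ← hψ, ← hψ, ← hψ, hc, Matrix.SpecialLinearGroup.coe_mul]
end

section
/- Let k be a field with a fixed algebraic closure k̄, n ≥ 1, and f(X_0,X_1) ∈ k[X_0,X_1] a nonzero homogeneous polynomial of degree n+1. Then the following are equivalent: (i) f is squarefree in k[X_0,X_1] (f has no repeated irreducible factors over k); (ii) every pair (M_0,M_1) of symmetric (n+1)×(n+1) matrices over k for which det(X_0 M_0 + X_1 M_1) = c·f for some c ∈ k^× satisfies rank(a M_0 + b M_1) ≥ n for all (a,b) ∈ k̄² with (a,b) ≠ (0,0). -/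
open Matrix

lemma aux_rank_add {K : Type*} [Field K] {m n : Type*} [Fintype m] [Fintype n] (A B : Matrix m n K) :
    (A + B).rank ≤ A.rank + B.rank := by
  classical
  unfold Matrix.rank
  rw [Matrix.mulVecLin_add]
  refine le_trans (Submodule.finrank_mono (t := LinearMap.range A.mulVecLin ⊔ LinearMap.range B.mulVecLin) ?_)
    (Submodule.finrank_add_le_finrank_add_finrank _ _)
  rintro _ ⟨v, rfl⟩
  exact Submodule.add_mem_sup ⟨v, rfl⟩ ⟨v, rfl⟩

lemma aux_adj {K : Type*} [Field K] {n : ℕ} (A : Matrix (Fin (n+1)) (Fin (n+1)) K) (h : A.rank < n) :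
    A.adjugate = 0 := by
  ext i j
  rw [Matrix.adjugate_apply]
  by_contra hne
  have h1 := Matrix.rank_of_det_ne_zero hne
  have h2 : A.updateRow j (Pi.single i 1) = A + vecMulVec (Pi.single j 1) (Pi.single i 1 - A j) := by
    ext r s
    by_cases hr : r = j
    · subst hr; simp [vecMulVec_apply]
    · simp [vecMulVec_apply, hr]
  have h3 := aux_rank_add A (vecMulVec (Pi.single j 1) (Pi.single i 1 - A j))
  have h4 := rank_vecMulVec_le (Pi.single j 1) (Pi.single i 1 - A j)
  rw [← h2, h1] at h3
  simp at h3
  omega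

lemma aux_singular {K : Type*} [Field K] {n : ℕ} (A : Matrix (Fin n) (Fin n) K) (h : A.det = 0) :
    A.rank + 1 ≤ n := by
  by_contra hh
  have h1 : A.rank = n := le_antisymm (by simpa using A.rank_le_card_width) (by omega)
  have h2 : LinearMap.range A.mulVecLin = ⊤ := by
    apply Submodule.eq_top_of_finrank_eq
    simpa [Matrix.rank] using h1
  have h3 := LinearMap.range_eq_top.1 h2
  have : IsUnit A := by
    rw [← Matrix.mulVec_surjective_iff_isUnit]; exact h3
  rw [Matrix.isUnit_iff_isUnit_det, h] at this
  simp at this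

lemma aux_block {K : Type*} [Field K] {m n : Type*} [Fintype m] [Fintype n] [DecidableEq m] [DecidableEq n]
    (A : Matrix m m K) (B : Matrix n n K) :
    (fromBlocks A 0 0 B).rank ≤ A.rank + B.rank := by
  have e : fromBlocks A 0 0 B = (fromRows (1 : Matrix m m K) (0 : Matrix n m K) : Matrix (m ⊕ n) m K) * A *
      (fromCols (1 : Matrix m m K) (0 : Matrix m n K) : Matrix m (m ⊕ n) K)
      + (fromRows (0 : Matrix m n K) (1 : Matrix n n K) : Matrix (m ⊕ n) n K) * B *
      (fromCols (0 : Matrix n m K) (1 : Matrix n n K) : Matrix n (m ⊕ n) K) := by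
    rw [fromRows_mul, fromRows_mul, mul_fromCols, mul_fromCols]
    ext (i | i) (j | j) <;> simp
  rw [e]
  refine (aux_rank_add _ _).trans (add_le_add ?_ ?_)
  · exact (rank_mul_le_left _ _).trans (rank_mul_le_right _ _)
  · exact (rank_mul_le_left _ _).trans (rank_mul_le_right _ _)

open MvPolynomial in
lemma aux_dim {k : Type*} [Field k] (I J : Ideal (MvPolynomial (Fin 2) k)) [hI : I.IsPrime] [hJ : J.IsPrime]
    (hIJ : I < J) (hI0 : I ≠ ⊥) : ∃ P, Prime P ∧ I = Ideal.span {P} := by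
  obtain ⟨P, hPI, hP⟩ := hI.exists_mem_prime_of_ne_bot hI0
  refine ⟨P, hP, ?_⟩
  by_contra hne
  have hlt : Ideal.span {P} < I := lt_of_le_of_ne ((Ideal.span_singleton_le_iff_mem I).2 hPI) (Ne.symm hne)
  have hPp : (Ideal.span {P}).IsPrime := (Ideal.span_singleton_prime hP.ne_zero).2 hP
  have hbp : (⊥ : Ideal (MvPolynomial (Fin 2) k)).IsPrime := Ideal.isPrime_bot
  have hb : (⊥ : Ideal (MvPolynomial (Fin 2) k)) < Ideal.span {P} := by
    rw [bot_lt_iff_ne_bot]; simpa using hP.ne_zero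
  let s : LTSeries (PrimeSpectrum (MvPolynomial (Fin 2) k)) :=
    { length := 3
      toFun := ![⟨⊥, hbp⟩, ⟨_, hPp⟩, ⟨I, hI⟩, ⟨J, hJ⟩]
      step := by
        intro i
        fin_cases i
        · exact hb
        · exact hlt
        · exact hIJ }
  have h1 := Order.LTSeries.length_le_krullDim s
  have h2 : ringKrullDim (MvPolynomial (Fin 2) k) = 2 := by
    rw [MvPolynomial.ringKrullDim_of_isNoetherianRing]; simp
  unfold ringKrullDim at h2
  rw [h2] at h1
  have h3 : ((3:ℕ) : WithBot ℕ∞) ≤ ((2:ℕ) : WithBot ℕ∞) := h1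
  rw [Nat.cast_le] at h3
  omega

open MvPolynomial in
lemma aux_forward (k : Type*) [Field k] (n : ℕ)
    (f : MvPolynomial (Fin 2) k) (hf0 : f ≠ 0) (hsq : Squarefree f)
    (M₀ M₁ : Matrix (Fin (n + 1)) (Fin (n + 1)) k) (c : kˣ)
    (hc : ((X 0 : MvPolynomial (Fin 2) k) • M₀.map (C : k → MvPolynomial (Fin 2) k)
          + (X 1 : MvPolynomial (Fin 2) k) • M₁.map (C : k → MvPolynomial (Fin 2) k)).det = C (c : k) * f)
    (a b : AlgebraicClosure k) (hab : (a, b) ≠ (0, 0)) :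
    n ≤ (a • M₀.map (algebraMap k (AlgebraicClosure k))
          + b • M₁.map (algebraMap k (AlgebraicClosure k))).rank := by
  by_contra hr
  push Not at hr
  set N := a • M₀.map (algebraMap k (AlgebraicClosure k))
          + b • M₁.map (algebraMap k (AlgebraicClosure k)) with hN
  set M := ((X 0 : MvPolynomial (Fin 2) k) • M₀.map (C : k → MvPolynomial (Fin 2) k)
          + (X 1 : MvPolynomial (Fin 2) k) • M₁.map (C : k → MvPolynomial (Fin 2) k)) with hM
  let φ : MvPolynomial (Fin 2) k →ₐ[k] Polynomial (AlgebraicClosure k) :=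
    aeval ![Polynomial.C a * Polynomial.X, Polynomial.C b * Polynomial.X]
  let ψ : MvPolynomial (Fin 2) k →ₐ[k] k := aeval 0
  have hφM : φ.mapMatrix M = (Polynomial.X : Polynomial (AlgebraicClosure k)) • N.map (Polynomial.C : AlgebraicClosure k → Polynomial (AlgebraicClosure k)) := by
    ext1 i j
    simp [hM, hN, φ, IsScalarTower.algebraMap_apply k (AlgebraicClosure k) (Polynomial (AlgebraicClosure k))]
    ring
  have hφadj : φ.mapMatrix M.adjugate = 0 := by
    rw [AlgHom.map_adjugate, hφM, adjugate_smul]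
    have := RingHom.map_adjugate (Polynomial.C : AlgebraicClosure k →+* _) N
    rw [aux_adj N hr] at this
    simp only [RingHom.mapMatrix_apply] at this
    rw [← this]; simp
  have hIJ : RingHom.ker φ < RingHom.ker ψ := by
    refine lt_of_le_of_ne ?_ ?_
    · intro p hp
      have hp' : φ p = 0 := hp
      have key : (Polynomial.aeval (0 : AlgebraicClosure k)).toRingHom.comp φ.toRingHom =
        (algebraMap k (AlgebraicClosure k)).comp ψ.toRingHom := by
        apply MvPolynomial.ringHom_ext
        · intro r
          simp [φ, ψ, IsScalarTower.algebraMap_apply k (AlgebraicClosure k) (Polynomial (AlgebraicClosure k))]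
        · intro i
          fin_cases i <;> simp [φ, ψ]
      have h2 := congrArg (fun g => g p) key
      simp [hp'] at h2
      exact (algebraMap k (AlgebraicClosure k)).injective (h2.symm.trans (map_zero _).symm)
    · intro heq
      have h0 : (X 0 : MvPolynomial (Fin 2) k) ∈ RingHom.ker φ := by
        rw [heq]; simp [RingHom.mem_ker, ψ]
      have h1 : (X 1 : MvPolynomial (Fin 2) k) ∈ RingHom.ker φ := by
        rw [heq]; simp [RingHom.mem_ker, ψ]
      simp [RingHom.mem_ker, φ] at h0 h1
      exact hab (by simp [h0, h1])
  have hMadj : M.det • (1 : Matrix (Fin (n+1)) (Fin (n+1)) _) = M * M.adjugate := (mul_adjugate M).symm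
  have hfI : f ∈ RingHom.ker φ := by
    have h1 : φ M.det = 0 := by
      rw [AlgHom.map_det, hφM, det_smul]
      have : N.det = 0 := by
        by_contra h
        have := rank_of_det_ne_zero h
        simp at this; omega
      have h2 := RingHom.map_det (Polynomial.C : AlgebraicClosure k →+* _) N
      rw [this] at h2
      simp only [RingHom.mapMatrix_apply] at h2
      rw [← h2]; simp
    rw [hc, map_mul] at h1
    rcases mul_eq_zero.1 h1 with h | h
    · exfalso
      have : (C (c:k) : MvPolynomial (Fin 2) k) = algebraMap k _ (c:k) := rfl
      rw [this, AlgHom.commutes] at h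
      have := (algebraMap k (Polynomial (AlgebraicClosure k))).injective (h.trans (map_zero _).symm)
      exact c.ne_zero this
    · exact h
  have : (RingHom.ker φ).IsPrime := RingHom.ker_isPrime φ.toRingHom
  have : (RingHom.ker ψ).IsPrime := RingHom.ker_isPrime ψ.toRingHom
  obtain ⟨P, hP, hIP⟩ := aux_dim (RingHom.ker φ) (RingHom.ker ψ) hIJ (by
    intro h; rw [h] at hfI; exact hf0 (by simpa using hfI))
  have hdiv : ∀ i j, ∃ q, M.adjugate i j = P * q := by
    intro i j
    have : M.adjugate i j ∈ RingHom.ker φ := congrFun (congrFun hφadj i) j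
    rw [hIP, Ideal.mem_span_singleton] at this
    exact this
  choose B hB using hdiv
  have hB' : M.adjugate = P • Matrix.of B := by
    ext1 i j; simp [hB]
  have hdet := det_adjugate M
  rw [hB', det_smul, hc] at hdet
  simp at hdet
  rw [hIP, Ideal.mem_span_singleton] at hfI
  obtain ⟨g, hg⟩ := hfI
  have hPg : ¬ P ∣ g := by
    rintro ⟨q, rfl⟩
    exact hP.not_isUnit (hsq P ⟨q, by rw [hg]; ring⟩)
  have hcancel : P * (of B).det = C (c:k) ^ n * g ^ n := by
    apply mul_left_cancel₀ (pow_ne_zero n hP.ne_zero)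
    rw [← mul_assoc, ← pow_succ, hdet, hg]; ring
  have hd : P ∣ C (c:k) ^ n * g ^ n := ⟨_, hcancel.symm⟩
  rcases hP.dvd_or_dvd hd with h | h
  · have hu : IsUnit (C (c:k) : MvPolynomial (Fin 2) k) := c.isUnit.map C
    exact hP.not_isUnit (isUnit_of_dvd_unit h (hu.pow n))
  · exact hPg (hP.dvd_of_dvd_pow h)

def bord {R : Type*} [CommRing R] {m : ℕ} (d z : R) (T : Matrix (Fin (m+1)) (Fin (m+1)) R) :
    Matrix (Fin (m+2)) (Fin (m+2)) R :=
  Matrix.of fun i j => Fin.cases (Fin.cases d (fun j => if j = 0 then z else 0) j)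
    (fun i => Fin.cases (if i = 0 then z else 0) (fun j => T i j) j) i

section
variable {R : Type*} [CommRing R] {m : ℕ} (d z : R) (T : Matrix (Fin (m+1)) (Fin (m+1)) R)
lemma bord_00 : bord d z T 0 0 = d := rfl
lemma bord_0s (j) : bord d z T 0 (Fin.succ j) = if j = 0 then z else 0 := rfl
lemma bord_s0 (j) : bord d z T (Fin.succ j) 0 = if j = 0 then z else 0 := rfl
lemma bord_ss (i j) : bord d z T (Fin.succ i) (Fin.succ j) = T i j := rfl

lemma bord_sub : (bord d z T).submatrix Fin.succ Fin.succ = T := rfl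

lemma bord_det : (bord d z T).det = d * T.det - z ^ 2 * (T.submatrix Fin.succ Fin.succ).det := by
  have h1 : ((bord d z T).submatrix Fin.succ (Fin.succAbove 1)).det
      = z * (T.submatrix Fin.succ Fin.succ).det := by
    rw [det_succ_column_zero, Fin.sum_univ_succ, Finset.sum_eq_zero]
    · have : (((bord d z T).submatrix Fin.succ (Fin.succAbove 1)).submatrix (Fin.succAbove 0) Fin.succ)
          = T.submatrix Fin.succ Fin.succ := by
        ext i j
        have : (Fin.succAbove 1 (Fin.succ j) : Fin (m+2)) = j.succ.succ := by
          rw [← Fin.succ_zero_eq_one, Fin.succ_succAbove_succ]; simp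
        simp [this, bord_ss]
      rw [this]
      have h0 : (Fin.succAbove 1 0 : Fin (m+2)) = 0 := by simp
      have h1 : bord d z T 1 0 = z := rfl
      simp [h0, h1]
    · intro i _
      have h0 : (Fin.succAbove 1 0 : Fin (m+2)) = 0 := by simp
      simp [h0, bord_s0]
  rw [det_succ_row_zero, Fin.sum_univ_succ, Fin.sum_univ_succ, Finset.sum_eq_zero]
  · have h2 : (bord d z T).submatrix Fin.succ (Fin.succAbove 0) = T := rfl
    rw [h2, Fin.succ_zero_eq_one, h1]
    have : bord d z T 0 1 = z := rfl
    rw [this, bord_00]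
    simp; ring
  · intro i _
    simp [bord_0s]

lemma bord_symm (h : T.IsSymm) : (bord d z T).IsSymm := by
  apply Matrix.IsSymm.ext
  intro i j
  refine Fin.cases ?_ (fun i => ?_) i <;> refine Fin.cases ?_ (fun j => ?_) j
  · rfl
  · rfl
  · rfl
  · simp [bord_ss, h.apply]
end

open MvPolynomial

def IsLin {k : Type*} [Field k] (p : MvPolynomial (Fin 2) k) : Prop := ∃ a b, p = C a * X 0 + C b * X 1

lemma bord_lin {k : Type*} [Field k] {m : ℕ} (d z : MvPolynomial (Fin 2) k)
    (T : Matrix (Fin (m+1)) (Fin (m+1)) (MvPolynomial (Fin 2) k)) (hd : IsLin d) (hz : IsLin z)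
    (hT : ∀ i j, IsLin (T i j)) (i j) : IsLin (bord d z T i j) := by
  have h0 : IsLin (0 : MvPolynomial (Fin 2) k) := ⟨0, 0, by simp⟩
  refine Fin.cases ?_ (fun i => ?_) i <;> refine Fin.cases ?_ (fun j => ?_) j
  · exact hd
  · rw [bord_0s]; split_ifs <;> assumption
  · rw [bord_s0]; split_ifs <;> assumption
  · exact hT i j

noncomputable def bform {k : Type*} [Field k] (e : ℕ) (c : ℕ → k) : MvPolynomial (Fin 2) k :=
  ∑ i ∈ Finset.range (e+1), C (c i) * X 0 ^ i * X 1 ^ (e - i)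

section
variable {k : Type*} [Field k]

lemma bform_step (e : ℕ) (c : ℕ → k) : bform (e+2) c = X 1 ^ 2 * bform e c
    + (C (c (e+2)) * X 0 + C (c (e+1)) * X 1) * X 0 ^ (e+1) := by
  unfold bform
  rw [Finset.sum_range_succ, Finset.sum_range_succ, Finset.mul_sum]
  have : ∀ i ∈ Finset.range (e+1), C (c i) * X 0 ^ i * X 1 ^ (e + 2 - i)
      = X 1 ^ 2 * (C (c i) * X 0 ^ i * X 1 ^ (e - i) : MvPolynomial (Fin 2) k) := by
    intro i hi
    have : e + 2 - i = (e - i) + 2 := by have := Finset.mem_range.1 hi; omega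
    rw [this]; ring
  rw [Finset.sum_congr rfl this]
  have h1 : e + 2 - (e+1) = 1 := by omega
  rw [h1]; simp; ring

lemma bform_zero (e : ℕ) (c : ℕ → k) (h : c 0 = 0) : bform (e+1) c = X 0 * bform e (fun i => c (i+1)) := by
  unfold bform
  rw [Finset.sum_range_succ', Finset.mul_sum]
  simp [h]
  refine Finset.sum_congr rfl fun i _ => ?_
  ring

lemma exists_bform (e : ℕ) (f : MvPolynomial (Fin 2) k) (hf : f.IsHomogeneous e) : ∃ c, f = bform e c := by
  refine ⟨fun i => coeff (Finsupp.single 0 i + Finsupp.single 1 (e - i)) f, ?_⟩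
  have hm : ∀ i, (C (coeff (Finsupp.single 0 i + Finsupp.single 1 (e - i)) f) * X 0 ^ i * X 1 ^ (e - i) : MvPolynomial (Fin 2) k)
     = monomial (Finsupp.single 0 i + Finsupp.single 1 (e - i)) (coeff (Finsupp.single 0 i + Finsupp.single 1 (e - i)) f) := by
    intro i
    rw [X_pow_eq_monomial, X_pow_eq_monomial, C_mul_monomial, monomial_mul]; simp
  unfold bform
  simp only [hm]
  ext m
  rw [coeff_sum]
  simp only [coeff_monomial]
  by_cases hd : m.degree = e
  · have hm01 : m 0 + m 1 = e := by
      rw [← hd, Finsupp.degree_eq_sum]; simp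
    have hmm : Finsupp.single 0 (m 0) + Finsupp.single 1 (e - m 0) = m := by
      ext i; fin_cases i <;> simp; omega
    rw [Finset.sum_eq_single (m 0)]
    · rw [if_pos hmm, hmm]
    · intro i _ hi
      rw [if_neg]
      intro h
      apply hi
      rw [← h]; simp
    · intro h; simp at h; omega
  · rw [hf.coeff_eq_zero hd, Finset.sum_eq_zero]
    intro i hi
    rw [if_neg]
    rintro rfl
    apply hd
    simp at hi
    rw [Finsupp.degree_eq_sum]; simp; omega

lemma isLin_smul (a : k) {p : MvPolynomial (Fin 2) k} (h : IsLin p) : IsLin (C a * p) := by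
  obtain ⟨u, v, rfl⟩ := h
  exact ⟨a * u, a * v, by simp; ring⟩
lemma isLin_X0 : IsLin (X 0 : MvPolynomial (Fin 2) k) := ⟨1, 0, by simp⟩
lemma isLin_X1 : IsLin (X 1 : MvPolynomial (Fin 2) k) := ⟨0, 1, by simp⟩
lemma isLin_0 : IsLin (0 : MvPolynomial (Fin 2) k) := ⟨0, 0, by simp⟩

lemma repQ (c : ℕ → k) (h0 : c 0 ≠ 0) : ∀ e : ℕ, ∃ T : Matrix (Fin (e+1)) (Fin (e+1)) (MvPolynomial (Fin 2) k),
    T.IsSymm ∧ (∀ i j, IsLin (T i j)) ∧ ∃ u v : k, u ≠ 0 ∧ v ≠ 0 ∧ T.det = C u * bform (e+1) c ∧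
      (T.submatrix Fin.succ Fin.succ).det = C v * X 0 ^ e
  | 0 => by
    refine ⟨Matrix.of fun _ _ => bform 1 c, ?_, ?_, 1, 1, one_ne_zero, one_ne_zero, ?_, ?_⟩
    · rfl
    · intro i j
      refine ⟨c 1, c 0, ?_⟩
      simp [bform, Finset.sum_range_succ, add_comm]
    · simp
    · simp
  | 1 => by
    refine ⟨bord (C (c 2) * X 0 + C (c 1) * X 1) (C (c 0) * X 1) (Matrix.of fun _ _ => C (- c 0) * X 0),
      bord_symm _ _ _ rfl, bord_lin _ _ _ ⟨_, _, rfl⟩ (isLin_smul _ isLin_X1)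
        (fun _ _ => isLin_smul _ isLin_X0), - c 0, - c 0, neg_ne_zero.2 h0, neg_ne_zero.2 h0, ?_, ?_⟩
    · rw [bord_det]
      simp [bform, Finset.sum_range_succ]
      ring
    · rw [bord_sub]; simp
  | (e+2) => by
    obtain ⟨T, hs, hl, u, v, hu, hv, hdet, hmin⟩ := repQ c h0 e
    refine ⟨bord (C (u / v) * (C (c (e+3)) * X 0 + C (c (e+2)) * X 1)) (X 1) (bord 0 (X 0) T),
      bord_symm _ _ _ (bord_symm _ _ _ hs), bord_lin _ _ _ (isLin_smul _ ⟨_, _, rfl⟩) isLin_X1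
        (bord_lin _ _ _ isLin_0 isLin_X0 hl), -u, -v, neg_ne_zero.2 hu, neg_ne_zero.2 hv, ?_, ?_⟩
    · rw [bord_det, bord_det, bord_sub, hmin, hdet, bform_step (e+1)]
      have : (C u : MvPolynomial (Fin 2) k) = C (u / v) * C v := by
        rw [← C_mul, div_mul_cancel₀ _ hv]
      rw [C_neg, this]; ring
    · rw [bord_sub, bord_det, hmin]; simp; ring

def DRep (e : ℕ) (g : MvPolynomial (Fin 2) k) (S : Matrix (Fin e) (Fin e) (MvPolynomial (Fin 2) k)) : Prop :=
  S.IsSymm ∧ (∀ i j, IsLin (S i j)) ∧ ∃ u : k, u ≠ 0 ∧ S.det = C u * g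

def bsum {d e : ℕ} {R : Type*} [CommRing R] (S : Matrix (Fin d) (Fin d) R) (T : Matrix (Fin e) (Fin e) R) :
    Matrix (Fin (d+e)) (Fin (d+e)) R := Matrix.reindex finSumFinEquiv finSumFinEquiv (fromBlocks S 0 0 T)

lemma DRep.bsum {d e : ℕ} {g h : MvPolynomial (Fin 2) k} {S T} (hS : DRep d g S) (hT : DRep e h T) :
    DRep (d+e) (g * h) (bsum S T) := by
  obtain ⟨s1, l1, u, hu, d1⟩ := hS
  obtain ⟨s2, l2, v, hv, d2⟩ := hT
  refine ⟨?_, ?_, u * v, mul_ne_zero hu hv, ?_⟩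
  · have := Matrix.IsSymm.fromBlocks s1 (show (0 : Matrix (Fin d) (Fin e) (MvPolynomial (Fin 2) k))ᵀ = 0 by simp) s2
    exact this.submatrix _
  · intro i j
    simp only [_root_.bsum, reindex_apply, submatrix_apply]
    rcases finSumFinEquiv.symm i with i | i <;> rcases finSumFinEquiv.symm j with j | j
    · exact l1 _ _
    · exact isLin_0
    · exact isLin_0
    · exact l2 _ _
  · simp only [_root_.bsum, det_reindex_self]
    rw [det_fromBlocks_zero₂₁, d1, d2, C_mul]; ring

lemma exists_rep : ∀ (e : ℕ) (c : ℕ → k), bform e c ≠ 0 → ∃ S, DRep e (bform e c) S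
  | 0, c, h => by
    refine ⟨0, by ext i; exact i.elim0, fun i => i.elim0, (c 0)⁻¹, ?_, ?_⟩
    · intro h'; apply h; simp [bform] at h' ⊢; exact h'
    · have : c 0 ≠ 0 := by rintro h'; apply h; simp [bform, h']
      simp [bform, ← C_mul, this]
  | e+1, c, h => by
    by_cases h0 : c 0 = 0
    · rw [bform_zero e c h0] at h ⊢
      obtain ⟨S, hS⟩ := exists_rep e _ (right_ne_zero_of_mul h)
      have hX : DRep 1 (X 0 : MvPolynomial (Fin 2) k) (Matrix.of fun _ _ => X 0) :=
        ⟨rfl, fun _ _ => isLin_X0, 1, one_ne_zero, by simp⟩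
      have := hX.bsum hS
      rw [add_comm e 1]
      exact ⟨_, this⟩
    · obtain ⟨T, hs, hl, u, v, hu, hv, hdet, hmin⟩ := repQ c h0 e
      exact ⟨T, hs, hl, u, hu, hdet⟩

lemma bform_root (d : ℕ) (hd : 1 ≤ d) (c : ℕ → k) : ∃ a b : AlgebraicClosure k, (a, b) ≠ (0, 0) ∧
    aeval ![a, b] (bform d c) = 0 := by
  by_cases h : c d = 0
  · refine ⟨1, 0, by simp, ?_⟩
    simp only [bform, map_sum]
    refine Finset.sum_eq_zero fun i hi => ?_
    by_cases hid : i = d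
    · subst hid; simp [h]
    · have : d - i ≠ 0 := by have := Finset.mem_range.1 hi; omega
      simp [this]
  · let p : Polynomial (AlgebraicClosure k) :=
      ∑ i ∈ Finset.range (d+1), Polynomial.C (algebraMap k (AlgebraicClosure k) (c i)) * Polynomial.X ^ i
    have hco : p.coeff d ≠ 0 := by
      simp [p, Polynomial.finsetSum_coeff, Polynomial.coeff_C_mul, Polynomial.coeff_X_pow, h]
    have hdeg : p.degree ≠ 0 := by
      have := Polynomial.le_degree_of_ne_zero hco
      intro h'
      rw [h'] at this
      have h2 : d ≤ 0 := by exact_mod_cast this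
      omega
    obtain ⟨a, ha⟩ := IsAlgClosed.exists_root p hdeg
    refine ⟨a, 1, by simp, ?_⟩
    simpa [bform, p, Polynomial.eval_finsetSum] using ha

lemma hc_mul (a b : ℕ) (p q : MvPolynomial (Fin 2) k) (hp : p.totalDegree ≤ a) (hq : q.totalDegree ≤ b) :
    homogeneousComponent (a+b) (p*q) = homogeneousComponent a p * homogeneousComponent b q := by
  have key : ∀ (n : ℕ) (p : MvPolynomial (Fin 2) k), p.totalDegree ≤ n →
      p = ∑ i ∈ Finset.range (n+1), homogeneousComponent i p := by
    intro n p h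
    conv_lhs => rw [← sum_homogeneousComponent p]
    apply Finset.sum_subset
    · intro i; simp; omega
    · intro i _ hi
      apply homogeneousComponent_eq_zero
      simp at hi; omega
  conv_lhs => rw [key a p hp, key b q hq]
  rw [Finset.sum_mul_sum, map_sum]
  simp only [map_sum]
  have hterm : ∀ i j, homogeneousComponent (a+b) (homogeneousComponent i p * homogeneousComponent j q)
     = if i + j = a + b then homogeneousComponent i p * homogeneousComponent j q else 0 := by
    intro i j
    rw [homogeneousComponent_of_mem (n := i+j)]
    · simp [eq_comm]
    · exact (homogeneousComponent_isHomogeneous i p).mul (homogeneousComponent_isHomogeneous j q)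
  simp only [hterm]
  rw [Finset.sum_eq_single a, Finset.sum_eq_single b]
  · simp
  · intro j hj hjb; rw [if_neg]; omega
  · simp
  · intro i hi hia
    refine Finset.sum_eq_zero fun j hj => ?_
    simp at hi hj
    rw [if_neg]; omega
  · simp


lemma aux_back (n : ℕ) (f : MvPolynomial (Fin 2) k) (hf0 : f ≠ 0) (hfh : f.IsHomogeneous (n + 1))
    (hns : ¬ Squarefree f) : ∃ S, DRep (n+1) f S ∧ ∃ a b : AlgebraicClosure k, (a, b) ≠ (0, 0) ∧
      (S.map (aeval ![a, b] : MvPolynomial (Fin 2) k →ₐ[k] AlgebraicClosure k)).rank + 2 ≤ n + 1 := by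
  unfold Squarefree at hns
  push Not at hns
  obtain ⟨h, ⟨g, hg⟩, hu⟩ := hns
  have hhg : h * (h * g) ≠ 0 := by rw [← mul_assoc, ← hg]; exact hf0
  have hh0 : h ≠ 0 := left_ne_zero_of_mul hhg
  have hg' : h * g ≠ 0 := right_ne_zero_of_mul hhg
  have hg0 : g ≠ 0 := right_ne_zero_of_mul hg'
  have hd1 : 1 ≤ h.totalDegree := by
    by_contra hlt
    have h0 : h.totalDegree = 0 := by omega
    rw [totalDegree_eq_zero_iff_eq_C] at h0
    apply hu
    rw [h0]
    apply IsUnit.map C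
    rw [isUnit_iff_ne_zero]
    intro hz
    rw [hz] at h0
    simp at h0
    exact hh0 h0
  have hN : h.totalDegree + (h.totalDegree + g.totalDegree) = n + 1 := by
    rw [← hfh.totalDegree hf0, hg, mul_assoc, totalDegree_mul_of_isDomain hh0 hg',
      totalDegree_mul_of_isDomain hh0 hg0]
  have hf : f = homogeneousComponent h.totalDegree h *
      (homogeneousComponent h.totalDegree h * homogeneousComponent g.totalDegree g) := by
    rw [← hc_mul _ _ h g le_rfl le_rfl, ← hc_mul _ _ h (h * g) le_rfl (totalDegree_mul _ _), hN,
      ← mul_assoc, ← hg, homogeneousComponent_eq_self hfh]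
  obtain ⟨c, hc⟩ := exists_bform _ _ (homogeneousComponent_isHomogeneous h.totalDegree h)
  obtain ⟨c', hc'⟩ := exists_bform _ _ (homogeneousComponent_isHomogeneous g.totalDegree g)
  rw [hc, hc'] at hf
  generalize h.totalDegree = d at *
  generalize g.totalDegree = e at *
  have hn1 : bform d c ≠ 0 := by rw [hf] at hf0; exact left_ne_zero_of_mul hf0
  have hn2 : bform e c' ≠ 0 := by
    rw [hf] at hf0; exact right_ne_zero_of_mul (right_ne_zero_of_mul hf0)
  obtain ⟨S, hS⟩ := exists_rep d c hn1
  obtain ⟨T, hT⟩ := exists_rep e c' hn2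
  obtain ⟨a, b, hab, hroot⟩ := bform_root d hd1 c
  rw [← hN, hf]
  refine ⟨_, hS.bsum (hS.bsum hT), a, b, hab, ?_⟩
  let φ : MvPolynomial (Fin 2) k →ₐ[k] AlgebraicClosure k := aeval ![a, b]
  have hsing : (S.map φ).rank + 1 ≤ d := by
    apply aux_singular
    have := AlgHom.map_det φ S
    rw [AlgHom.mapMatrix_apply] at this
    rw [← this]
    obtain ⟨_, _, u, _, hdet⟩ := hS
    rw [hdet, map_mul]
    simp only [φ, hroot, mul_zero]
  have hb : ∀ {p q : ℕ} (A : Matrix (Fin p) (Fin p) (MvPolynomial (Fin 2) k)) (B : Matrix (Fin q) (Fin q) (MvPolynomial (Fin 2) k)),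
      ((bsum A B).map φ).rank ≤ (A.map φ).rank + (B.map φ).rank := by
    intro p q A B
    refine le_trans (le_of_eq ?_) (aux_block (A.map φ) (B.map φ))
    rw [← rank_reindex finSumFinEquiv finSumFinEquiv (fromBlocks (A.map φ) 0 0 (B.map φ))]
    congr 1
    simp only [bsum, reindex_apply, ← submatrix_map, fromBlocks_map]
    simp [Matrix.map_zero]
  have h1 := hb S (bsum S T)
  have h2 := hb S T
  have h3 : (T.map φ).rank ≤ e := by simpa using (T.map φ).rank_le_card_width
  change ((bsum S (bsum S T)).map φ).rank + 2 ≤ _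
  omega

end

theorem squarefree_iff_all_pairs_regular
    (k : Type*) [Field k] (n : ℕ) (hn : 1 ≤ n)
    (f : MvPolynomial (Fin 2) k) (hf0 : f ≠ 0) (hfh : f.IsHomogeneous (n + 1)) :
    Squarefree f ↔
    ∀ M₀ M₁ : Matrix (Fin (n + 1)) (Fin (n + 1)) k, M₀.IsSymm → M₁.IsSymm →
      (∃ c : kˣ,
        ((MvPolynomial.X 0 : MvPolynomial (Fin 2) k) •
            M₀.map (MvPolynomial.C : k → MvPolynomial (Fin 2) k)
          + (MvPolynomial.X 1 : MvPolynomial (Fin 2) k) •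
            M₁.map (MvPolynomial.C : k → MvPolynomial (Fin 2) k)).det
          = MvPolynomial.C (c : k) * f) →
      ∀ a b : AlgebraicClosure k, (a, b) ≠ (0, 0) →
        n ≤ (a • M₀.map (algebraMap k (AlgebraicClosure k))
          + b • M₁.map (algebraMap k (AlgebraicClosure k))).rank := by
  constructor
  · rintro hsq M₀ M₁ _ _ ⟨c, hc⟩ a b hab
    exact aux_forward k n f hf0 hsq M₀ M₁ c hc a b hab
  · intro H
    by_contra hns
    obtain ⟨S, ⟨hs, hl, u, hu, hdet⟩, a, b, hab, hr⟩ := aux_back n f hf0 hfh hns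
    have hl' : ∀ i j, S i j = C (coeff (Finsupp.single 0 1) (S i j)) * X 0
        + C (coeff (Finsupp.single 1 1) (S i j)) * X 1 := by
      intro i j
      obtain ⟨x, y, hxy⟩ := hl i j
      have h01 : (Finsupp.single 0 1 : Fin 2 →₀ ℕ) ≠ Finsupp.single 1 1 := by
        intro h; have := DFunLike.congr_fun h 0; simp at this
      rw [hxy]
      simp [coeff_X', h01, h01.symm]
    have hS : (X 0 : MvPolynomial (Fin 2) k) • (S.map (coeff (Finsupp.single 0 1))).map (C : k → MvPolynomial (Fin 2) k)
          + (X 1 : MvPolynomial (Fin 2) k) • (S.map (coeff (Finsupp.single 1 1))).map (C : k → MvPolynomial (Fin 2) k) = S := by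
      ext1 i j
      conv_rhs => rw [hl' i j]
      simp [mul_comm]
    have := H (S.map (coeff (Finsupp.single 0 1))) (S.map (coeff (Finsupp.single 1 1)))
      (hs.map _) (hs.map _) ⟨Units.mk0 u hu, by rw [hS, hdet]; rfl⟩ a b hab
    have hev : S.map (aeval ![a, b] : MvPolynomial (Fin 2) k →ₐ[k] AlgebraicClosure k)
        = a • (S.map (coeff (Finsupp.single 0 1))).map (algebraMap k (AlgebraicClosure k))
          + b • (S.map (coeff (Finsupp.single 1 1))).map (algebraMap k (AlgebraicClosure k)) := by
      ext1 i j
      rw [map_apply, hl' i j]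
      simp [mul_comm]
    rw [hev] at hr
    omega
end
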